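/- arXiv:1202.3219 — 2 statements merged into one kernel-verified Lean document; each statement's English description precedes it below -/
import Mathlib

section
/- Let 𝓞 be the ring of integers of the imaginary quadratic field ℚ(√-6), and let Γ = SL₂(𝓞). Then the first group homology of Γ with trivial rational coefficients is isomorphic to ℚ²; equivalently, ℚ ⊗_ℤ Abelianization(Γ) is a ℚ-vector space of dimension 2. -/
open NumberField Matrix TensorProduct

namespace BianchiSqrtNegSix

/-- If the trace `2 * p` and the norm `p ^ 2 + 6 * q ^ 2` of `p + q√-6` are integers, then so are
`p` and `q`. -/
theorem exists_int_of_trace_norm {p q : ℚ} {t n : ℤ} (ht : 2 * p = t)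
    (hn : p ^ 2 + 6 * q ^ 2 = n) : ∃ a b : ℤ, p = a ∧ q = b := by
  have hr : IsIntegral ℤ (12 * q) := by
    refine IsIntegral.of_pow (n := 2) two_pos ?_
    have h : (12 * q) ^ 2 = algebraMap ℤ ℚ (6 * (4 * n - t ^ 2)) := by
      simp only [eq_intCast]; push_cast; rw [← ht, ← hn]; ring
    rw [h]
    exact isIntegral_algebraMap
  obtain ⟨r, hr⟩ := IsIntegrallyClosed.isIntegral_iff.mp hr
  rw [eq_intCast] at hr
  have h1 : r ^ 2 = 6 * (4 * n - t ^ 2) := by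
    have : (r : ℚ) ^ 2 = 6 * (4 * n - t ^ 2) := by rw [hr, ← ht, ← hn]; ring
    exact_mod_cast this
  obtain ⟨s, rfl⟩ : (6 : ℤ) ∣ r := by
    have h2 : (2 : ℤ) ∣ r := Int.prime_two.dvd_of_dvd_pow (n := 2) ⟨3 * (4 * n - t ^ 2), by lia⟩
    have h3 : (3 : ℤ) ∣ r := Int.prime_three.dvd_of_dvd_pow (n := 2) ⟨2 * (4 * n - t ^ 2), by lia⟩
    lia
  have h2 : 6 * s ^ 2 + t ^ 2 = 4 * n := by lia
  obtain ⟨a, rfl | rfl⟩ := Int.even_or_odd' t <;>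
  obtain ⟨b, rfl | rfl⟩ := Int.even_or_odd' s
  · refine ⟨a, b, ?_, ?_⟩
    · push_cast at ht; linarith
    · push_cast at hr; linarith
  all_goals ring_nf at h2; lia

section RingOfIntegers

variable {K : Type*} [Field K] [NumberField K] {α : K}

theorem exists_rat_of_adjoin_eq_top (hα : α ^ 2 = -(6 : K)) (hgen : Algebra.adjoin ℚ {α} = ⊤)
    (x : K) : ∃ p q : ℚ, x = p + q * α := by
  have hx : x ∈ Algebra.adjoin ℚ {α} := hgen ▸ Algebra.mem_top
  induction hx using Algebra.adjoin_induction with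
  | mem y hy => exact ⟨0, 1, by simpa using hy⟩
  | algebraMap r => exact ⟨r, 0, by simp⟩
  | add y z _ _ hy hz =>
    obtain ⟨p, q, rfl⟩ := hy
    obtain ⟨p', q', rfl⟩ := hz
    exact ⟨p + p', q + q', by push_cast; ring⟩
  | mul y z _ _ hy hz =>
    obtain ⟨p, q, rfl⟩ := hy
    obtain ⟨p', q', rfl⟩ := hz
    exact ⟨p * p' - 6 * q * q', p * q' + q * p', by push_cast; linear_combination q * q' * hα⟩

open Polynomial in
theorem exists_int_of_isIntegral (hα : α ^ 2 = -(6 : K)) {p q : ℚ}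
    (h : IsIntegral ℤ ((p : K) + q * α)) : ∃ a b : ℤ, p = a ∧ q = b := by
  rcases eq_or_ne q 0 with rfl | hq
  · have hp : IsIntegral ℤ p := by
      rw [← isIntegral_algebraMap_iff (algebraMap ℚ K).injective]
      simpa using h
    obtain ⟨a, ha⟩ := IsIntegrallyClosed.isIntegral_iff.mp hp
    exact ⟨a, 0, by simpa using ha.symm, by simp⟩
  · set f : ℚ[X] := X ^ 2 + C (-(2 * p)) * X + C (p ^ 2 + 6 * q ^ 2) with hf
    have hm : f.Monic := by rw [hf]; monicity!
    have hd : f.natDegree = 2 := by rw [hf]; compute_degree!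
    have hirr : Irreducible f := by
      rw [hm.irreducible_iff_roots_eq_zero_of_degree_le_three hd.ge (by lia)]
      refine Multiset.eq_zero_of_forall_notMem fun r hr => ?_
      have h0 := (mem_roots'.mp hr).2.eq_zero
      simp only [hf, eval_add, eval_pow, eval_X, eval_mul, eval_C] at h0
      nlinarith [sq_nonneg (r - p), pow_pos (abs_pos.mpr hq) 2, sq_abs q]
    have hroot : aeval ((p : K) + q * α) f = 0 := by
      simp only [hf, map_add, map_mul, map_pow, aeval_X, aeval_C, eq_ratCast]
      push_cast
      linear_combination (q : K) ^ 2 * hα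
    have hmin := minpoly.eq_of_irreducible_of_monic hirr hroot hm
    rw [minpoly.isIntegrallyClosed_eq_field_fractions' ℚ h] at hmin
    refine exists_int_of_trace_norm (t := -(minpoly ℤ ((p : K) + q * α)).coeff 1)
      (n := (minpoly ℤ ((p : K) + q * α)).coeff 0) ?_ ?_
    · have := congrArg (fun g => coeff g 1) hmin
      simp only [hf, coeff_add, coeff_C_mul, coeff_X_pow, coeff_X_one, coeff_C_succ, coeff_map,
        eq_intCast] at this
      push_cast
      norm_num at this
      linarith
    · have := congrArg (fun g => coeff g 0) hmin
      simp only [hf, coeff_add, coeff_C_mul, coeff_X_pow, coeff_X_zero, coeff_C_zero, coeff_map,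
        eq_intCast] at this
      norm_num at this
      linarith

/-- The ring of integers of `ℚ(√-6)` is `ℤ[√-6]`. -/
theorem nonempty_ringEquiv_ringOfIntegers (hα : α ^ 2 = -(6 : K))
    (hgen : Algebra.adjoin ℚ {α} = ⊤) : Nonempty (𝓞 K ≃+* ℤ√(-6)) := by
  have hα_int : IsIntegral ℤ α := IsIntegral.of_pow (n := 2) two_pos (by
    rw [hα, show (-(6 : K)) = algebraMap ℤ K (-6) by simp]
    exact isIntegral_algebraMap)
  obtain ⟨β, hβα⟩ : ∃ β : 𝓞 K, algebraMap (𝓞 K) K β = α := ⟨⟨α, hα_int⟩, rfl⟩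
  have hβ : β * β = ((-6 : ℤ) : 𝓞 K) := by
    apply RingOfIntegers.ext
    rw [RingOfIntegers.coe_eq_algebraMap, map_mul, hβα, ← pow_two, hα,
      RingOfIntegers.coe_eq_algebraMap, map_intCast]
    norm_num
  refine ⟨(RingEquiv.ofBijective (Zsqrtd.lift ⟨β, hβ⟩)
    ⟨Zsqrtd.lift_injective _ fun n => by nlinarith [mul_self_nonneg n], fun x => ?_⟩).symm⟩
  obtain ⟨p, q, hx⟩ := exists_rat_of_adjoin_eq_top hα hgen (x : K)
  obtain ⟨a, b, rfl, rfl⟩ := exists_int_of_isIntegral hα (p := p) (q := q)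
    (by rw [← hx]; exact x.isIntegral_coe)
  refine ⟨⟨a, b⟩, RingOfIntegers.ext ?_⟩
  rw [hx]
  simp [hβα]

end RingOfIntegers

/-- The upper triangular unipotent matrix with off-diagonal entry `b`. -/
def translation (b : ℤ√(-6)) : SpecialLinearGroup (Fin 2) (ℤ√(-6)) :=
  ⟨!![1, b; 0, 1], by simp⟩

/-- The matrix acting on the Riemann sphere as `z ↦ -1/z`. -/
def inversion : SpecialLinearGroup (Fin 2) (ℤ√(-6)) :=
  ⟨!![0, -1; 1, 0], by simp⟩

/-- A matrix of order four sending `(1 + √-6)/2` to `∞`. -/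
def elliptic : SpecialLinearGroup (Fin 2) (ℤ√(-6)) :=
  ⟨!![⟨1, 1⟩, ⟨2, -1⟩; 2, ⟨-1, -1⟩], by rw [det_fin_two_of]; rfl⟩

/-- A hyperbolic matrix sending `5√-6/12` to `∞`. -/
def hyperbolic : SpecialLinearGroup (Fin 2) (ℤ√(-6)) :=
  ⟨!![5, ⟨0, -2⟩; ⟨0, 2⟩, 5], by rw [det_fin_two_of]; rfl⟩

theorem eq_of_coe_eq {g h : SpecialLinearGroup (Fin 2) (ℤ√(-6))}
    (e : (g : Matrix (Fin 2) (Fin 2) (ℤ√(-6))) = h) : g = h :=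
  Subtype.ext e

theorem coe_translation (b : ℤ√(-6)) :
    (translation b : Matrix (Fin 2) (Fin 2) (ℤ√(-6))) = !![1, b; 0, 1] := rfl

theorem coe_inversion :
    (inversion : Matrix (Fin 2) (Fin 2) (ℤ√(-6))) = !![0, -1; 1, 0] := rfl

theorem coe_elliptic : (elliptic : Matrix (Fin 2) (Fin 2) (ℤ√(-6))) =
    !![⟨1, 1⟩, ⟨2, -1⟩; 2, ⟨-1, -1⟩] := rfl

theorem coe_hyperbolic : (hyperbolic : Matrix (Fin 2) (Fin 2) (ℤ√(-6))) =
    !![5, ⟨0, -2⟩; ⟨0, 2⟩, 5] := rfl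

theorem coe_hyperbolic_inv : (↑(hyperbolic⁻¹) : Matrix (Fin 2) (Fin 2) (ℤ√(-6))) =
    !![5, ⟨0, 2⟩; ⟨0, -2⟩, 5] := by
  refine (Matrix.SpecialLinearGroup.coe_inv hyperbolic).trans ?_
  rw [coe_hyperbolic, adjugate_fin_two_of]
  rfl

/-- A fundamental rectangle for the translations is covered by open discs,
except for the singular point `√-6/2`. -/
theorem rat_disc_cover {x y : ℚ} (hx : 0 ≤ x) (hx' : 2 * x ≤ 1) (hy : 0 ≤ y) (hy' : 2 * y ≤ 1)
    (h₁ : 1 ≤ x ^ 2 + 6 * y ^ 2) (h₂ : 1 ≤ (2 * x - 1) ^ 2 + 6 * (2 * y - 1) ^ 2)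
    (h₃ : 1 ≤ (5 - 12 * y) ^ 2 + 24 * x ^ 2) : x = 0 ∧ 2 * y = 1 := by
  obtain ⟨v, rfl⟩ : ∃ v, y = 1 / 2 - v := ⟨1 / 2 - y, by ring⟩
  have hv : 0 ≤ v := by linarith
  have e₁ : 6 * v * (1 - v) ≤ x ^ 2 + 1 / 2 := by nlinarith
  have e₂ : x * (1 - x) ≤ 6 * v ^ 2 := by nlinarith
  have e₃ : v * (1 - 6 * v) ≤ x ^ 2 := by nlinarith
  have a₁ : v ≤ 3 / 20 := by nlinarith
  have a₂ : x ≤ 12 * v ^ 2 := by nlinarith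
  have a₃ : x ≤ 27 / 100 := by nlinarith
  have a₄ : v ≤ 11 / 100 := by nlinarith
  have a₅ : x ^ 2 ≤ 12 * v ^ 2 * (12 * v ^ 2) := by nlinarith
  have a₆ : v ^ 3 ≤ (11 / 100) ^ 3 := by gcongr
  have a₇ : v = 0 := by
    by_contra h
    have hv' : 0 < v := lt_of_le_of_ne hv (Ne.symm h)
    have : 0 < v * (1 - 6 * v - 144 * v ^ 3) := by
      apply mul_pos hv'; linarith
    nlinarith
  subst a₇
  constructor <;> linarith

theorem int_disc_cover {X Y N : ℤ} (hN : 0 < N) (hX : 0 ≤ X) (hX' : 2 * X ≤ N) (hY : 0 ≤ Y)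
    (hY' : 2 * Y ≤ N) :
    X ^ 2 + 6 * Y ^ 2 < N ^ 2 ∨ (2 * X - N) ^ 2 + 6 * (2 * Y - N) ^ 2 < N ^ 2 ∨
      (5 * N - 12 * Y) ^ 2 + 24 * X ^ 2 < N ^ 2 ∨ X = 0 ∧ 2 * Y = N := by
  by_contra! h
  obtain ⟨h₁, h₂, h₃, h₄⟩ := h
  have hN' : (0 : ℚ) < N := by exact_mod_cast hN
  have key := rat_disc_cover (x := X / N) (y := Y / N) (by positivity)
    (by rw [← mul_div_assoc, div_le_one hN']; exact_mod_cast hX') (by positivity)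
    (by rw [← mul_div_assoc, div_le_one hN']; exact_mod_cast hY')
    (by
      rw [← sub_nonneg, show ((X : ℚ) / N) ^ 2 + 6 * (Y / N) ^ 2 - 1
        = (X ^ 2 + 6 * Y ^ 2 - N ^ 2) / N ^ 2 by field_simp]
      exact div_nonneg (sub_nonneg.mpr (by exact_mod_cast h₁)) (by positivity))
    (by
      rw [← sub_nonneg, show (2 * ((X : ℚ) / N) - 1) ^ 2 + 6 * (2 * (Y / N) - 1) ^ 2 - 1
        = ((2 * X - N) ^ 2 + 6 * (2 * Y - N) ^ 2 - N ^ 2) / N ^ 2 by field_simp]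
      exact div_nonneg (sub_nonneg.mpr (by exact_mod_cast h₂)) (by positivity))
    (by
      rw [← sub_nonneg, show (5 - 12 * ((Y : ℚ) / N)) ^ 2 + 24 * (X / N) ^ 2 - 1
        = ((5 * N - 12 * Y) ^ 2 + 24 * X ^ 2 - N ^ 2) / N ^ 2 by field_simp]
      exact div_nonneg (sub_nonneg.mpr (by exact_mod_cast h₃)) (by positivity))
  have hX0 : X = 0 := by
    have := key.1
    rw [div_eq_zero_iff] at this
    exact_mod_cast this.resolve_right hN'.ne'
  refine h₄ hX0 ?_
  have := key.2
  rw [← mul_div_assoc, div_eq_one_iff_eq hN'.ne'] at this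
  exact_mod_cast this

theorem norm_eq (z : ℤ√(-6)) : z.norm = z.re ^ 2 + 6 * z.im ^ 2 := by
  rw [Zsqrtd.norm_def]; ring

theorem norm_pos {z : ℤ√(-6)} (hz : z ≠ 0) : 0 < z.norm :=
  lt_of_le_of_ne (Zsqrtd.norm_nonneg (by norm_num) z)
    (Ne.symm (mt (Zsqrtd.norm_eq_zero_iff (by norm_num) z).mp hz))

/-- The singular point `√-6/2` is not a cusp in the orbit of `∞`. -/
theorem two_mul_ne_sqrtd_mul {a b c d : ℤ√(-6)} (h : a * d - b * c = 1) :
    2 * a ≠ ⟨0, 1⟩ * c := by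
  intro hac
  have hn : c.norm ∣ 4 := by
    have : c * (⟨0, 1⟩ * d - 2 * b) = 2 := by linear_combination 2 * h - d * hac
    have h2 := congrArg Zsqrtd.norm this
    rw [Zsqrtd.norm_mul] at h2
    exact ⟨_, h2.symm⟩
  have hle := Int.le_of_dvd (by norm_num) hn
  obtain ⟨a₁, a₂⟩ := a
  obtain ⟨b₁, b₂⟩ := b
  obtain ⟨c₁, c₂⟩ := c
  obtain ⟨d₁, d₂⟩ := d
  simp [Zsqrtd.ext_iff] at h hac
  simp [norm_eq] at hle
  have hc : c₂ = 0 := by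
    by_contra hc
    have : 0 < c₂ ^ 2 := by positivity
    nlinarith [sq_nonneg c₁]
  obtain ⟨hac₁, hac₂⟩ := hac
  have ha₁ : a₁ = 0 := by lia
  have hc₁ : c₁ = 2 * a₂ := by lia
  subst hc ha₁ hc₁
  have := h.1
  ring_nf at this
  lia

theorem exists_close_int {N : ℤ} (hN : 0 < N) (X : ℤ) : ∃ i : ℤ, |2 * (X + i * N)| ≤ N := by
  refine ⟨-((2 * X + N) / (2 * N)), ?_⟩
  have h₁ := Int.emod_add_mul_ediv (2 * X + N) (2 * N)
  have h₂ := Int.emod_nonneg (2 * X + N) (b := 2 * N) (by lia)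
  have h₃ := Int.emod_lt_of_pos (2 * X + N) (b := 2 * N) (by lia)
  rw [abs_le]
  constructor <;> linarith

theorem translation_add (b c : ℤ√(-6)) :
    translation (b + c) = translation b * translation c := by
  apply eq_of_coe_eq
  rw [Matrix.SpecialLinearGroup.coe_mul]
  simp [coe_translation, add_comm]

theorem translation_zsmul (b : ℤ√(-6)) (n : ℤ) :
    translation (n • b) = translation b ^ n := by
  let f : Multiplicative (ℤ√(-6)) →* SpecialLinearGroup (Fin 2) (ℤ√(-6)) :=
    { toFun := fun b => translation b.toAdd
      map_one' := eq_of_coe_eq (by simp [coe_translation, one_fin_two])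
      map_mul' := fun b c => translation_add _ _ }
  exact map_zpow f (Multiplicative.ofAdd b) n

theorem translation_mem {H : Subgroup (SpecialLinearGroup (Fin 2) (ℤ√(-6)))}
    (h₁ : translation 1 ∈ H) (h₂ : translation ⟨0, 1⟩ ∈ H) (b : ℤ√(-6)) :
    translation b ∈ H := by
  have : b = b.re • (1 : ℤ√(-6)) + b.im • (⟨0, 1⟩ : ℤ√(-6)) := by
    ext <;> simp
  rw [this, translation_add, translation_zsmul, translation_zsmul]
  exact H.mul_mem (H.zpow_mem h₁ _) (H.zpow_mem h₂ _)

theorem coe_one_zero_mul (h g : SpecialLinearGroup (Fin 2) (ℤ√(-6))) :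
    (h * g) 1 0 = h 1 0 * g 0 0 + h 1 1 * g 1 0 := by
  simp [Matrix.mul_apply, Fin.sum_univ_two]

theorem eq_sqrtd_of_mul_star {a c : ℤ√(-6)} (hc : c ≠ 0) {s : ℤ}
    (h : 2 * (a * star c) = ⟨0, s * c.norm⟩) : 2 * a = ⟨0, s⟩ * c := by
  have h0 : (2 * a - ⟨0, s⟩ * c) * star c = 0 := by
    rw [sub_mul, mul_assoc, h, mul_assoc, ← Zsqrtd.norm_eq_mul_conj]
    ext <;> simp
  have h1 := congrArg Zsqrtd.norm h0
  rw [Zsqrtd.norm_mul, Zsqrtd.norm_conj, Zsqrtd.norm_zero] at h1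
  exact sub_eq_zero.mp ((Zsqrtd.norm_eq_zero_iff (by norm_num) _).mp
    ((mul_eq_zero.mp h1).resolve_right (norm_pos hc).ne'))

theorem norm_mul_add_lt {a c r s : ℤ√(-6)} (hc : c ≠ 0)
    (h : (r * (a * star c) + s * (c.norm : ℤ√(-6))).norm < c.norm ^ 2) :
    (r * a + s * c).norm < c.norm := by
  have e : r * (a * star c) + s * (c.norm : ℤ√(-6)) = (r * a + s * c) * star c := by
    rw [Zsqrtd.norm_eq_mul_conj]; ring
  rw [e, Zsqrtd.norm_mul, Zsqrtd.norm_conj, pow_two] at h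
  exact lt_of_mul_lt_mul_right h (norm_pos hc).le

theorem exists_norm_lt_of_normalized {H : Subgroup (SpecialLinearGroup (Fin 2) (ℤ√(-6)))}
    (h₁ : translation 1 ∈ H) (h₂ : translation ⟨0, 1⟩ ∈ H) (h₃ : inversion ∈ H)
    (h₄ : elliptic ∈ H) (h₅ : hyperbolic ∈ H) (g : SpecialLinearGroup (Fin 2) (ℤ√(-6)))
    (hg : g 1 0 ≠ 0) (hX : |2 * (g 0 0 * star (g 1 0)).re| ≤ (g 1 0).norm)
    (hY : |2 * (g 0 0 * star (g 1 0)).im| ≤ (g 1 0).norm) :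
    ∃ h ∈ H, ((h * g) 1 0).norm < (g 1 0).norm := by
  have hdet : g 0 0 * g 1 1 - g 0 1 * g 1 0 = 1 := by
    rw [← det_fin_two]; exact g.2
  have hcusp := two_mul_ne_sqrtd_mul hdet
  have hcusp' : 2 * g 0 0 ≠ ⟨0, -1⟩ * g 1 0 := by
    intro h
    refine two_mul_ne_sqrtd_mul (a := -g 0 0) (b := g 0 1) (c := g 1 0) (d := -g 1 1)
      (by linear_combination hdet) ?_
    rw [show (⟨0, 1⟩ : ℤ√(-6)) = -⟨0, -1⟩ by rfl]
    linear_combination -h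
  have hN := norm_pos hg
  simp only [coe_one_zero_mul]
  generalize hw : g 0 0 * star (g 1 0) = w at hX hY
  have hsing : ∀ s : ℤ, w.re = 0 → 2 * w.im = s * (g 1 0).norm → 2 * g 0 0 = ⟨0, s⟩ * g 1 0 := by
    intro s hre him
    refine eq_sqrtd_of_mul_star hg ?_
    rw [hw]
    ext <;> simp [hre, him]
  have bottom : ∀ h ∈ H, (h 1 0 * w + h 1 1 * ((g 1 0).norm : ℤ√(-6))).norm < (g 1 0).norm ^ 2 →
      ∃ h ∈ H, (h 1 0 * g 0 0 + h 1 1 * g 1 0).norm < (g 1 0).norm :=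
    fun h hh hlt => ⟨h, hh, norm_mul_add_lt hg (by rwa [hw])⟩
  generalize (g 1 0).norm = N at *
  obtain ⟨X, Y⟩ := w
  simp only at hX hY hsing
  rw [abs_le] at hX hY
  have caseS : X ^ 2 + 6 * Y ^ 2 < N ^ 2 →
      ∃ h ∈ H, (h 1 0 * g 0 0 + h 1 1 * g 1 0).norm < N := fun hlt =>
    bottom inversion h₃ (by simpa [coe_inversion, norm_eq] using hlt)
  have caseE : ∀ i j : ℤ,
      (2 * X + (2 * i - 1) * N) ^ 2 + 6 * (2 * Y + (2 * j - 1) * N) ^ 2 < N ^ 2 →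
      ∃ h ∈ H, (h 1 0 * g 0 0 + h 1 1 * g 1 0).norm < N := fun i j hlt =>
    bottom (elliptic * translation ⟨i, j⟩) (H.mul_mem h₄ (translation_mem h₁ h₂ _)) (by
      convert hlt using 1
      simp [Matrix.SpecialLinearGroup.coe_mul, coe_elliptic, coe_translation, norm_eq]
      ring)
  have caseM : (5 * N - 12 * Y) ^ 2 + 24 * X ^ 2 < N ^ 2 →
      ∃ h ∈ H, (h 1 0 * g 0 0 + h 1 1 * g 1 0).norm < N := fun hlt =>
    bottom hyperbolic h₅ (by
      convert hlt using 1
      simp [coe_hyperbolic, norm_eq]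
      ring)
  have caseM' : (5 * N + 12 * Y) ^ 2 + 24 * X ^ 2 < N ^ 2 →
      ∃ h ∈ H, (h 1 0 * g 0 0 + h 1 1 * g 1 0).norm < N := fun hlt =>
    bottom hyperbolic⁻¹ (H.inv_mem h₅) (by
      convert hlt using 1
      simp only [coe_hyperbolic_inv]
      simp [norm_eq]
      ring)
  rcases le_total 0 X with hX0 | hX0 <;> rcases le_total 0 Y with hY0 | hY0
  · rcases int_disc_cover hN hX0 hX.2 hY0 hY.2 with h | h | h | h
    · exact caseS h
    · exact caseE 0 0 (by convert h using 1; ring)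
    · exact caseM h
    · exact absurd (hsing 1 h.1 (by linarith [h.2])) hcusp
  · rcases int_disc_cover hN hX0 hX.2 (neg_nonneg.mpr hY0) (by linarith) with h | h | h | h
    · exact caseS (by simpa using h)
    · exact caseE 0 1 (by convert h using 1; ring)
    · exact caseM' (by convert h using 1; ring)
    · exact absurd (hsing (-1) h.1 (by linarith [h.2])) hcusp'
  · rcases int_disc_cover hN (neg_nonneg.mpr hX0) (by linarith) hY0 hY.2 with h | h | h | h
    · exact caseS (by simpa using h)
    · exact caseE 1 0 (by convert h using 1; ring)
    · exact caseM (by simpa using h)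
    · exact absurd (hsing 1 (by linarith [h.1]) (by linarith [h.2])) hcusp
  · rcases int_disc_cover hN (neg_nonneg.mpr hX0) (by linarith) (neg_nonneg.mpr hY0) (by linarith)
      with h | h | h | h
    · exact caseS (by simpa using h)
    · exact caseE 1 1 (by convert h using 1; ring)
    · exact caseM' (by convert h using 1; ring)
    · exact absurd (hsing (-1) (by linarith [h.1]) (by linarith [h.2])) hcusp'

theorem exists_norm_lt {H : Subgroup (SpecialLinearGroup (Fin 2) (ℤ√(-6)))}
    (h₁ : translation 1 ∈ H) (h₂ : translation ⟨0, 1⟩ ∈ H) (h₃ : inversion ∈ H)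
    (h₄ : elliptic ∈ H) (h₅ : hyperbolic ∈ H) (g : SpecialLinearGroup (Fin 2) (ℤ√(-6)))
    (hg : g 1 0 ≠ 0) : ∃ h ∈ H, ((h * g) 1 0).norm < (g 1 0).norm := by
  obtain ⟨i, hi⟩ := exists_close_int (norm_pos hg) (g 0 0 * star (g 1 0)).re
  obtain ⟨j, hj⟩ := exists_close_int (norm_pos hg) (g 0 0 * star (g 1 0)).im
  have e₀ : (translation ⟨i, j⟩ * g) 0 0 = g 0 0 + ⟨i, j⟩ * g 1 0 := by
    simp [Matrix.SpecialLinearGroup.coe_mul, coe_translation, Matrix.mul_apply, Fin.sum_univ_two]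
  have e₁ : (translation ⟨i, j⟩ * g) 1 0 = g 1 0 := by
    simp [Matrix.SpecialLinearGroup.coe_mul, coe_translation, Matrix.mul_apply, Fin.sum_univ_two]
  have e₂ : (g 0 0 + ⟨i, j⟩ * g 1 0) * star (g 1 0) =
      g 0 0 * star (g 1 0) + ⟨i * (g 1 0).norm, j * (g 1 0).norm⟩ := by
    rw [add_mul, mul_assoc, ← Zsqrtd.norm_eq_mul_conj]
    congr 1
    ext <;> simp
  obtain ⟨h, hh, hlt⟩ := exists_norm_lt_of_normalized h₁ h₂ h₃ h₄ h₅ (translation ⟨i, j⟩ * g)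
    (by rwa [e₁]) (by rw [e₀, e₁, e₂]; exact hi) (by rw [e₀, e₁, e₂]; exact hj)
  rw [e₁] at hlt
  exact ⟨h * translation ⟨i, j⟩, H.mul_mem hh (translation_mem h₁ h₂ _), by rwa [mul_assoc]⟩

theorem inversion_sq : inversion ^ 2 = -1 := by
  apply eq_of_coe_eq
  rw [pow_two, Matrix.SpecialLinearGroup.coe_mul, Matrix.SpecialLinearGroup.coe_neg,
    Matrix.SpecialLinearGroup.coe_one]
  simp [coe_inversion, one_fin_two]

theorem isUnit_eq {z : ℤ√(-6)} (hz : IsUnit z) : z = 1 ∨ z = -1 := by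
  rw [← Zsqrtd.norm_eq_one_iff' (by norm_num), norm_eq] at hz
  have him : z.im = 0 := by
    by_contra h
    have : 0 < z.im ^ 2 := by positivity
    nlinarith [sq_nonneg z.re]
  rw [him] at hz
  rcases mul_self_eq_one_iff.mp (by linarith : z.re * z.re = 1) with h | h
  · left; ext <;> simp [him, h]
  · right; ext <;> simp [him, h]

/-- `SL₂(ℤ[√-6])` is generated by five matrices. -/
theorem mem_of_generators_mem {H : Subgroup (SpecialLinearGroup (Fin 2) (ℤ√(-6)))}
    (h₁ : translation 1 ∈ H) (h₂ : translation ⟨0, 1⟩ ∈ H) (h₃ : inversion ∈ H)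
    (h₄ : elliptic ∈ H) (h₅ : hyperbolic ∈ H) (g : SpecialLinearGroup (Fin 2) (ℤ√(-6))) :
    g ∈ H := by
  induction hn : (g 1 0).norm.toNat using Nat.strong_induction_on generalizing g with
  | _ n ih =>
    by_cases hg : g 1 0 = 0
    · have hdet : g 0 0 * g 1 1 = 1 := by
        have := g.2
        rw [det_fin_two] at this
        linear_combination this + g 0 1 * hg
      have hneg : -1 ∈ H := inversion_sq ▸ H.pow_mem h₃ 2
      rcases isUnit_eq (IsUnit.of_mul_eq_one _ hdet) with h | h
      · have h' : g 1 1 = 1 := by simpa [h] using hdet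
        have : g = translation (g 0 1) := by
          apply eq_of_coe_eq
          rw [coe_translation]
          refine (eta_fin_two _).trans ?_
          rw [h, h', hg]
        rw [this]
        exact translation_mem h₁ h₂ _
      · have h' : g 1 1 = -1 := by rw [h] at hdet; linear_combination -hdet
        have : g = -1 * translation (-g 0 1) := by
          apply eq_of_coe_eq
          rw [neg_one_mul, Matrix.SpecialLinearGroup.coe_neg, coe_translation]
          refine (eta_fin_two _).trans ?_
          rw [h, h', hg]
          simp
        rw [this]
        exact H.mul_mem hneg (translation_mem h₁ h₂ _)
    · obtain ⟨h, hh, hlt⟩ := exists_norm_lt h₁ h₂ h₃ h₄ h₅ g hg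
      have := ih _ (by have := norm_pos hg; lia) (h * g) rfl
      exact (H.mul_mem_cancel_left hh).mp this

/-- The action of `SL₂(ℤ[√-6])` on matrices by `G ↦ g G gᴴ`. -/
def hermAct (g : SpecialLinearGroup (Fin 2) (ℤ√(-6))) (G : Matrix (Fin 2) (Fin 2) (ℤ√(-6))) :
    Matrix (Fin 2) (Fin 2) (ℤ√(-6)) :=
  (g : Matrix (Fin 2) (Fin 2) (ℤ√(-6))) * G * (g : Matrix (Fin 2) (Fin 2) (ℤ√(-6)))ᴴ

theorem hermAct_one (G : Matrix (Fin 2) (Fin 2) (ℤ√(-6))) : hermAct 1 G = G := by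
  simp [hermAct]

theorem hermAct_mul (g h : SpecialLinearGroup (Fin 2) (ℤ√(-6)))
    (G : Matrix (Fin 2) (Fin 2) (ℤ√(-6))) : hermAct (g * h) G = hermAct g (hermAct h G) := by
  simp only [hermAct, Matrix.SpecialLinearGroup.coe_mul, conjTranspose_mul, Matrix.mul_assoc]

/-- The permutation of the space of matrices given by the action of `g`. -/
def hermActEquiv (g : SpecialLinearGroup (Fin 2) (ℤ√(-6))) :
    Equiv.Perm (Matrix (Fin 2) (Fin 2) (ℤ√(-6))) where
  toFun := hermAct g
  invFun := hermAct g⁻¹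
  left_inv G := by rw [← hermAct_mul, inv_mul_cancel, hermAct_one]
  right_inv G := by rw [← hermAct_mul, mul_inv_cancel, hermAct_one]

/-- The skew-hermitian matrices of determinant one that are congruent to `k` times the standard
symplectic matrix modulo twice `√-6`. They correspond to planes in hyperbolic space. -/
def planes (k : ℤ) : Set (Matrix (Fin 2) (Fin 2) (ℤ√(-6))) :=
  {G | Gᴴ = -G ∧ G.det = 1 ∧ ∃ N, G = (k : ℤ√(-6)) • !![0, 1; -1, 0] + (⟨0, 2⟩ : ℤ√(-6)) • N}

/-- Explicit coordinates on the skew-hermitian matrices. -/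
def skewForm (a d m n : ℤ) : Matrix (Fin 2) (Fin 2) (ℤ√(-6)) :=
  !![⟨0, 2 * a⟩, ⟨n, 2 * m⟩; ⟨-n, 2 * m⟩, ⟨0, 2 * d⟩]

theorem mem_planes_iff {k : ℤ} {G : Matrix (Fin 2) (Fin 2) (ℤ√(-6))} :
    G ∈ planes k ↔ ∃ a d m n : ℤ, G = skewForm a d m n ∧ n ^ 2 + 24 * m ^ 2 = 1 + 24 * (a * d) ∧
      12 ∣ n - k := by
  constructor
  · rintro ⟨hs, hd, N, hN⟩
    have e₀₀ := congrFun₂ hN 0 0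
    have e₀₁ := congrFun₂ hN 0 1
    have e₁₁ := congrFun₂ hN 1 1
    have s₀₀ := congrFun₂ hs 0 0
    have s₀₁ := congrFun₂ hs 0 1
    have s₁₁ := congrFun₂ hs 1 1
    simp [Zsqrtd.ext_iff] at e₀₀ e₀₁ e₁₁ s₀₀ s₀₁ s₁₁
    have hG : G = skewForm (N 0 0).re (N 1 1).re (N 0 1).re (G 0 1).re := by
      apply Matrix.ext
      intro i j
      fin_cases i <;> fin_cases j <;> apply Zsqrtd.ext <;> simp [skewForm] <;> lia
    refine ⟨_, _, _, _, hG, ?_, ?_⟩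
    · rw [hG, skewForm, det_fin_two_of] at hd
      have := congrArg Zsqrtd.re hd
      simp at this
      linarith
    · exact ⟨-(N 0 1).im, by lia⟩
  · rintro ⟨a, d, m, n, rfl, hd, t, ht⟩
    obtain rfl : n = k + 12 * t := by lia
    refine ⟨?_, ?_, !![a, ⟨m, -t⟩; ⟨m, t⟩, d], ?_⟩
    · ext i j <;> fin_cases i <;> fin_cases j <;> simp [skewForm]
    · rw [skewForm, det_fin_two_of]
      ext <;> simp
      · linarith
      · ring
    · ext i j <;> fin_cases i <;> fin_cases j <;> (simp [skewForm]; try ring)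

theorem conjTranspose_eq_transpose_add (g : Matrix (Fin 2) (Fin 2) (ℤ√(-6))) :
    ∃ N, gᴴ = gᵀ + (⟨0, 2⟩ : ℤ√(-6)) • N := by
  refine ⟨of fun i j => ((-(g j i).im : ℤ) : ℤ√(-6)), ?_⟩
  ext i j <;> simp
  ring

theorem mul_symplectic_mul_transpose (g : SpecialLinearGroup (Fin 2) (ℤ√(-6))) :
    (g : Matrix (Fin 2) (Fin 2) (ℤ√(-6))) * !![0, 1; -1, 0] *
      (g : Matrix (Fin 2) (Fin 2) (ℤ√(-6)))ᵀ = !![0, 1; -1, 0] := by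
  have hdet : g 0 0 * g 1 1 - g 0 1 * g 1 0 = 1 := by
    rw [← det_fin_two]; exact g.2
  generalize (g : Matrix (Fin 2) (Fin 2) (ℤ√(-6))) = M at *
  apply Matrix.ext
  intro i j
  fin_cases i <;> fin_cases j <;> simp [Matrix.mul_apply, Fin.sum_univ_two]
  · ring
  · linear_combination hdet
  · linear_combination -hdet
  · ring

theorem hermAct_mem_planes {k : ℤ} {G : Matrix (Fin 2) (Fin 2) (ℤ√(-6))} (hG : G ∈ planes k)
    (g : SpecialLinearGroup (Fin 2) (ℤ√(-6))) : hermAct g G ∈ planes k := by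
  obtain ⟨hs, hd, N, hN⟩ := hG
  refine ⟨?_, ?_, ?_⟩
  · simp [hermAct, conjTranspose_mul, hs, Matrix.mul_assoc]
  · simp [hermAct, det_conjTranspose, hd]
  · obtain ⟨N', hN'⟩ := conjTranspose_eq_transpose_add (g : Matrix (Fin 2) (Fin 2) (ℤ√(-6)))
    have key := mul_symplectic_mul_transpose g
    rw [hermAct, hN, Matrix.mul_add, Matrix.add_mul, Matrix.mul_smul, Matrix.mul_smul,
      Matrix.smul_mul, Matrix.smul_mul]
    nth_rewrite 1 [hN']
    rw [Matrix.mul_add, key, smul_add, Matrix.mul_smul, smul_comm, add_assoc, ← smul_add]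
    exact ⟨_, rfl⟩

theorem hermAct_mem_planes_iff {k : ℤ} {G : Matrix (Fin 2) (Fin 2) (ℤ√(-6))}
    (g : SpecialLinearGroup (Fin 2) (ℤ√(-6))) : hermAct g G ∈ planes k ↔ G ∈ planes k := by
  refine ⟨fun h => ?_, fun h => hermAct_mem_planes h g⟩
  simpa [← hermAct_mul, hermAct_one] using hermAct_mem_planes h g⁻¹

/-- The squared length of a column. -/
def colNorm (g : SpecialLinearGroup (Fin 2) (ℤ√(-6))) (j : Fin 2) : ℤ :=
  (g 0 j).norm + (g 1 j).norm

/-- The hermitian inner product of the columns. -/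
def colInner (g : SpecialLinearGroup (Fin 2) (ℤ√(-6))) : ℤ√(-6) :=
  star (g 0 0) * g 0 1 + star (g 1 0) * g 1 1

/-- Half the imaginary part of the trace of `g G gᴴ`, for `G` in coordinates. -/
def halfTrace (g : SpecialLinearGroup (Fin 2) (ℤ√(-6))) (a d m n : ℤ) : ℤ :=
  colNorm g 0 * a + colNorm g 1 * d + 2 * (colInner g).re * m - (colInner g).im * n

theorem colNorm_mul_colNorm (g : SpecialLinearGroup (Fin 2) (ℤ√(-6))) :
    colNorm g 0 * colNorm g 1 = 1 + (colInner g).re ^ 2 + 6 * (colInner g).im ^ 2 := by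
  have hdet : (g 0 0 * g 1 1 - g 0 1 * g 1 0).norm = 1 := by
    rw [← det_fin_two, show (g : Matrix (Fin 2) (Fin 2) (ℤ√(-6))).det = 1 from g.2,
      Zsqrtd.norm_one]
  rw [← hdet]
  simp only [colNorm, colInner, norm_eq]
  simp
  ring

theorem colNorm_pos (g : SpecialLinearGroup (Fin 2) (ℤ√(-6))) (j : Fin 2) : 0 < colNorm g j := by
  have h : ∀ j, 0 ≤ colNorm g j := fun j =>
    add_nonneg (Zsqrtd.norm_nonneg (by norm_num) _) (Zsqrtd.norm_nonneg (by norm_num) _)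
  refine lt_of_le_of_ne (h j) fun h0 => ?_
  have := colNorm_mul_colNorm g
  have h0' : colNorm g 0 * colNorm g 1 = 0 := by
    fin_cases j <;> simp at h0 <;> simp [← h0]
  nlinarith [sq_nonneg (colInner g).re, sq_nonneg (colInner g).im]

theorem trace_hermAct (g : SpecialLinearGroup (Fin 2) (ℤ√(-6))) (a d m n : ℤ) :
    (hermAct g (skewForm a d m n)).trace.im = 2 * halfTrace g a d m n := by
  simp only [halfTrace, colNorm, colInner, norm_eq, hermAct, skewForm]
  generalize (g : Matrix (Fin 2) (Fin 2) (ℤ√(-6))) = M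
  simp [trace_fin_two, Matrix.mul_apply, Fin.sum_univ_two]
  ring

theorem trace_skewForm (a d m n : ℤ) : (skewForm a d m n).trace.im = 2 * (a + d) := by
  simp [skewForm, trace_fin_two]
  ring

theorem mul_nonpos_of_sign_ne {x y : ℤ} (h : x.sign ≠ y.sign) : y * x ≤ 0 := by
  by_contra! hlt
  apply h
  rcases lt_trichotomy x 0 with hx | rfl | hx
  · rw [Int.sign_eq_neg_one_of_neg hx, Int.sign_eq_neg_one_of_neg (by nlinarith)]
  · simp at hlt
  · rw [Int.sign_eq_one_of_pos hx, Int.sign_eq_one_of_pos (by nlinarith)]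

theorem crossing_bound {A D p q a d m n : ℤ} (hA : 0 < A) (hD : 0 < D)
    (hAD : A * D = 1 + p ^ 2 + 6 * q ^ 2) (h : n ^ 2 + 24 * m ^ 2 = 1 + 24 * (a * d))
    (hs : (a + d) * (A * a + D * d + 2 * p * m - q * n) ≤ 0) :
    0 ≤ a * d ∧ 6 * (A * a - D * d) ^ 2 + 24 * (a * d) ≤ A * D - 1 := by
  have had : 0 ≤ a * d := by nlinarith [sq_nonneg n, sq_nonneg m]
  refine ⟨had, ?_⟩
  have hL : (A * a + D * d) ^ 2 ≤ (2 * p * m - q * n) ^ 2 := by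
    rcases eq_or_ne (a + d) 0 with h0 | h0
    · have hd : d = -a := by lia
      subst hd
      have ha : a = 0 := by nlinarith
      subst ha
      simpa using sq_nonneg (2 * p * m - q * n)
    · have h1 : 0 ≤ (a + d) * (A * a + D * d) := by
        nlinarith [mul_nonneg hA.le had, mul_nonneg hD.le had, mul_nonneg hA.le (sq_nonneg a),
          mul_nonneg hD.le (sq_nonneg d)]
      have h2 : (a + d) * (A * a + D * d) ≤ -((a + d) * (2 * p * m - q * n)) := by linarith
      have h3 := pow_le_pow_left₀ h1 h2 2
      have h4 : 0 < (a + d) ^ 2 := by positivity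
      refine le_of_mul_le_mul_left ?_ h4
      linarith
  nlinarith [sq_nonneg (p * n + 12 * q * m)]

theorem crossing_box {A D a d m n : ℤ} (hA : 0 < A) (hD : 0 < D) (had : 0 ≤ a * d)
    (h : n ^ 2 + 24 * m ^ 2 = 1 + 24 * (a * d))
    (hb : 6 * (A * a - D * d) ^ 2 + 24 * (a * d) ≤ A * D - 1) :
    |a| ≤ A * D ∧ |d| ≤ A * D ∧ |m| ≤ A * D ∧ |n| ≤ A * D := by
  have hN : 0 < A * D := mul_pos hA hD
  have hL : 6 * (A * a + D * d) ^ 2 ≤ (A * D) ^ 2 := by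
    nlinarith [mul_nonneg hN.le had]
  have ha : a ^ 2 ≤ (A * a + D * d) ^ 2 := by
    nlinarith [mul_nonneg hN.le had, sq_nonneg (D * d),
      mul_nonneg (by nlinarith : 0 ≤ A ^ 2 - 1) (sq_nonneg a)]
  have hd : d ^ 2 ≤ (A * a + D * d) ^ 2 := by
    nlinarith [mul_nonneg hN.le had, sq_nonneg (A * a),
      mul_nonneg (by nlinarith : 0 ≤ D ^ 2 - 1) (sq_nonneg d)]
  have hN2 : A * D ≤ (A * D) ^ 2 := by nlinarith
  refine ⟨abs_le_of_sq_le_sq ?_ hN.le, abs_le_of_sq_le_sq ?_ hN.le, abs_le_of_sq_le_sq ?_ hN.le,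
    abs_le_of_sq_le_sq ?_ hN.le⟩ <;>
    nlinarith [sq_nonneg (A * a + D * d), sq_nonneg m, sq_nonneg n, sq_nonneg (A * a - D * d)]

open Classical in
/-- The side on which the basepoint lies of an oriented plane in the family `planes k`. -/
noncomputable def side (k : ℤ) (G : Matrix (Fin 2) (Fin 2) (ℤ√(-6))) : ℤ :=
  if G ∈ planes k then G.trace.im.sign else 0

/-- The contribution of a plane to the signed number of crossings between the basepoint and
its translate. -/
noncomputable def crossing (k : ℤ) (g : SpecialLinearGroup (Fin 2) (ℤ√(-6)))
    (G : Matrix (Fin 2) (Fin 2) (ℤ√(-6))) : ℤ :=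
  side k (hermAct g G) - side k G

theorem crossing_skewForm {k a d m n : ℤ} (h : n ^ 2 + 24 * m ^ 2 = 1 + 24 * (a * d))
    (hk : 12 ∣ n - k) (g : SpecialLinearGroup (Fin 2) (ℤ√(-6))) :
    crossing k g (skewForm a d m n) = (halfTrace g a d m n).sign - (a + d).sign := by
  have hG : skewForm a d m n ∈ planes k := mem_planes_iff.mpr ⟨a, d, m, n, rfl, h, hk⟩
  rw [crossing, side, side, if_pos hG, if_pos ((hermAct_mem_planes_iff g).mpr hG), trace_hermAct,
    trace_skewForm, Int.sign_mul, Int.sign_mul, show Int.sign 2 = 1 from rfl, one_mul, one_mul]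

theorem exists_of_crossing_ne_zero {k : ℤ} {g : SpecialLinearGroup (Fin 2) (ℤ√(-6))}
    {G : Matrix (Fin 2) (Fin 2) (ℤ√(-6))} (hG : crossing k g G ≠ 0) :
    ∃ a d m n : ℤ, G = skewForm a d m n ∧ n ^ 2 + 24 * m ^ 2 = 1 + 24 * (a * d) ∧ 12 ∣ n - k ∧
      (a + d) * halfTrace g a d m n ≤ 0 ∧ 0 ≤ a * d ∧
      6 * (colNorm g 0 * a - colNorm g 1 * d) ^ 2 + 24 * (a * d) ≤
        colNorm g 0 * colNorm g 1 - 1 := by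
  by_cases hmem : G ∈ planes k
  · obtain ⟨a, d, m, n, rfl, h, hk⟩ := mem_planes_iff.mp hmem
    rw [crossing_skewForm h hk] at hG
    have hs := mul_nonpos_of_sign_ne (sub_ne_zero.mp hG)
    obtain ⟨had, hb⟩ := crossing_bound (colNorm_pos g 0) (colNorm_pos g 1)
      (colNorm_mul_colNorm g) h hs
    exact ⟨a, d, m, n, rfl, h, hk, hs, had, hb⟩
  · exact absurd (by simp [crossing, side, hmem, hermAct_mem_planes_iff]) hG

theorem finite_support_crossing (k : ℤ) (g : SpecialLinearGroup (Fin 2) (ℤ√(-6))) :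
    (Function.support (crossing k g)).Finite := by
  set N := colNorm g 0 * colNorm g 1
  have hfin : (Set.Icc (-N) N ×ˢ Set.Icc (-N) N ×ˢ Set.Icc (-N) N ×ˢ Set.Icc (-N) N).Finite := by
    refine .prod ?_ (.prod ?_ (.prod ?_ ?_)) <;> exact Set.finite_Icc _ _
  refine (hfin.image fun x => skewForm x.1 x.2.1 x.2.2.1 x.2.2.2).subset fun G hG => ?_
  obtain ⟨a, d, m, n, rfl, h, -, -, had, hb⟩ := exists_of_crossing_ne_zero hG
  obtain ⟨ha, hd, hm, hn⟩ := crossing_box (colNorm_pos g 0) (colNorm_pos g 1) had h hb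
  exact ⟨(a, d, m, n), ⟨abs_le.mp ha, abs_le.mp hd, abs_le.mp hm, abs_le.mp hn⟩, rfl⟩

/-- The homomorphism counting with sign the planes of the family `planes k` crossed by a path
from the basepoint to its translate. -/
noncomputable def crossingHom (k : ℤ) :
    SpecialLinearGroup (Fin 2) (ℤ√(-6)) →* Multiplicative ℤ where
  toFun g := Multiplicative.ofAdd (∑ᶠ G, crossing k g G)
  map_one' := by simp [crossing, hermAct_one]
  map_mul' g h := by
    rw [← ofAdd_add]
    congr 1
    have e : ∀ G, crossing k (g * h) G = crossing k g (hermActEquiv h G) + crossing k h G := by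
      intro G
      simp [crossing, hermAct_mul, hermActEquiv]
    rw [finsum_congr e, finsum_add_distrib _ (finite_support_crossing k h),
      finsum_comp_equiv (hermActEquiv h) (f := crossing k g)]
    exact (finite_support_crossing k g).preimage (hermActEquiv h).injective.injOn

theorem crossingHom_eq_sum {k : ℤ} {g : SpecialLinearGroup (Fin 2) (ℤ√(-6))}
    (T : Finset (Matrix (Fin 2) (Fin 2) (ℤ√(-6))))
    (hT : ∀ a d m n : ℤ, n ^ 2 + 24 * m ^ 2 = 1 + 24 * (a * d) → 12 ∣ n - k →
      (a + d) * halfTrace g a d m n ≤ 0 → 0 ≤ a * d →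
      6 * (colNorm g 0 * a - colNorm g 1 * d) ^ 2 + 24 * (a * d) ≤
        colNorm g 0 * colNorm g 1 - 1 →
      skewForm a d m n ∈ T ∨ crossing k g (skewForm a d m n) = 0) :
    (crossingHom k g).toAdd = ∑ G ∈ T, crossing k g G := by
  refine finsum_eq_sum_of_support_subset _ fun G hG => ?_
  obtain ⟨a, d, m, n, rfl, h, hk, hs, had, hb⟩ := exists_of_crossing_ne_zero hG
  exact (hT a d m n h hk hs had hb).resolve_right hG

theorem skewForm_injective {a d m n a' d' m' n' : ℤ} (h : skewForm a d m n = skewForm a' d' m' n') :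
    a = a' ∧ d = d' ∧ m = m' ∧ n = n' := by
  have e₀₀ := congrFun₂ h 0 0
  have e₀₁ := congrFun₂ h 0 1
  have e₁₁ := congrFun₂ h 1 1
  simp [skewForm] at e₀₀ e₀₁ e₁₁
  lia

theorem halfTrace_translation (a d m n : ℤ) :
    halfTrace (translation ⟨0, 1⟩) a d m n = a + 7 * d - n := by
  simp [halfTrace, colNorm, colInner, coe_translation, norm_eq]

theorem halfTrace_hyperbolic (a d m n : ℤ) :
    halfTrace hyperbolic a d m n = 49 * a + 49 * d + 20 * n := by
  simp [halfTrace, colNorm, colInner, coe_hyperbolic, norm_eq]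

theorem translation_crossing_coords {a d m n : ℤ} (h : n ^ 2 + 24 * m ^ 2 = 1 + 24 * (a * d))
    (had : 0 ≤ a * d) (hb : 6 * (1 * a - 7 * d) ^ 2 + 24 * (a * d) ≤ 1 * 7 - 1) :
    d = 0 ∧ (a = -1 ∨ a = 0 ∨ a = 1) ∧ m = 0 ∧ (n = 1 ∨ n = -1) := by
  have had0 : a * d = 0 := by nlinarith [sq_nonneg (1 * a - 7 * d)]
  rw [had0] at h hb
  have hm : m = 0 := by
    by_contra hm
    have : 0 < m ^ 2 := by positivity
    nlinarith [sq_nonneg n]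
  subst hm
  have h1 : (1 * a - 7 * d) ^ 2 ≤ 1 := by linarith
  have h2 := abs_le.mp (abs_le_of_sq_le_sq (h1.trans_eq (one_pow 2).symm) zero_le_one)
  have h3 := mul_self_eq_one_iff.mp (by linarith : n * n = 1)
  clear h hb had h1
  rcases mul_eq_zero.mp had0 with rfl | rfl <;> clear had0 <;> lia

theorem hyperbolic_crossing_coords {a d m n : ℤ} (h : n ^ 2 + 24 * m ^ 2 = 1 + 24 * (a * d))
    (hs : (a + d) * (49 * a + 49 * d + 20 * n) ≤ 0)
    (had : 0 ≤ a * d) (hb : 6 * (49 * a - 49 * d) ^ 2 + 24 * (a * d) ≤ 49 * 49 - 1) :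
    d = a ∧ m = 0 ∧ (a = 0 ∧ (n = 1 ∨ n = -1) ∨ (a = 1 ∨ a = -1) ∧ (n = 5 ∨ n = -5) ∨
      (a = 10 ∨ a = -10) ∧ (n = 49 ∨ n = -49)) := by
  obtain rfl : a = d := by
    by_contra hne
    have : 0 < (a - d) ^ 2 := by have := sub_ne_zero.mpr hne; positivity
    nlinarith
  have ha : a ^ 2 ≤ 10 ^ 2 := by linarith
  have ha' := abs_le.mp (abs_le_of_sq_le_sq ha (by norm_num))
  have hn : 2401 * a ^ 2 ≤ 100 * n ^ 2 := by
    have h1 := pow_le_pow_left₀ (by positivity : 0 ≤ 49 * a ^ 2)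
      (by linarith : 49 * a ^ 2 ≤ -(10 * a * n)) 2
    rcases eq_or_ne a 0 with rfl | h0
    · simp; positivity
    · have : 0 < a ^ 2 := by positivity
      refine le_of_mul_le_mul_left ?_ this
      linarith
  have hm : m = 0 := by
    by_contra hm
    have : 0 < m ^ 2 := by positivity
    nlinarith [sq_nonneg n, sq_nonneg a]
  subst hm
  refine ⟨rfl, rfl, ?_⟩
  have hn' := abs_le.mp (abs_le_of_sq_le_sq (by linarith : n ^ 2 ≤ 49 ^ 2) (by norm_num))
  have key : ∀ b : Fin 11, ∀ k : Fin 50, k.val * k.val = 1 + 24 * (b.val * b.val) →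
      b.val = 0 ∧ k.val = 1 ∨ b.val = 1 ∧ k.val = 5 ∨ b.val = 10 ∧ k.val = 49 := by decide
  have h' : n.natAbs * n.natAbs = 1 + 24 * (a.natAbs * a.natAbs) := by
    zify
    rw [abs_mul_abs_self, abs_mul_abs_self]
    linarith
  have := key ⟨a.natAbs, by lia⟩ ⟨n.natAbs, by lia⟩ h'
  clear h h' hs had hb ha hn key
  dsimp only at this
  lia

theorem crossingHom_one_translation : (crossingHom 1 (translation ⟨0, 1⟩)).toAdd = -2 := by
  have hD : colNorm (translation ⟨0, 1⟩) 0 = 1 ∧ colNorm (translation ⟨0, 1⟩) 1 = 7 := ⟨rfl, rfl⟩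
  rw [crossingHom_eq_sum {skewForm 0 0 0 1, skewForm 1 0 0 1}, Finset.sum_pair,
    crossing_skewForm (by norm_num) (by norm_num), crossing_skewForm (by norm_num) (by norm_num),
    halfTrace_translation, halfTrace_translation]
  · rfl
  · intro h
    simpa using (skewForm_injective h).1
  · intro a d m n h hk _ had hb
    rw [hD.1, hD.2] at hb
    obtain ⟨rfl, ha, rfl, rfl | rfl⟩ := translation_crossing_coords h had hb
    · rcases ha with rfl | rfl | rfl
      · right
        rw [crossing_skewForm h hk, halfTrace_translation]
        rfl
      · simp
      · simp
    · norm_num at hk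

theorem crossingHom_seven_translation : (crossingHom 7 (translation ⟨0, 1⟩)).toAdd = 0 := by
  have hD : colNorm (translation ⟨0, 1⟩) 0 = 1 ∧ colNorm (translation ⟨0, 1⟩) 1 = 7 := ⟨rfl, rfl⟩
  rw [crossingHom_eq_sum ∅, Finset.sum_empty]
  intro a d m n h hk _ had hb
  rw [hD.1, hD.2] at hb
  obtain ⟨rfl, ha, rfl, rfl | rfl⟩ := translation_crossing_coords h had hb <;> norm_num at hk

theorem crossingHom_seven_hyperbolic : (crossingHom 7 hyperbolic).toAdd = -2 := by
  have hD : colNorm hyperbolic 0 = 49 ∧ colNorm hyperbolic 1 = 49 := ⟨rfl, rfl⟩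
  rw [crossingHom_eq_sum {skewForm 1 1 0 (-5)}, Finset.sum_singleton,
    crossing_skewForm (by norm_num) (by norm_num), halfTrace_hyperbolic]
  · rfl
  · intro a d m n h hk hs had hb
    rw [hD.1, hD.2] at hb
    obtain ⟨rfl, rfl, ⟨rfl, rfl | rfl⟩ | ⟨rfl | rfl, rfl | rfl⟩ | ⟨rfl | rfl, rfl | rfl⟩⟩ :=
      hyperbolic_crossing_coords h (by rwa [halfTrace_hyperbolic] at hs) had hb <;> norm_num at hk
    · simp
    · right
      rw [crossing_skewForm h (by norm_num), halfTrace_hyperbolic]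
      rfl

/-- The class of a group element in the first rational homology. -/
noncomputable def rationalClass {G : Type*} [Group G] (g : G) :
    ℚ ⊗[ℤ] Additive (Abelianization G) :=
  1 ⊗ₜ Additive.ofMul (Abelianization.of g)

section RationalClass

variable {G : Type*} [Group G]

theorem rationalClass_one : rationalClass (1 : G) = 0 := by
  rw [rationalClass, map_one, ofMul_one, tmul_zero]

theorem rationalClass_mul (g h : G) :
    rationalClass (g * h) = rationalClass g + rationalClass h := by
  rw [rationalClass, map_mul, ofMul_mul, tmul_add]
  rfl

theorem rationalClass_inv (g : G) : rationalClass g⁻¹ = -rationalClass g := by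
  rw [eq_neg_iff_add_eq_zero, ← rationalClass_mul, inv_mul_cancel, rationalClass_one]

theorem rationalClass_pow (g : G) (n : ℕ) : rationalClass (g ^ n) = (n : ℚ) • rationalClass g := by
  induction n with
  | zero => simp [rationalClass_one]
  | succ n ih => rw [pow_succ, rationalClass_mul, ih, Nat.cast_succ, add_smul, one_smul]

theorem rationalClass_eq_zero_of_pow_eq_one {g : G} {n : ℕ} (hn : n ≠ 0) (hg : g ^ n = 1) :
    rationalClass g = 0 := by
  have h := rationalClass_pow g n
  rw [hg, rationalClass_one] at h
  exact (smul_eq_zero.mp h.symm).resolve_left (Nat.cast_ne_zero.mpr hn)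

/-- The linear functional on rational homology induced by a homomorphism to `ℤ`. -/
noncomputable def rationalFunctional (f : G →* Multiplicative ℤ) :
    ℚ ⊗[ℤ] Additive (Abelianization G) →ₗ[ℚ] ℚ :=
  (TensorProduct.AlgebraTensorModule.rid ℤ ℚ ℚ).toLinearMap ∘ₗ
    (MonoidHom.toAdditiveLeft (Abelianization.lift f)).toIntLinearMap.baseChange ℚ

theorem rationalFunctional_rationalClass (f : G →* Multiplicative ℤ) (g : G) :
    rationalFunctional f (rationalClass g) = (f g).toAdd := by
  simp [rationalFunctional, rationalClass]

/-- The elements whose rational class lies in a given subspace. -/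
def classSubgroup (W : Submodule ℚ (ℚ ⊗[ℤ] Additive (Abelianization G))) : Subgroup G where
  carrier := {g | rationalClass g ∈ W}
  one_mem' := by simp [rationalClass_one]
  mul_mem' := fun {g h} hg hh => by
    simpa only [Set.mem_ofPred_eq, rationalClass_mul] using W.add_mem hg hh
  inv_mem' := fun {g} hg => by
    simpa only [Set.mem_ofPred_eq, rationalClass_inv] using W.neg_mem hg

theorem mem_classSubgroup {W : Submodule ℚ (ℚ ⊗[ℤ] Additive (Abelianization G))} {g : G} :
    g ∈ classSubgroup W ↔ rationalClass g ∈ W := Iff.rfl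

theorem eq_top_of_classSubgroup_eq_top
    {W : Submodule ℚ (ℚ ⊗[ℤ] Additive (Abelianization G))} (h : classSubgroup W = ⊤) :
    W = ⊤ := by
  rw [eq_top_iff]
  rintro x -
  induction x using TensorProduct.induction_on with
  | zero => exact W.zero_mem
  | add x y hx hy => exact W.add_mem hx hy
  | tmul q a =>
    obtain ⟨g, hg⟩ := QuotientGroup.mk_surjective a.toMul
    have hx : q ⊗ₜ[ℤ] a = q • rationalClass g := by
      rw [rationalClass, smul_tmul', smul_eq_mul, mul_one]
      exact congrArg (q ⊗ₜ[ℤ] ·) (congrArg Additive.ofMul hg.symm)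
    rw [hx]
    exact W.smul_mem q (mem_classSubgroup.mp (h ▸ Subgroup.mem_top g))

/-- Isomorphic groups have rational homology of the same dimension. -/
theorem finrank_congr {G' : Type*} [Group G'] (e : G ≃* G') :
    Module.finrank ℚ (ℚ ⊗[ℤ] Additive (Abelianization G)) =
      Module.finrank ℚ (ℚ ⊗[ℤ] Additive (Abelianization G')) :=
  LinearEquiv.finrank_eq (LinearEquiv.baseChange ℤ ℚ _ _
    (MulEquiv.toAdditive e.abelianizationCongr).toIntLinearEquiv)

end RationalClass

theorem rationalClass_eq_zero_of_sq_eq_neg_one {g : SpecialLinearGroup (Fin 2) (ℤ√(-6))}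
    (hg : g ^ 2 = -1) : rationalClass g = 0 :=
  rationalClass_eq_zero_of_pow_eq_one (n := 4) (by norm_num)
    (by rw [show 4 = 2 * 2 from rfl, pow_mul, hg, neg_one_sq])

theorem elliptic_sq : elliptic ^ 2 = -1 := by
  apply eq_of_coe_eq
  rw [pow_two, Matrix.SpecialLinearGroup.coe_mul, Matrix.SpecialLinearGroup.coe_neg,
    Matrix.SpecialLinearGroup.coe_one, coe_elliptic]
  apply Matrix.ext
  intro i j
  fin_cases i <;> fin_cases j <;> rfl

theorem inversion_mul_translation_pow_three : (inversion * translation 1) ^ 3 = -1 := by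
  apply eq_of_coe_eq
  simp only [pow_succ, pow_zero, one_mul, Matrix.SpecialLinearGroup.coe_mul,
    Matrix.SpecialLinearGroup.coe_neg, Matrix.SpecialLinearGroup.coe_one, coe_inversion,
    coe_translation]
  apply Matrix.ext
  intro i j
  fin_cases i <;> fin_cases j <;> rfl

theorem rationalClass_inversion : rationalClass inversion = 0 :=
  rationalClass_eq_zero_of_sq_eq_neg_one inversion_sq

theorem rationalClass_elliptic : rationalClass elliptic = 0 :=
  rationalClass_eq_zero_of_sq_eq_neg_one elliptic_sq

theorem rationalClass_translation_one : rationalClass (translation 1) = 0 := by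
  have h : rationalClass (inversion * translation 1) = 0 :=
    rationalClass_eq_zero_of_pow_eq_one (n := 6) (by norm_num)
      (by rw [show 6 = 3 * 2 from rfl, pow_mul, inversion_mul_translation_pow_three, neg_one_sq])
  rwa [rationalClass_mul, rationalClass_inversion, zero_add] at h

theorem span_rationalClass_eq_top : Submodule.span ℚ
    (Set.range ![rationalClass (translation ⟨0, 1⟩), rationalClass hyperbolic]) = ⊤ := by
  refine eq_top_of_classSubgroup_eq_top (eq_top_iff.mpr fun g _ => ?_)
  apply mem_of_generators_mem <;> rw [mem_classSubgroup]
  · exact rationalClass_translation_one ▸ Submodule.zero_mem _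
  · exact Submodule.subset_span ⟨0, rfl⟩
  · exact rationalClass_inversion ▸ Submodule.zero_mem _
  · exact rationalClass_elliptic ▸ Submodule.zero_mem _
  · exact Submodule.subset_span ⟨1, rfl⟩

theorem linearIndependent_rationalClass : LinearIndependent ℚ
    ![rationalClass (translation ⟨0, 1⟩), rationalClass hyperbolic] := by
  rw [LinearIndependent.pair_iff]
  intro s t h
  have h₇ := congrArg (rationalFunctional (crossingHom 7)) h
  have h₁ := congrArg (rationalFunctional (crossingHom 1)) h
  simp only [map_add, map_smul, map_zero, rationalFunctional_rationalClass,
    crossingHom_seven_translation, crossingHom_seven_hyperbolic] at h₇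
  obtain rfl : t = 0 := by simpa using h₇
  simp only [map_add, map_smul, map_zero, rationalFunctional_rationalClass,
    crossingHom_one_translation, zero_smul] at h₁
  exact ⟨by simpa using h₁, rfl⟩

theorem finrank_eq_two : Module.finrank ℚ
    (ℚ ⊗[ℤ] Additive (Abelianization (SpecialLinearGroup (Fin 2) (ℤ√(-6))))) = 2 := by
  rw [Module.finrank_eq_card_basis
    (Module.Basis.mk linearIndependent_rationalClass span_rationalClass_eq_top.ge),
    Fintype.card_fin]

/-- The isomorphism of special linear groups induced by a ring isomorphism. -/
def specialLinearGroupCongr {R S : Type*} [CommRing R] [CommRing S] (e : R ≃+* S) :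
    SpecialLinearGroup (Fin 2) R ≃* SpecialLinearGroup (Fin 2) S :=
  MonoidHom.toMulEquiv (Matrix.SpecialLinearGroup.map e.toRingHom)
    (Matrix.SpecialLinearGroup.map e.symm.toRingHom)
    (by ext; simp) (by ext; simp)

end BianchiSqrtNegSix

/-- Let `𝓞` be the ring of integers of the imaginary quadratic field
`ℚ(√-6)` and `Γ = SL₂(𝓞)` the Bianchi group. Then `H₁(Γ; ℚ) ≅ ℚ²`; equivalently,
`ℚ ⊗_ℤ Abelianization(Γ)` is a ℚ-vector space of dimension `2`. -/
theorem first_rational_homology_of_bianchi_sqrt_neg_six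
    (K : Type) [Field K] [NumberField K]
    (α : K) (hα : α ^ 2 = -(6 : K)) (hgen : Algebra.adjoin ℚ {α} = ⊤) :
    Module.finrank ℚ
        (ℚ ⊗[ℤ]
          Additive (Abelianization (Matrix.SpecialLinearGroup (Fin 2) (𝓞 K)))) = 2 := by
  obtain ⟨e⟩ := BianchiSqrtNegSix.nonempty_ringEquiv_ringOfIntegers hα hgen
  rw [BianchiSqrtNegSix.finrank_congr (BianchiSqrtNegSix.specialLinearGroupCongr e)]
  exact BianchiSqrtNegSix.finrank_eq_two
end

section
/- Let 𝓞 be the ring of integers of the imaginary quadratic field ℚ(√-6), and let Γ = SL₂(𝓞). Then the second group homology of Γ with trivial rational coefficients, H₂(Γ; ℚ), is isomorphic to ℚ. -/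
open NumberField Matrix

/-! Group homology `H₂(G; ℚ)` with trivial coefficients, defined via the standard
(inhomogeneous) bar complex `⋯ → ℚ[G×G×G] → ℚ[G×G] → ℚ[G]`:
for trivial coefficients the differentials are
`d₂(g, h) = (h) - (g*h) + (g)` and
`d₃(g, h, k) = (h, k) - (g*h, k) + (g, h*k) - (g, h)`,
and `H₂(G; ℚ) = ker d₂ / im d₃`. -/

/-- The differential `ℚ[G × G] → ℚ[G]` of the inhomogeneous bar complex with trivial
ℚ-coefficients. -/
noncomputable def barD2 (G : Type) [Group G] : ((G × G) →₀ ℚ) →ₗ[ℚ] (G →₀ ℚ) :=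
  Finsupp.lift _ ℚ _ fun p =>
    Finsupp.single p.2 1 - Finsupp.single (p.1 * p.2) 1 + Finsupp.single p.1 1

/-- The differential `ℚ[G × G × G] → ℚ[G × G]` of the inhomogeneous bar complex with trivial
ℚ-coefficients. -/
noncomputable def barD3 (G : Type) [Group G] : ((G × G × G) →₀ ℚ) →ₗ[ℚ] ((G × G) →₀ ℚ) :=
  Finsupp.lift _ ℚ _ fun t =>
    Finsupp.single (t.2.1, t.2.2) 1 - Finsupp.single (t.1 * t.2.1, t.2.2) 1
      + Finsupp.single (t.1, t.2.1 * t.2.2) 1 - Finsupp.single (t.1, t.2.1) 1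

/-- The second group homology `H₂(G; ℚ)` with trivial ℚ-coefficients: the 2-cycles of the
inhomogeneous bar complex modulo the 2-boundaries. -/
noncomputable def groupHomology2 (G : Type) [Group G] :=
  LinearMap.ker (barD2 G) ⧸
    (LinearMap.range (barD3 G)).comap (LinearMap.ker (barD2 G)).subtype

noncomputable instance (G : Type) [Group G] : AddCommGroup (groupHomology2 G) :=
  Submodule.Quotient.addCommGroup _

noncomputable instance (G : Type) [Group G] : Module ℚ (groupHomology2 G) :=
  Submodule.Quotient.module _

namespace BianchiNegSix

/-- A rational inhomogeneous 2-cocycle with trivial coefficients. -/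
def IsCocycle {G : Type} [Group G] (f : G → G → ℚ) : Prop :=
  ∀ g h k, f h k - f (g * h) k + f g (h * k) - f g h = 0

/-- A rational inhomogeneous 2-coboundary with trivial coefficients. -/
def IsCoboundary {G : Type} [Group G] (f : G → G → ℚ) : Prop :=
  ∃ φ : G → ℚ, ∀ g h, f g h = φ h - φ (g * h) + φ g

/-- The cocycles of `G` modulo coboundaries are detected, faithfully and nontrivially, by the
torus spanned by a pair of commuting elements. -/
def HasDetectingTorus (G : Type) [Group G] : Prop :=
  ∃ x y : G, x * y = y * x ∧
    (∀ f : G → G → ℚ, IsCocycle f → f x y = f y x → IsCoboundary f) ∧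
    ∃ f : G → G → ℚ, IsCocycle f ∧ f x y ≠ f y x

theorem HasDetectingTorus.congr {G H : Type} [Group G] [Group H] (e : G ≃* H)
    (hG : HasDetectingTorus G) : HasDetectingTorus H := by
  obtain ⟨x, y, hxy, h1, f, hf, hne⟩ := hG
  refine ⟨e x, e y, by rw [← map_mul, hxy, map_mul], ?_, fun g h => f (e.symm g) (e.symm h), ?_, ?_⟩
  · intro F hF hFxy
    obtain ⟨φ, hφ⟩ := h1 (fun g h => F (e g) (e h))
      (fun g h k => by simpa using hF (e g) (e h) (e k)) hFxy
    exact ⟨fun g => φ (e.symm g), fun g h => by simpa using hφ (e.symm g) (e.symm h)⟩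
  · intro g h k
    simpa using hf (e.symm g) (e.symm h) (e.symm k)
  · simpa using hne

theorem barD2_single {G : Type} [Group G] (g h : G) :
    barD2 G (Finsupp.single (g, h) 1) =
      Finsupp.single h 1 - Finsupp.single (g * h) 1 + Finsupp.single g 1 := by
  simp [barD2]

theorem barD3_single {G : Type} [Group G] (g h k : G) :
    barD3 G (Finsupp.single (g, h, k) 1) =
      Finsupp.single (h, k) 1 - Finsupp.single (g * h, k) 1
        + Finsupp.single (g, h * k) 1 - Finsupp.single (g, h) 1 := by
  simp [barD3]

theorem comp_barD3_eq_zero_iff {G : Type} [Group G] (L : ((G × G) →₀ ℚ) →ₗ[ℚ] ℚ) :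
    L ∘ₗ barD3 G = 0 ↔ IsCocycle fun g h => L (Finsupp.single (g, h) 1) := by
  constructor
  · intro h a b c
    have := LinearMap.congr_fun h (Finsupp.single (a, b, c) 1)
    simpa [barD3_single] using this
  · intro h
    refine Finsupp.lhom_ext' fun ⟨a, b, c⟩ => LinearMap.ext_ring ?_
    simpa [barD3_single] using h a b c

theorem HasDetectingTorus.nonempty_equiv {G : Type} [Group G] (hG : HasDetectingTorus G) :
    Nonempty (groupHomology2 G ≃ₗ[ℚ] ℚ) := by
  obtain ⟨x, y, hxy, h1, f, hf, hne⟩ := hG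
  have hz : (Finsupp.single (x, y) 1 - Finsupp.single (y, x) 1 : (G × G) →₀ ℚ) ∈
      LinearMap.ker (barD2 G) := by
    rw [LinearMap.mem_ker, map_sub, barD2_single, barD2_single, hxy]
    abel
  set z : LinearMap.ker (barD2 G) := ⟨_, hz⟩
  set B := (LinearMap.range (barD3 G)).comap (LinearMap.ker (barD2 G)).subtype with hB
  let mk : LinearMap.ker (barD2 G) →ₗ[ℚ] groupHomology2 G := B.mkQ
  have hmk0 : ∀ w, mk w = 0 ↔ w ∈ B := fun w => Submodule.Quotient.mk_eq_zero B
  have hsurj : Function.Surjective mk := Submodule.mkQ_surjective B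
  have hcne : mk z ≠ 0 := by
    rw [Ne, hmk0]
    rintro ⟨t, ht⟩
    let L : ((G × G) →₀ ℚ) →ₗ[ℚ] ℚ := Finsupp.lift ℚ ℚ _ fun p => f p.1 p.2
    have hL : ∀ g h, L (Finsupp.single (g, h) 1) = f g h := fun g h => by simp [L]
    have h0 : L ∘ₗ barD3 G = 0 := (comp_barD3_eq_zero_iff L).2 (by simpa only [hL] using hf)
    have : L (z : (G × G) →₀ ℚ) = 0 := by
      have := LinearMap.congr_fun h0 t
      rwa [LinearMap.comp_apply, ht] at this
    rw [show (z : (G × G) →₀ ℚ) = Finsupp.single (x, y) 1 - Finsupp.single (y, x) 1 from rfl,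
      map_sub, hL, hL] at this
    exact hne (sub_eq_zero.1 this)
  have hspan : ∀ w, w ∈ Submodule.span ℚ {mk z} := by
    intro w
    by_contra hw
    obtain ⟨ℓ, hℓw, hℓ⟩ := Submodule.exists_dual_map_eq_bot_of_notMem hw inferInstance
    obtain ⟨L, hL⟩ := LinearMap.exists_extend (ℓ ∘ₗ mk)
    have hL' : ∀ v : LinearMap.ker (barD2 G), L v = ℓ (mk v) := LinearMap.congr_fun hL
    have hcoc : IsCocycle fun g h => L (Finsupp.single (g, h) 1) := by
      intro a b c
      have hker : barD3 G (Finsupp.single (a, b, c) 1) ∈ LinearMap.ker (barD2 G) := by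
        rw [LinearMap.mem_ker, barD3_single]
        simp only [map_sub, map_add, barD2_single, mul_assoc]
        abel
      have h := hL' ⟨_, hker⟩
      rw [(hmk0 _).2 ⟨_, rfl⟩, map_zero] at h
      simpa [barD3_single] using h
    have hLz : L (z : (G × G) →₀ ℚ) = 0 := by
      rw [hL']
      have : ℓ (mk z) ∈ (Submodule.span ℚ {mk z}).map ℓ :=
        Submodule.mem_map_of_mem (Submodule.mem_span_singleton_self _)
      rwa [hℓ, Submodule.mem_bot] at this
    obtain ⟨φ, hφ⟩ := h1 _ hcoc (by
      rw [show (z : (G × G) →₀ ℚ) = Finsupp.single (x, y) 1 - Finsupp.single (y, x) 1 from rfl,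
        map_sub] at hLz
      exact sub_eq_zero.1 hLz)
    let Φ : (G →₀ ℚ) →ₗ[ℚ] ℚ := Finsupp.lift ℚ ℚ _ φ
    have hΦs : ∀ g, Φ (Finsupp.single g 1) = φ g := fun g => by simp [Φ]
    have hΦ : L = Φ ∘ₗ barD2 G := by
      refine Finsupp.lhom_ext' fun ⟨a, b⟩ => LinearMap.ext_ring ?_
      simp [barD2_single, hΦs, hφ]
    obtain ⟨v, rfl⟩ := hsurj w
    apply hℓw
    rw [← hL', hΦ, LinearMap.comp_apply, LinearMap.mem_ker.1 v.2, map_zero]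
  refine ⟨(LinearEquiv.ofTop _ ?_).symm ≪≫ₗ (LinearEquiv.toSpanNonzeroSingleton ℚ _ _ hcne).symm⟩
  exact (Submodule.eq_top_iff'.2 hspan)

section RingOfIntegers

variable {K : Type} [Field K] [NumberField K]

theorem exists_eq_add_mul_of_adjoin_eq_top {α : K} (hα : α ^ 2 = -(6 : K))
    (hgen : Algebra.adjoin ℚ {α} = ⊤) (x : K) : ∃ a b : ℚ, x = a + b * α := by
  have hx : x ∈ Algebra.adjoin ℚ {α} := hgen ▸ Algebra.mem_top
  induction hx using Algebra.adjoin_induction with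
  | mem y hy => exact ⟨0, 1, by simp [Set.mem_singleton_iff.1 hy]⟩
  | algebraMap r => exact ⟨r, 0, by simp⟩
  | add y z _ _ hy hz =>
    obtain ⟨a, b, rfl⟩ := hy
    obtain ⟨c, d, rfl⟩ := hz
    exact ⟨a + c, b + d, by push_cast; ring⟩
  | mul y z _ _ hy hz =>
    obtain ⟨a, b, rfl⟩ := hy
    obtain ⟨c, d, rfl⟩ := hz
    exact ⟨a * c - 6 * (b * d), a * d + b * c, by push_cast; linear_combination (b * d : K) * hα⟩

theorem eq_zero_of_add_mul_eq_zero {α : K} (hα : α ^ 2 = -(6 : K)) {a b : ℚ}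
    (h : (a : K) + b * α = 0) : a = 0 ∧ b = 0 := by
  have h2 : (a : K) ^ 2 + 6 * b ^ 2 = 0 := by
    linear_combination (a - b * α : K) * h + (b : K) ^ 2 * hα
  have h3 : a ^ 2 + 6 * b ^ 2 = 0 := by exact_mod_cast h2
  constructor <;> nlinarith [sq_nonneg a, sq_nonneg b]

theorem exists_int_trace_norm_of_isIntegral {α : K} (hα : α ^ 2 = -(6 : K)) {a b : ℚ}
    (hb : b ≠ 0) (h : IsIntegral ℤ ((a : K) + b * α)) :
    ∃ m n : ℤ, 2 * a = m ∧ a ^ 2 + 6 * b ^ 2 = n := by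
  open Polynomial in
  set x : K := a + b * α with hx
  have hxQ : IsIntegral ℚ x := h.tower_top
  let P : ℚ[X] := X ^ 2 + (C (-2 * a) * X + C (a ^ 2 + 6 * b ^ 2))
  have hPd : (C (-2 * a) * X + C (a ^ 2 + 6 * b ^ 2) : ℚ[X]).degree < (2 : ℕ) := by
    compute_degree!
  have hPm : P.Monic := monic_X_pow_add hPd
  have hPn : P.natDegree = 2 := by
    simp only [P]
    compute_degree!
  have hPx : aeval x P = 0 := by
    simp only [P, map_add, map_mul, map_pow, aeval_X, aeval_C, eq_ratCast]
    push_cast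
    rw [hx]
    linear_combination (b : K) ^ 2 * hα
  have h2 : 2 ≤ (minpoly ℚ x).natDegree := by
    rw [minpoly.two_le_natDegree_iff hxQ]
    rintro ⟨q, hq⟩
    rw [eq_ratCast] at hq
    refine hb (eq_zero_of_add_mul_eq_zero (a := a - q) hα ?_).2
    push_cast
    linear_combination -hq + hx
  have hmin : minpoly ℚ x = P :=
    (eq_of_monic_of_dvd_of_natDegree_le (minpoly.monic hxQ) hPm (minpoly.dvd _ _ hPx)
      (hPn ▸ h2)).symm
  have hmap := minpoly.isIntegrallyClosed_eq_field_fractions' ℚ h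
  rw [hmin] at hmap
  have c0 := congrArg (fun p => coeff p 0) hmap
  have c1 := congrArg (fun p => coeff p 1) hmap
  simp only [P, coeff_add, coeff_X_pow, coeff_C_mul, coeff_X, coeff_C, coeff_map] at c0 c1
  norm_num at c0 c1
  exact ⟨-(minpoly ℤ x).coeff 1, _, by push_cast; linarith, c0⟩

theorem exists_int_coords_of_isIntegral {α : K} (hα : α ^ 2 = -(6 : K)) {a b : ℚ}
    (h : IsIntegral ℤ ((a : K) + b * α)) : ∃ m n : ℤ, a = m ∧ b = n := by
  by_cases hb : b = 0
  · subst hb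
    have h1 : IsIntegral ℤ (algebraMap ℚ K a) := by simpa using h
    obtain ⟨m, hm⟩ := IsIntegrallyClosed.isIntegral_iff.1
      ((isIntegral_algebraMap_iff (algebraMap ℚ K).injective).1 h1)
    exact ⟨m, 0, by simpa using hm.symm, by simp⟩
  · obtain ⟨A, n, hA, hn⟩ := exists_int_trace_norm_of_isIntegral hα hb h
    have hB6 : 6 * (2 * b) ^ 2 = ((4 * n - A ^ 2 : ℤ) : ℚ) := by
      push_cast; rw [← hn, ← hA]; ring
    have hBint : IsIntegral ℤ (6 * (2 * b)) := by
      refine IsIntegral.of_pow (n := 2) (by norm_num) ?_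
      rw [show (6 * (2 * b)) ^ 2 = ((6 * (4 * n - A ^ 2) : ℤ) : ℚ) by
        rw [Int.cast_mul, ← hB6]; push_cast; ring]
      exact isIntegral_algebraMap
    obtain ⟨C, hC⟩ := IsIntegrallyClosed.isIntegral_iff.1 hBint
    rw [eq_intCast] at hC
    have hC2 : C ^ 2 = 6 * (4 * n - A ^ 2) := by
      have : (C : ℚ) ^ 2 = ((6 * (4 * n - A ^ 2) : ℤ) : ℚ) := by
        rw [hC, Int.cast_mul, ← hB6]; push_cast; ring
      exact_mod_cast this
    have h6 : (6 : ℤ) ∣ C := by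
      have h2 : (2 : ℤ) ∣ C := Int.prime_two.dvd_of_dvd_pow (n := 2) ⟨3 * (4 * n - A ^ 2), by
        rw [hC2]; ring⟩
      have h3 : (3 : ℤ) ∣ C := Int.prime_three.dvd_of_dvd_pow (n := 2) ⟨2 * (4 * n - A ^ 2), by
        rw [hC2]; ring⟩
      omega
    obtain ⟨B, rfl⟩ := h6
    have hAB : A ^ 2 + 6 * B ^ 2 = 4 * n := by nlinarith
    have hbB : 2 * b = B := by push_cast at hC; linarith
    have hAe : (2 : ℤ) ∣ A := Int.prime_two.dvd_of_dvd_pow (n := 2) ⟨2 * n - 3 * B ^ 2, by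
      linarith⟩
    obtain ⟨A', rfl⟩ := hAe
    have hBe : (2 : ℤ) ∣ B := Int.prime_two.dvd_of_dvd_pow (n := 2) (by
      have : 2 * A' ^ 2 + 3 * B ^ 2 = 2 * n := by nlinarith
      omega)
    obtain ⟨B', rfl⟩ := hBe
    push_cast at hA hbB
    exact ⟨A', B', by linarith, by linarith⟩

/-- The ring of integers of `ℚ(√-6)` is `ℤ[√-6]`. -/
theorem nonempty_ringEquiv_ringOfIntegers {α : K} (hα : α ^ 2 = -(6 : K))
    (hgen : Algebra.adjoin ℚ {α} = ⊤) : Nonempty (ℤ√(-6) ≃+* 𝓞 K) := by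
  have hαint : IsIntegral ℤ α := by
    refine IsIntegral.of_pow (n := 2) (by norm_num) ?_
    rw [hα]
    exact_mod_cast (isIntegral_algebraMap : IsIntegral ℤ (algebraMap ℤ K (-6)))
  let β : 𝓞 K := ⟨α, hαint⟩
  have hβ : β * β = ((-6 : ℤ) : 𝓞 K) := by
    apply NumberField.RingOfIntegers.ext
    simp only [map_mul, map_intCast]
    push_cast
    rw [← hα, sq]
    rfl
  let φ : ℤ√(-6) →+* 𝓞 K := Zsqrtd.lift ⟨β, hβ⟩
  have hφ : ∀ z, ((φ z : 𝓞 K) : K) = ((z.re : ℚ) : K) + ((z.im : ℚ) : K) * α := by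
    intro z
    simp only [φ, Zsqrtd.lift_apply_apply, map_add, map_mul, map_intCast]
    push_cast
    rfl
  refine ⟨RingEquiv.ofBijective φ ⟨?_, ?_⟩⟩
  · rw [injective_iff_map_eq_zero]
    intro z hz
    have h := hφ z
    rw [hz, NumberField.RingOfIntegers.coe_eq_algebraMap, map_zero] at h
    obtain ⟨h1, h2⟩ := eq_zero_of_add_mul_eq_zero hα h.symm
    exact Zsqrtd.ext (by exact_mod_cast h1) (by exact_mod_cast h2)
  · intro y
    obtain ⟨a, b, hab⟩ := exists_eq_add_mul_of_adjoin_eq_top hα hgen (y : K)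
    obtain ⟨m, n, rfl, rfl⟩ : ∃ m n : ℤ, a = m ∧ b = n :=
      exists_int_coords_of_isIntegral hα (by rw [← hab]; exact y.isIntegral_coe)
    exact ⟨⟨m, n⟩, NumberField.RingOfIntegers.ext (by rw [hφ, hab])⟩

end RingOfIntegers

/-- The isomorphism of special linear groups induced by a ring isomorphism. -/
def specialLinearGroupCongr {R S : Type} [CommRing R] [CommRing S] (e : R ≃+* S) :
    SpecialLinearGroup (Fin 2) R ≃* SpecialLinearGroup (Fin 2) S :=
  MonoidHom.toMulEquiv (SpecialLinearGroup.map e.toRingHom) (SpecialLinearGroup.map e.symm.toRingHom)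
    (by ext; simp) (by ext; simp)

/-- The group `SL₂(ℤ[√-6])`. -/
abbrev Bianchi : Type := SpecialLinearGroup (Fin 2) (ℤ√(-6))

theorem bianchi_ext {g h : Bianchi} (h00 : g 0 0 = h 0 0) (h01 : g 0 1 = h 0 1)
    (h10 : g 1 0 = h 1 0) (h11 : g 1 1 = h 1 1) : g = h := by
  apply Subtype.ext
  rw [Matrix.eta_fin_two g.1, Matrix.eta_fin_two h.1]
  exact congrArg _ (by simp [h00, h01, h10, h11])

/-- The real part of `x * star y`. -/
def reMulStar (x y : ℤ√(-6)) : ℤ := x.re * y.re + 6 * (x.im * y.im)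

/-- The imaginary part of `x * star y`. -/
def imMulStar (x y : ℤ√(-6)) : ℤ := x.im * y.re - x.re * y.im

theorem reMulStar_self_nonneg (x : ℤ√(-6)) : 0 ≤ reMulStar x x := by
  unfold reMulStar; nlinarith [sq_nonneg x.re, sq_nonneg x.im]

theorem det_re (g : Bianchi) :
    (g 0 0).re * (g 1 1).re - 6 * ((g 0 0).im * (g 1 1).im) - (g 0 1).re * (g 1 0).re
      + 6 * ((g 0 1).im * (g 1 0).im) = 1 := by
  have h := congrArg Zsqrtd.re ((Matrix.det_fin_two g.1).symm.trans g.2)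
  simp only [Zsqrtd.re_sub, Zsqrtd.re_mul, Zsqrtd.re_one] at h
  linarith

theorem det_im (g : Bianchi) :
    (g 0 0).re * (g 1 1).im + (g 0 0).im * (g 1 1).re - (g 0 1).re * (g 1 0).im
      - (g 0 1).im * (g 1 0).re = 0 := by
  have h := congrArg Zsqrtd.im ((Matrix.det_fin_two g.1).symm.trans g.2)
  simp only [Zsqrtd.im_sub, Zsqrtd.im_mul, Zsqrtd.im_one] at h
  linarith

theorem mul_apply_two (g x : Bianchi) (i j : Fin 2) :
    (g * x) i j = g i 0 * x 0 j + g i 1 * x 1 j := by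
  simp [Matrix.mul_apply, Fin.sum_univ_two]

section HermitianForms

/-- The Hermitian form `k₀ |y|² + k₁ Re (x ȳ) + k₂ Im (x ȳ)`. -/
def hermForm (k : ℤ × ℤ × ℤ) (x y : ℤ√(-6)) : ℤ :=
  k.1 * reMulStar y y + k.2.1 * reMulStar x y + k.2.2 * imMulStar x y

/-- Value of the form on the first column. -/
def formA (k : ℤ × ℤ × ℤ) (g : Bianchi) : ℤ := hermForm k (g 0 0) (g 1 0)

/-- Value of the form on the second column. -/
def formC (k : ℤ × ℤ × ℤ) (g : Bianchi) : ℤ := hermForm k (g 0 1) (g 1 1)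

/-- Real part of the polar form of the two columns. -/
def formL (k : ℤ × ℤ × ℤ) (g : Bianchi) : ℤ :=
  2 * k.1 * reMulStar (g 1 0) (g 1 1)
    + k.2.1 * (reMulStar (g 0 0) (g 1 1) + reMulStar (g 0 1) (g 1 0))
    + k.2.2 * (imMulStar (g 0 0) (g 1 1) + imMulStar (g 0 1) (g 1 0))

/-- Imaginary part of the polar form of the two columns. -/
def formM (k : ℤ × ℤ × ℤ) (g : Bianchi) : ℤ :=
  -12 * k.1 * imMulStar (g 1 0) (g 1 1)
    + 6 * k.2.1 * (imMulStar (g 0 1) (g 1 0) - imMulStar (g 0 0) (g 1 1))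
    + k.2.2 * (reMulStar (g 0 0) (g 1 1) - reMulStar (g 0 1) (g 1 0))

theorem hermForm_comb (k : ℤ × ℤ × ℤ) (a b c d y z : ℤ√(-6)) :
    hermForm k (a * y + b * z) (c * y + d * z) =
      reMulStar y y * hermForm k a c + reMulStar z z * hermForm k b d
        + (2 * k.1 * reMulStar c d + k.2.1 * (reMulStar a d + reMulStar b c)
            + k.2.2 * (imMulStar a d + imMulStar b c)) * reMulStar y z
        + (-12 * k.1 * imMulStar c d + 6 * k.2.1 * (imMulStar b c - imMulStar a d)
            + k.2.2 * (reMulStar a d - reMulStar b c)) * imMulStar y z := by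
  simp only [hermForm, reMulStar, imMulStar, Zsqrtd.re_add, Zsqrtd.im_add, Zsqrtd.re_mul,
    Zsqrtd.im_mul]
  ring

theorem formA_mul (k : ℤ × ℤ × ℤ) (g x : Bianchi) :
    formA k (g * x) = reMulStar (x 0 0) (x 0 0) * formA k g + reMulStar (x 1 0) (x 1 0) * formC k g
      + formL k g * reMulStar (x 0 0) (x 1 0) + formM k g * imMulStar (x 0 0) (x 1 0) := by
  unfold formA
  rw [mul_apply_two, mul_apply_two, hermForm_comb]
  rfl

theorem formC_mul (k : ℤ × ℤ × ℤ) (g x : Bianchi) :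
    formC k (g * x) = reMulStar (x 0 1) (x 0 1) * formA k g + reMulStar (x 1 1) (x 1 1) * formC k g
      + formL k g * reMulStar (x 0 1) (x 1 1) + formM k g * imMulStar (x 0 1) (x 1 1) := by
  unfold formC
  rw [mul_apply_two, mul_apply_two, hermForm_comb]
  rfl

theorem form_disc (k : ℤ × ℤ × ℤ) (g : Bianchi) :
    6 * formL k g ^ 2 + formM k g ^ 2 =
      6 * k.2.1 ^ 2 + k.2.2 ^ 2 + 24 * (formA k g * formC k g) := by
  have h1 := det_re g
  have h2 := det_im g
  obtain ⟨k0, k1, k2⟩ := k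
  simp only [formA, formC, formL, formM, hermForm, reMulStar, imMulStar]
  generalize (g 0 0).re = a at *
  generalize (g 0 0).im = a' at *
  generalize (g 0 1).re = b at *
  generalize (g 0 1).im = b' at *
  generalize (g 1 0).re = c at *
  generalize (g 1 0).im = c' at *
  generalize (g 1 1).re = d at *
  generalize (g 1 1).im = d' at *
  linear_combination (6 * k1 ^ 2 + k2 ^ 2) *
    ((a * d - 6 * (a' * d') - b * c + 6 * (b' * c') + 1) * h1
      + 6 * (a * d' + a' * d - b * c' - b' * c) * h2)

theorem formA_mul_formC_nonneg {k : ℤ × ℤ × ℤ} (hk : 6 * k.2.1 ^ 2 + k.2.2 ^ 2 ≤ 6)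
    (g : Bianchi) : 0 ≤ formA k g * formC k g := by
  have := form_disc k g
  by_contra! h
  nlinarith [sq_nonneg (formL k g), sq_nonneg (formM k g)]

/-- Squared length of the first row. -/
def rowA (x : Bianchi) : ℤ := reMulStar (x 0 0) (x 0 0) + reMulStar (x 0 1) (x 0 1)

/-- Squared length of the second row. -/
def rowB (x : Bianchi) : ℤ := reMulStar (x 1 0) (x 1 0) + reMulStar (x 1 1) (x 1 1)

/-- Real part of the inner product of the rows. -/
def rowP (x : Bianchi) : ℤ := reMulStar (x 0 0) (x 1 0) + reMulStar (x 0 1) (x 1 1)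

/-- Imaginary part of the inner product of the rows. -/
def rowQ (x : Bianchi) : ℤ := imMulStar (x 0 0) (x 1 0) + imMulStar (x 0 1) (x 1 1)

theorem row_disc (x : Bianchi) : rowP x ^ 2 + 6 * rowQ x ^ 2 = rowA x * rowB x - 1 := by
  have h1 := det_re x
  have h2 := det_im x
  simp only [rowA, rowB, rowP, rowQ, reMulStar, imMulStar]
  generalize (x 0 0).re = a at *
  generalize (x 0 0).im = a' at *
  generalize (x 0 1).re = b at *
  generalize (x 0 1).im = b' at *
  generalize (x 1 0).re = c at *
  generalize (x 1 0).im = c' at *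
  generalize (x 1 1).re = d at *
  generalize (x 1 1).im = d' at *
  linear_combination -((a * d - 6 * (a' * d') - b * c + 6 * (b' * c') + 1) * h1
      + 6 * (a * d' + a' * d - b * c' - b' * c) * h2)

theorem rowA_nonneg (x : Bianchi) : 0 ≤ rowA x :=
  add_nonneg (reMulStar_self_nonneg _) (reMulStar_self_nonneg _)

theorem rowB_nonneg (x : Bianchi) : 0 ≤ rowB x :=
  add_nonneg (reMulStar_self_nonneg _) (reMulStar_self_nonneg _)

theorem rowA_pos (x : Bianchi) : 0 < rowA x := by
  have := row_disc x
  refine (rowA_nonneg x).lt_of_ne fun h => ?_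
  rw [← h] at this
  nlinarith [sq_nonneg (rowP x), sq_nonneg (rowQ x)]

theorem rowB_pos (x : Bianchi) : 0 < rowB x := by
  have := row_disc x
  refine (rowB_nonneg x).lt_of_ne fun h => ?_
  rw [← h] at this
  nlinarith [sq_nonneg (rowP x), sq_nonneg (rowQ x)]

/-- The sign of the trace of the transformed Hermitian form. -/
def formSign (k : ℤ × ℤ × ℤ) (g : Bianchi) : ℤ := (formA k g + formC k g).sign

theorem trace_mul (k : ℤ × ℤ × ℤ) (g x : Bianchi) :
    formA k (g * x) + formC k (g * x) = rowA x * formA k g + rowB x * formC k g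
      + (formL k g * rowP x + formM k g * rowQ x) := by
  rw [formA_mul, formC_mul]
  simp only [rowA, rowB, rowP, rowQ]
  ring

theorem mul_nonpos_of_sign_ne {x y : ℤ} (h : x.sign ≠ y.sign) : x * y ≤ 0 := by
  by_contra! h'
  rcases pos_and_pos_or_neg_and_neg_of_mul_pos h' with ⟨h1, h2⟩ | ⟨h1, h2⟩
  · exact h (by rw [Int.sign_eq_one_of_pos h1, Int.sign_eq_one_of_pos h2])
  · exact h (by rw [Int.sign_eq_neg_one_of_neg h1, Int.sign_eq_neg_one_of_neg h2])

theorem sq_le_of_formSign_ne {k : ℤ × ℤ × ℤ} (hk : 6 * k.2.1 ^ 2 + k.2.2 ^ 2 ≤ 6)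
    {g x : Bianchi} (h : formSign k g ≠ formSign k (g * x)) :
    6 * ((rowA x * formA k g - rowB x * formC k g) ^ 2 + 4 * (formA k g * formC k g)) ≤
      (6 * k.2.1 ^ 2 + k.2.2 ^ 2) * (rowA x * rowB x - 1) := by
  have hAC := formA_mul_formC_nonneg hk g
  have hdisc := form_disc k g
  have hrow := row_disc x
  have ha := rowA_pos x
  have hb := rowB_pos x
  have hmul := mul_nonpos_of_sign_ne h
  rw [trace_mul] at hmul
  generalize formA k g = A at *
  generalize formC k g = C at *
  generalize formL k g = L at *
  generalize formM k g = M at *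
  generalize rowA x = a at *
  generalize rowB x = b at *
  generalize rowP x = p at *
  generalize rowQ x = q at *
  generalize 6 * k.2.1 ^ 2 + k.2.2 ^ 2 = κ at *
  have hcs : 6 * (L * p + M * q) ^ 2 ≤ (κ + 24 * (A * C)) * (a * b - 1) := by
    rw [← hdisc, ← hrow]
    nlinarith [sq_nonneg (6 * L * q - M * p)]
  have hsq : (a * A + b * C) ^ 2 ≤ (L * p + M * q) ^ 2 := by
    rcases lt_trichotomy (A + C) 0 with hs | hs | hs
    · have hA : A ≤ 0 := by by_contra! hA; nlinarith
      have hC : C ≤ 0 := by by_contra! hC; nlinarith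
      have h0 : a * A + b * C ≤ 0 := by nlinarith
      have h1 : 0 ≤ a * A + b * C + (L * p + M * q) := by by_contra! h1; nlinarith
      nlinarith
    · have hA : A = 0 := by
        have : C = -A := by linarith
        subst this
        nlinarith
      have hC : C = 0 := by linarith
      subst hA hC
      nlinarith [sq_nonneg (L * p + M * q)]
    · have hA : 0 ≤ A := by by_contra! hA; nlinarith
      have hC : 0 ≤ C := by by_contra! hC; nlinarith
      have h0 : 0 ≤ a * A + b * C := by nlinarith
      have h1 : a * A + b * C + (L * p + M * q) ≤ 0 := by by_contra! h1; nlinarith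
      nlinarith
  nlinarith

end HermitianForms

section Finiteness

/-- The values of two Hermitian forms on the columns, with the polar part. -/
def formData (k : ℤ × ℤ × ℤ) (g : Bianchi) : ℤ × ℤ × ℤ × ℤ :=
  (formA k g, formL k g, formM k g, formC k g)

theorem formA_mul_eq_of_formData_eq {k : ℤ × ℤ × ℤ} {g g' : Bianchi}
    (h : formData k g = formData k g') (x : Bianchi) : formA k (g * x) = formA k (g' * x) := by
  simp only [formData, Prod.mk.injEq] at h
  obtain ⟨h1, h2, h3, h4⟩ := h
  rw [formA_mul, formA_mul, h1, h2, h3, h4]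

theorem formC_mul_eq_of_formData_eq {k : ℤ × ℤ × ℤ} {g g' : Bianchi}
    (h : formData k g = formData k g') (x : Bianchi) : formC k (g * x) = formC k (g' * x) := by
  simp only [formData, Prod.mk.injEq] at h
  obtain ⟨h1, h2, h3, h4⟩ := h
  rw [formC_mul, formC_mul, h1, h2, h3, h4]

theorem abs_le_of_sq_sub_le {a b x y N : ℤ} (ha : 0 < a) (hb : 0 < b) (hxy : 0 ≤ x * y)
    (h : (a * x - b * y) ^ 2 + 4 * (x * y) ≤ N) : |x| ≤ N ∧ |y| ≤ N := by
  have hN : 0 ≤ N := by nlinarith [sq_nonneg (a * x - b * y)]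
  rcases eq_or_ne y 0 with rfl | hy
  · refine ⟨?_, by simpa⟩
    have hx : x ^ 2 ≤ N := by
      have : 1 ≤ a ^ 2 := by nlinarith
      nlinarith [sq_nonneg x]
    rw [abs_le]
    constructor <;> nlinarith
  rcases eq_or_ne x 0 with rfl | hx
  · refine ⟨by simpa, ?_⟩
    have hy' : y ^ 2 ≤ N := by
      have : 1 ≤ b ^ 2 := by nlinarith
      nlinarith [sq_nonneg y]
    rw [abs_le]
    constructor <;> nlinarith
  have hx1 : 1 ≤ |x| := Int.one_le_abs hx
  have hy1 : 1 ≤ |y| := Int.one_le_abs hy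
  have : |x| * |y| ≤ N := by
    rw [← abs_mul, abs_of_nonneg hxy]
    nlinarith [sq_nonneg (a * x - b * y)]
  constructor <;> nlinarith

theorem exists_formData_mem_Icc {k : ℤ × ℤ × ℤ} (hk : 6 * k.2.1 ^ 2 + k.2.2 ^ 2 ≤ 6)
    (x : Bianchi) : ∃ N : ℤ, ∀ g, formSign k g ≠ formSign k (g * x) →
      formData k g ∈ Set.Icc (-(N, N, N, N)) (N, N, N, N) := by
  set M := rowA x * rowB x - 1 with hM
  refine ⟨6 + 24 * M ^ 2 + M, fun g hg => ?_⟩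
  have hAC := formA_mul_formC_nonneg hk g
  have hM0 : 0 ≤ M := by nlinarith [rowA_pos x, rowB_pos x]
  have h := sq_le_of_formSign_ne hk hg
  rw [← hM] at h
  have hle : (rowA x * formA k g - rowB x * formC k g) ^ 2 + 4 * (formA k g * formC k g) ≤ M := by
    nlinarith [mul_nonneg (sub_nonneg.2 hk) hM0]
  obtain ⟨h1, h2⟩ := abs_le_of_sq_sub_le (rowA_pos x) (rowB_pos x) hAC hle
  have hd := form_disc k g
  have hACM : formA k g * formC k g ≤ M ^ 2 := by
    rw [← abs_of_nonneg hAC, abs_mul, sq]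
    exact mul_le_mul h1 h2 (abs_nonneg _) hM0
  have hsq : ∀ z : ℤ, z ^ 2 ≤ 6 + 24 * M ^ 2 → |z| ≤ 6 + 24 * M ^ 2 := by
    intro z hz
    rw [abs_le]
    constructor <;> nlinarith [sq_nonneg M]
  have h3 := hsq (formL k g) (by nlinarith [sq_nonneg (formL k g), sq_nonneg (formM k g)])
  have h4 := hsq (formM k g) (by nlinarith [sq_nonneg (formL k g), sq_nonneg (formM k g)])
  rw [abs_le] at h1 h2 h3 h4
  simp only [formData, Set.mem_Icc, Prod.neg_mk, Prod.mk_le_mk]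
  have := sq_nonneg M
  refine ⟨⟨?_, ?_, ?_, ?_⟩, ⟨?_, ?_, ?_, ?_⟩⟩ <;> linarith

/-- Parameters of the first Hermitian form, `|y|² - 2 Im (x ȳ)`. -/
abbrev formU : ℤ × ℤ × ℤ := (1, 0, -2)

/-- Parameters of the second Hermitian form, `Re (x ȳ)`. -/
abbrev formV : ℤ × ℤ × ℤ := (0, 1, 0)

theorem lower_left_eq_zero {g : Bianchi} (hu : formA formU g = 0) (hv : formA formV g = 0) :
    g 1 0 = 0 := by
  simp only [formA, hermForm, reMulStar, imMulStar] at hu hv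
  have h1 := det_re g
  have h2 := det_im g
  by_contra hne
  have hc : (g 1 0).re ≠ 0 ∨ (g 1 0).im ≠ 0 := by
    by_contra! h
    exact hne (Zsqrtd.ext h.1 h.2)
  generalize (g 0 0).re = a at *
  generalize (g 0 0).im = a' at *
  generalize (g 0 1).re = b at *
  generalize (g 0 1).im = b' at *
  generalize (g 1 0).re = c at *
  generalize (g 1 0).im = c' at *
  generalize (g 1 1).re = d at *
  generalize (g 1 1).im = d' at *
  have hN : c ^ 2 + 6 * c' ^ 2 ≠ 0 := by
    rcases hc with h | h
    · have := sq_pos_of_ne_zero h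
      nlinarith [sq_nonneg c']
    · have := sq_pos_of_ne_zero h
      nlinarith [sq_nonneg c]
  have ha : a = -3 * c' := by
    apply mul_left_cancel₀ hN
    linear_combination c * hv + 3 * c' * hu
  have hc : c = 2 * a' := by
    apply mul_left_cancel₀ hN
    linear_combination c * hu - 2 * c' * hv
  subst ha hc
  have h3 : (2 * a' ^ 2 + 3 * c' ^ 2) * (2 * (3 * d' + b) ^ 2 + 3 * (d - 2 * b') ^ 2 * 1) = 1 := by
    nlinarith
  have h4 : 2 * a' ^ 2 + 3 * c' ^ 2 = 1 := by
    refine Int.eq_one_of_mul_eq_one_right ?_ h3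
    positivity
  rcases eq_or_ne c' 0 with rfl | h
  · omega
  · have := sq_pos_of_ne_zero h
    nlinarith [sq_nonneg a']

theorem exists_sign_of_lower_left_eq_zero {g : Bianchi} (h : g 1 0 = 0) :
    ∃ ε : ℤ, ε ^ 2 = 1 ∧ g 0 0 = ε ∧ g 1 1 = ε := by
  have h1 := det_re g
  have h2 := det_im g
  rw [h] at h1 h2
  simp only [Zsqrtd.re_zero, Zsqrtd.im_zero, mul_zero, sub_zero, add_zero] at h1 h2
  have hN : ((g 0 0).re ^ 2 + 6 * (g 0 0).im ^ 2) * ((g 1 1).re ^ 2 + 6 * (g 1 1).im ^ 2) = 1 := by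
    linear_combination ((g 0 0).re * (g 1 1).re - 6 * ((g 0 0).im * (g 1 1).im) + 1) * h1
      + 6 * ((g 0 0).re * (g 1 1).im + (g 0 0).im * (g 1 1).re) * h2
  have ha := Int.eq_one_of_mul_eq_one_right (by positivity) hN
  have hd := Int.eq_one_of_mul_eq_one_left (by positivity) hN
  have hz : ∀ x y : ℤ, x ^ 2 + 6 * y ^ 2 = 1 → y = 0 := by
    intro x y hxy
    by_contra hy
    have := sq_pos_of_ne_zero hy
    nlinarith [sq_nonneg x]
  have ha0 := hz _ _ ha
  have hd0 := hz _ _ hd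
  rw [ha0] at ha h1
  rw [hd0] at h1
  refine ⟨(g 0 0).re, by linarith, Zsqrtd.ext (by simp) (by simp [ha0]), Zsqrtd.ext ?_ (by simp [hd0])⟩
  simp only [Zsqrtd.re_intCast]
  linear_combination (g 0 0).re * h1 - (g 1 1).re * ha

theorem eq_one_or_neg_one_of_forms {g : Bianchi} (hu : formA formU g = 0)
    (hv : formA formV g = 0) (hu' : formC formU g = 1) (hv' : formC formV g = 0) :
    g = 1 ∨ g = -1 := by
  have hc := lower_left_eq_zero hu hv
  obtain ⟨ε, hε, ha, hd⟩ := exists_sign_of_lower_left_eq_zero hc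
  have hε' : ε ≠ 0 := by rintro rfl; norm_num at hε
  simp only [formC, hermForm, reMulStar, imMulStar, hd] at hu' hv'
  simp at hu' hv'
  have hb : g 0 1 = 0 := by
    refine Zsqrtd.ext ?_ ?_
    · simpa [hε'] using hv'
    · have : (g 0 1).im * ε = 0 := by nlinarith
      simpa [hε'] using this
  rcases mul_self_eq_one_iff.1 ((sq ε).symm.trans hε) with rfl | rfl
  · left
    apply bianchi_ext <;> simp [ha, hb, hc, hd]
  · right
    apply bianchi_ext <;> simp [ha, hb, hc, hd]

theorem finite_support (x y z : Bianchi) :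
    {g : Bianchi | formSign formU g ≠ formSign formU (g * x) ∧
      formSign formV (g * y) ≠ formSign formV (g * z)}.Finite := by
  obtain ⟨N, hN⟩ := exists_formData_mem_Icc (k := formU) (by norm_num) x
  obtain ⟨M, hM⟩ := exists_formData_mem_Icc (k := formV) (by norm_num) (y⁻¹ * z)
  refine (Set.Finite.preimage' (f := fun g : Bianchi => (formData formU g, formData formV (g * y)))
    ((Set.finite_Icc (-(N, N, N, N)) (N, N, N, N)).prod
      (Set.finite_Icc (-(M, M, M, M)) (M, M, M, M))) ?_).subset ?_
  · intro b _
    rcases Set.eq_empty_or_nonempty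
      ((fun g : Bianchi => (formData formU g, formData formV (g * y))) ⁻¹' {b}) with h | ⟨g', hg'⟩
    · rw [h]; exact Set.finite_empty
    refine (Set.toFinite {g', -g'}).subset fun g hg => ?_
    have heq := (Set.mem_singleton_iff.1 hg).trans (Set.mem_singleton_iff.1 hg').symm
    obtain ⟨h1, h2⟩ := Prod.mk.inj heq
    have e1 := formA_mul_eq_of_formData_eq h1 g'⁻¹
    have e2 := formC_mul_eq_of_formData_eq h1 g'⁻¹
    have e3 := formA_mul_eq_of_formData_eq h2 (g' * y)⁻¹
    have e4 := formC_mul_eq_of_formData_eq h2 (g' * y)⁻¹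
    rw [mul_inv_cancel] at e1 e2 e3 e4
    rw [_root_.mul_inv_rev, mul_assoc, mul_inv_cancel_left] at e3 e4
    rcases eq_one_or_neg_one_of_forms (g := g * g'⁻¹) (by rw [e1]; decide) (by rw [e3]; decide)
      (by rw [e2]; decide) (by rw [e4]; decide) with h | h
    · left; exact mul_inv_eq_one.1 h
    · right; rw [mul_inv_eq_iff_eq_mul.1 h]; simp
  · rintro g ⟨h1, h2⟩
    exact ⟨hN g h1, hM (g * y) (by rwa [mul_assoc, mul_inv_cancel_left])⟩

end Finiteness

section LowerBound

/-- Upper triangular unipotent matrices. -/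
def unip (z : ℤ√(-6)) : Bianchi := ⟨!![1, z; 0, 1], by simp⟩

@[simp] theorem unip_00 (z : ℤ√(-6)) : unip z 0 0 = 1 := rfl
@[simp] theorem unip_01 (z : ℤ√(-6)) : unip z 0 1 = z := rfl
@[simp] theorem unip_10 (z : ℤ√(-6)) : unip z 1 0 = 0 := rfl
@[simp] theorem unip_11 (z : ℤ√(-6)) : unip z 1 1 = 1 := rfl

theorem unip_mul (y z : ℤ√(-6)) : unip y * unip z = unip (y + z) := by
  apply bianchi_ext <;> rw [mul_apply_two] <;> simp [add_comm]

/-- The translation by `1`. -/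
abbrev trT : Bianchi := unip 1

/-- The translation by `√-6`. -/
abbrev trS : Bianchi := unip ⟨0, 1⟩

/-- The summand of the intersection cocycle. -/
def crossTerm (g h γ : Bianchi) : ℤ :=
  (formSign formU γ - formSign formU (γ * g)) *
    (formSign formV (γ * g) - formSign formV (γ * (g * h)))

theorem crossTerm_support_finite (g h : Bianchi) : (Function.support (crossTerm g h)).Finite := by
  refine (finite_support g g (g * h)).subset fun γ hγ => ?_
  have := mul_ne_zero_iff.1 (Function.mem_support.1 hγ)
  exact ⟨sub_ne_zero.1 this.1, sub_ne_zero.1 this.2⟩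

/-- The cocycle counting signed intersections of the walls of the two Hermitian forms. -/
noncomputable def crossCocycle (g h : Bianchi) : ℤ := ∑ᶠ γ, crossTerm g h γ

theorem crossCocycle_cocycle (g h k : Bianchi) :
    crossCocycle h k + crossCocycle g (h * k) = crossCocycle (g * h) k + crossCocycle g h := by
  have hre : crossCocycle h k = ∑ᶠ γ, crossTerm h k (γ * g) :=
    (finsum_comp_equiv (Equiv.mulRight g)).symm
  have hfin : (Function.support fun γ => crossTerm h k (γ * g)).Finite :=
    (crossTerm_support_finite h k).preimage (Equiv.mulRight g).injective.injOn
  rw [hre]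
  unfold crossCocycle
  rw [← finsum_add_distrib hfin (crossTerm_support_finite _ _),
    ← finsum_add_distrib (crossTerm_support_finite _ _) (crossTerm_support_finite _ _)]
  refine finsum_congr fun γ => ?_
  simp only [crossTerm, mul_assoc]
  ring

theorem formSign_mul_trT {k : ℤ × ℤ × ℤ} (hk : 6 * k.2.1 ^ 2 + k.2.2 ^ 2 ≤ 6) {g : Bianchi}
    (h : formSign k g ≠ formSign k (g * trT)) : formA k g = 0 := by
  have := sq_le_of_formSign_ne hk h
  simp [rowA, rowB, reMulStar] at this
  by_contra hA
  have := sq_pos_of_ne_zero hA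
  nlinarith [sq_nonneg (formC k g)]

theorem formSign_formU_mul_trT (g : Bianchi) : formSign formU g = formSign formU (g * trT) := by
  by_contra h
  have h1 := sq_le_of_formSign_ne (k := formU) (by norm_num) h
  have hA := formSign_mul_trT (by norm_num) h
  have hd := form_disc formU g
  simp [rowA, rowB, reMulStar, hA] at h1 hd
  have hC : formC formU g = 0 := by
    by_contra hC
    have := sq_pos_of_ne_zero hC
    omega
  have hL : formL formU g = 0 := by
    by_contra hL
    have := sq_pos_of_ne_zero hL
    nlinarith [sq_nonneg (formM formU g)]
  apply h
  unfold formSign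
  rw [trace_mul]
  simp [hA, hC, hL, rowQ, imMulStar]

theorem formSign_formU_mul_trS {g : Bianchi} (h : formSign formU g ≠ formSign formU (g * trS)) :
    formA formU g = 0 := by
  have := sq_le_of_formSign_ne (k := formU) (by norm_num) h
  simp [rowA, rowB, reMulStar] at this
  by_contra hA
  have := sq_pos_of_ne_zero hA
  nlinarith [sq_nonneg (formC formU g - 5 * formA formU g)]

theorem crossTerm_trT (h γ : Bianchi) : crossTerm trT h γ = 0 := by
  simp [crossTerm, ← formSign_formU_mul_trT]

theorem formA_mul_unip (k : ℤ × ℤ × ℤ) (g : Bianchi) (z : ℤ√(-6)) :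
    formA k (g * unip z) = formA k g := by
  rw [formA_mul]
  simp [reMulStar, imMulStar]

theorem sign_antitone_at (m n : ℤ) :
    ((1 - 2 * m).sign - (1 - 2 * (m + 1)).sign) * (n.sign - (n + 1).sign) ≤ 0 := by
  have hmono : ∀ x y : ℤ, x ≤ y → x.sign ≤ y.sign := by
    intro x y hxy
    rcases lt_trichotomy x 0 with h | h | h
    · rw [Int.sign_eq_neg_one_of_neg h]
      rcases lt_trichotomy y 0 with h' | h' | h'
      · rw [Int.sign_eq_neg_one_of_neg h']
      · simp [h']
      · rw [Int.sign_eq_one_of_pos h']; norm_num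
    · subst h
      simpa using Int.sign_nonneg_iff.2 hxy
    · rw [Int.sign_eq_one_of_pos h, Int.sign_eq_one_of_pos (h.trans_le hxy)]
  have h1 := hmono (1 - 2 * (m + 1)) (1 - 2 * m) (by omega)
  have h2 := hmono n (n + 1) (by omega)
  nlinarith

theorem crossTerm_trS_trT_nonpos (γ : Bianchi) : crossTerm trS trT γ ≤ 0 := by
  by_contra! hpos
  have hne := mul_ne_zero_iff.1 hpos.ne'
  have hu := formSign_formU_mul_trS (sub_ne_zero.1 hne.1)
  have hv : formA formV γ = 0 := by
    rw [← formA_mul_unip formV γ ⟨0, 1⟩]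
    refine formSign_mul_trT (by norm_num) ?_
    rw [mul_assoc]
    exact sub_ne_zero.1 hne.2
  obtain ⟨ε, hε, ha, hd⟩ := exists_sign_of_lower_left_eq_zero (lower_left_eq_zero hu hv)
  have hc := lower_left_eq_zero hu hv
  have h := sign_antitone_at (ε * (γ 0 1).im) (ε * (γ 0 1).re)
  have e1 : formSign formU γ = (1 - 2 * (ε * (γ 0 1).im)).sign := by
    unfold formSign
    rw [hu]
    simp only [formC, hermForm, reMulStar, imMulStar, hd]
    simp
    congr 1
    linear_combination hε
  have e2 : formSign formU (γ * trS) = (1 - 2 * (ε * (γ 0 1).im + 1)).sign := by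
    unfold formSign
    rw [formA_mul_unip, hu]
    simp only [formC, hermForm, reMulStar, imMulStar, mul_apply_two, hd, ha, hc]
    simp
    congr 1
    linear_combination -hε
  have e3 : formSign formV (γ * trS) = (ε * (γ 0 1).re).sign := by
    unfold formSign
    rw [formA_mul_unip, hv]
    simp only [formC, hermForm, reMulStar, imMulStar, mul_apply_two, hd, ha, hc]
    simp [mul_comm]
  have e4 : formSign formV (γ * (trS * trT)) = (ε * (γ 0 1).re + 1).sign := by
    unfold formSign
    rw [← mul_assoc, formA_mul_unip, formA_mul_unip, hv]
    congr 1
    simp only [formC, hermForm, reMulStar, imMulStar, mul_apply_two, hd, ha, hc]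
    simp
    linear_combination hε
  unfold crossTerm at hpos
  rw [e1, e2, e3, e4] at hpos
  exact absurd hpos (not_lt.2 h)

theorem crossCocycle_trT_trS : crossCocycle trT trS = 0 := by
  simp [crossCocycle, crossTerm_trT]

theorem crossCocycle_trS_trT_neg : crossCocycle trS trT < 0 := by
  have h1 : crossTerm trS trT 1 = -2 := by decide
  have hfin : (Function.support fun γ => -crossTerm trS trT γ).Finite := by
    simpa [Function.support] using crossTerm_support_finite trS trT
  have h2 := single_le_finsum (f := fun γ => -crossTerm trS trT γ) 1 hfin
    (fun γ => neg_nonneg.2 (crossTerm_trS_trT_nonpos γ))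
  rw [finsum_neg_distrib, h1] at h2
  unfold crossCocycle
  linarith

theorem exists_cocycle_ne : ∃ f : Bianchi → Bianchi → ℚ, IsCocycle f ∧ f trT trS ≠ f trS trT := by
  refine ⟨fun g h => crossCocycle g h, fun g h k => ?_, ?_⟩
  · have := crossCocycle_cocycle g h k
    have h' : ((crossCocycle h k + crossCocycle g (h * k) : ℤ) : ℚ) =
      (crossCocycle (g * h) k + crossCocycle g h : ℤ) := by rw [this]
    push_cast at h'
    linarith
  · simp only [crossCocycle_trT_trS]
    exact_mod_cast crossCocycle_trS_trT_neg.ne'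

end LowerBound

section Descent

variable {V : Type} (h : V → ℤ) (R : V → V → Prop)

/-- Connectedness through vertices of height below `H`. -/
def LowPath (H : ℤ) : V → V → Prop := Relation.ReflTransGen fun x y => R x y ∧ h x < H ∧ h y < H

/-- The function propagated from height zero along a choice of descending neighbours. -/
noncomputable def descend (down : V → V) (base : V → ℚ) (hdown : ∀ a, 0 < h a → h (down a) < h a)
    (a : V) : ℚ :=
  if _ha : 0 < h a then descend down base hdown (down a) else base a
termination_by (h a).toNat
decreasing_by
  have := hdown a _ha
  omega

variable {h R}

theorem LowPath.symm {H : ℤ} (hR : ∀ x y, R x y → R y x) {x y : V} (p : LowPath h R H x y) :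
    LowPath h R H y x := by
  induction p with
  | refl => exact Relation.ReflTransGen.refl
  | tail _ hst ih => exact ih.head ⟨hR _ _ hst.1, hst.2.2, hst.2.1⟩

/-- A function on the vertices of height zero extends to a locally constant function when
descending links are nonempty and connected. -/
theorem exists_extension_of_descent (h0 : ∀ a, 0 ≤ h a) (hR : ∀ x y, R x y → R y x)
    (hnonempty : ∀ a, 0 < h a → ∃ c, R a c ∧ h c < h a)
    (hconn : ∀ a c c', R a c → h c < h a → R a c' → h c' < h a → LowPath h R (h a) c c')
    (hlevel : ∀ a b, R a b → h a = h b → 0 < h a →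
      ∃ c c', R a c ∧ h c < h a ∧ R b c' ∧ h c' < h a ∧ LowPath h R (h a) c c')
    (base : V → ℚ) (hbase : ∀ a b, R a b → h a = 0 → h b = 0 → base a = base b) :
    ∃ Ψ : V → ℚ, (∀ a, h a = 0 → Ψ a = base a) ∧ ∀ a b, R a b → Ψ a = Ψ b := by
  classical
  choose! down hdownR hdown using hnonempty
  let Ψ := descend h down base hdown
  have hΨ0 : ∀ a, h a = 0 → Ψ a = base a := fun a ha => by
    simp only [Ψ]
    rw [descend, dif_neg (by omega)]
  have hΨd : ∀ a, 0 < h a → Ψ a = Ψ (down a) := fun a ha => by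
    simp only [Ψ]
    rw [descend, dif_pos ha]
  have key : ∀ N : ℕ, ∀ a b, R a b → h a ≤ N → h b ≤ N → Ψ a = Ψ b := by
    intro N
    induction N with
    | zero =>
      intro a b hab ha hb
      have ha0 : h a = 0 := le_antisymm (by simpa using ha) (h0 a)
      have hb0 : h b = 0 := le_antisymm (by simpa using hb) (h0 b)
      rw [hΨ0 a ha0, hΨ0 b hb0, hbase a b hab ha0 hb0]
    | succ N ih =>
      push_cast at ih ⊢
      have hpath : ∀ H : ℤ, H ≤ N + 1 → ∀ x y, LowPath h R H x y → Ψ x = Ψ y := by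
        intro H hH x y p
        induction p with
        | refl => rfl
        | tail _ hst ihp => exact ihp.trans (ih _ _ hst.1 (by linarith [hst.2.1]) (by linarith [hst.2.2]))
      have hstep : ∀ a b, R a b → h a ≤ N + 1 → h b < h a → Ψ a = Ψ b := by
        intro a b hab ha hba
        have hpos : 0 < h a := (h0 b).trans_lt hba
        rw [hΨd a hpos]
        exact hpath _ ha _ _ (hconn a _ _ (hdownR a hpos) (hdown a hpos) hab hba)
      intro a b hab ha hb
      rcases lt_trichotomy (h a) (h b) with hlt | heq | hlt
      · exact (hstep b a (hR _ _ hab) hb hlt).symm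
      · rcases (h0 a).eq_or_lt with hz | hpos
        · rw [hΨ0 a hz.symm, hΨ0 b (by omega), hbase a b hab hz.symm (by omega)]
        · obtain ⟨c, c', hac, hc, hbc, hc', p⟩ := hlevel a b hab heq hpos
          rw [hstep a c hac ha hc, hstep b c' hbc hb (heq ▸ hc'), hpath _ ha _ _ p]
      · exact hstep a b hab ha hlt
  refine ⟨Ψ, hΨ0, fun a b hab => key (max (h a) (h b)).toNat a b hab ?_ ?_⟩
  · rw [Int.toNat_of_nonneg (le_max_of_le_left (h0 a))]; exact le_max_left _ _
  · rw [Int.toNat_of_nonneg (le_max_of_le_left (h0 a))]; exact le_max_right _ _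

end Descent

section Gram

/-- Squared length of the bottom row vector attached to `g` and the given type. -/
def gramN : Bool → Bianchi → ℤ
  | false, g => reMulStar (g 1 0) (g 1 0)
  | true, g => 3 * reMulStar (g 1 0) (g 1 0) + 2 * reMulStar (g 1 1) (g 1 1)
      + 12 * imMulStar (g 1 1) (g 1 0)

/-- Real part of the off-diagonal Gram entry. -/
def gramP : Bool → Bianchi → ℤ
  | false, g => reMulStar (g 1 1) (g 1 0)
  | true, g => -reMulStar (g 1 1) (g 1 0)

/-- Imaginary part of the off-diagonal Gram entry. -/
def gramQ : Bool → Bianchi → ℤ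
  | false, g => imMulStar (g 1 1) (g 1 0)
  | true, g => -(reMulStar (g 1 0) (g 1 0) + reMulStar (g 1 1) (g 1 1)
      + 5 * imMulStar (g 1 1) (g 1 0))

/-- The second diagonal Gram entry. -/
def gramN' : Bool → Bianchi → ℤ
  | false, g => reMulStar (g 1 1) (g 1 1)
  | true, g => 2 * reMulStar (g 1 0) (g 1 0) + 3 * reMulStar (g 1 1) (g 1 1)
      + 12 * imMulStar (g 1 1) (g 1 0)

theorem gramN_not (i : Bool) (g : Bianchi) :
    gramN (!i) g = 3 * gramN i g + 2 * gramN' i g + 12 * gramQ i g := by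
  cases i <;> simp only [gramN, gramN', gramQ, Bool.not_true, Bool.not_false]
  ring

theorem gramP_not (i : Bool) (g : Bianchi) : gramP (!i) g = -gramP i g := by
  cases i <;> simp [gramP]

theorem gramQ_not (i : Bool) (g : Bianchi) :
    gramQ (!i) g = -(gramN i g + gramN' i g + 5 * gramQ i g) := by
  cases i <;> simp only [gramN, gramN', gramQ, Bool.not_true, Bool.not_false]
  ring

theorem gramN'_not (i : Bool) (g : Bianchi) :
    gramN' (!i) g = 2 * gramN i g + 3 * gramN' i g + 12 * gramQ i g := by
  cases i <;> simp only [gramN, gramN', gramQ, Bool.not_true, Bool.not_false]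
  ring

theorem gram_disc (i : Bool) (g : Bianchi) :
    gramN i g * gramN' i g = gramP i g ^ 2 + 6 * gramQ i g ^ 2 := by
  cases i <;> simp only [gramN, gramN', gramQ, gramP, reMulStar, imMulStar] <;> ring

theorem gramN_nonneg (i : Bool) (g : Bianchi) : 0 ≤ gramN i g := by
  cases i
  · exact reMulStar_self_nonneg _
  · simp only [gramN, reMulStar, imMulStar]
    nlinarith [sq_nonneg ((g 1 0).re + 2 * (g 1 1).im), sq_nonneg ((g 1 1).re - 3 * (g 1 0).im)]

/-- The order four rotation. -/
def rotJ : Bianchi := ⟨!![0, -1; 1, 0], by simp⟩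

@[simp] theorem rotJ_00 : rotJ 0 0 = 0 := rfl
@[simp] theorem rotJ_01 : rotJ 0 1 = -1 := rfl
@[simp] theorem rotJ_10 : rotJ 1 0 = 1 := rfl
@[simp] theorem rotJ_11 : rotJ 1 1 = 0 := rfl

/-- The two families of unipotent matrices. -/
def unipB : Bool → ℤ√(-6) → Bianchi
  | false, z => unip z
  | true, z => ⟨!![1 - z * ⟨0, 1⟩, -3 * z; -2 * z, 1 + z * ⟨0, 1⟩], by
      rw [Matrix.det_fin_two_of]
      ext <;> simp <;> ring⟩

@[simp] theorem unipB_false (z : ℤ√(-6)) : unipB false z = unip z := rfl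
@[simp] theorem unipB_true_00 (z : ℤ√(-6)) : unipB true z 0 0 = 1 - z * ⟨0, 1⟩ := rfl
@[simp] theorem unipB_true_01 (z : ℤ√(-6)) : unipB true z 0 1 = -3 * z := rfl
@[simp] theorem unipB_true_10 (z : ℤ√(-6)) : unipB true z 1 0 = -2 * z := rfl
@[simp] theorem unipB_true_11 (z : ℤ√(-6)) : unipB true z 1 1 = 1 + z * ⟨0, 1⟩ := rfl

theorem unipB_mul (i : Bool) (y z : ℤ√(-6)) : unipB i y * unipB i z = unipB i (y + z) := by
  cases i
  · exact unip_mul y z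
  · apply bianchi_ext <;> rw [mul_apply_two] <;> simp <;> ext <;> simp <;> ring

theorem gramN_mul_unipB (i : Bool) (g : Bianchi) (z : ℤ√(-6)) :
    gramN i (g * unipB i z) = gramN i g := by
  cases i <;> simp [gramN, mul_apply_two, reMulStar, imMulStar]
  ring

theorem gramP_mul_unipB (i : Bool) (g : Bianchi) (z : ℤ√(-6)) :
    gramP i (g * unipB i z) = gramP i g + gramN i g * z.re := by
  cases i <;> simp [gramN, gramP, mul_apply_two, reMulStar, imMulStar] <;> ring

theorem gramQ_mul_unipB (i : Bool) (g : Bianchi) (z : ℤ√(-6)) :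
    gramQ i (g * unipB i z) = gramQ i g + gramN i g * z.im := by
  cases i <;> simp [gramN, gramQ, mul_apply_two, reMulStar, imMulStar] <;> ring

theorem gramN'_mul_unipB (i : Bool) (g : Bianchi) (z : ℤ√(-6)) :
    gramN' i (g * unipB i z) = gramN' i g + 2 * gramP i g * z.re + 12 * gramQ i g * z.im
      + gramN i g * (z.re ^ 2 + 6 * z.im ^ 2) := by
  cases i <;> simp [gramN, gramN', gramP, gramQ, mul_apply_two, reMulStar, imMulStar] <;> ring

theorem gramN_mul_rotJ (i : Bool) (g : Bianchi) : gramN i (g * rotJ) = gramN' i g := by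
  cases i <;> simp [gramN, gramN', mul_apply_two, reMulStar, imMulStar] <;> ring

theorem gramQ_mul_rotJ (i : Bool) (g : Bianchi) : gramQ i (g * rotJ) = gramQ i g := by
  cases i <;> simp [gramQ, mul_apply_two, reMulStar, imMulStar] <;> ring

theorem gramP_mul_rotJ (i : Bool) (g : Bianchi) : gramP i (g * rotJ) = -gramP i g := by
  cases i <;> simp [gramP, mul_apply_two, reMulStar, imMulStar] <;> ring

theorem gramN'_mul_rotJ (i : Bool) (g : Bianchi) : gramN' i (g * rotJ) = gramN i g := by
  cases i <;> simp [gramN, gramN', mul_apply_two, reMulStar, imMulStar] <;> ring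

theorem gramN_neg (i : Bool) (g : Bianchi) : gramN i (-g) = gramN i g := by
  cases i <;> simp [gramN, reMulStar, imMulStar]

theorem eq_false_and_lower_left_of_gramN_eq_zero {i : Bool} {g : Bianchi} (h : gramN i g = 0) :
    i = false ∧ g 1 0 = 0 := by
  cases i
  · refine ⟨rfl, ?_⟩
    simp only [gramN, reMulStar] at h
    ext
    · simp only [Zsqrtd.re_zero]; nlinarith [sq_nonneg (g 1 0).re, sq_nonneg (g 1 0).im]
    · simp only [Zsqrtd.im_zero]; nlinarith [sq_nonneg (g 1 0).re, sq_nonneg (g 1 0).im]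
  · exfalso
    simp only [gramN, reMulStar, imMulStar] at h
    have h1 := det_re g
    have hc : (g 1 0).re = -2 * (g 1 1).im := by
      nlinarith [sq_nonneg ((g 1 0).re + 2 * (g 1 1).im), sq_nonneg ((g 1 1).re - 3 * (g 1 0).im)]
    have hd : (g 1 1).re = 3 * (g 1 0).im := by
      nlinarith [sq_nonneg ((g 1 0).re + 2 * (g 1 1).im), sq_nonneg ((g 1 1).re - 3 * (g 1 0).im)]
    have h2 := det_im g
    rw [hc, hd] at h1 h2
    generalize (g 0 0).re = a at *
    generalize (g 0 0).im = a' at *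
    generalize (g 0 1).re = b at *
    generalize (g 0 1).im = b' at *
    generalize (g 1 0).im = c' at *
    generalize (g 1 1).im = d' at *
    have h3 : (2 * d' ^ 2 + 3 * c' ^ 2) * (2 * (3 * a' - b) ^ 2 + 3 * (a + 2 * b') ^ 2) = 1 := by
      nlinarith
    have h4 : 2 * d' ^ 2 + 3 * c' ^ 2 = 1 := Int.eq_one_of_mul_eq_one_right (by positivity) h3
    rcases eq_or_ne c' 0 with rfl | h
    · omega
    · have := sq_pos_of_ne_zero h
      nlinarith [sq_nonneg d']

end Gram

section Splitting

/-- A central extension of `SL₂(ℤ[√-6])` by `ℚ` with lifts of generators satisfying the same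
relations as the generators. -/
structure LiftData (E : Type) [Group E] where
  π : E →* Bianchi
  ι : Multiplicative ℚ →* E
  ι_injective : Function.Injective ι
  ι_central : ∀ q x, ι q * x = x * ι q
  π_ι : ∀ q, π (ι q) = 1
  exists_ι : ∀ x, π x = 1 → ∃ q, ι q = x
  eps : E
  J : E
  T : Bool → E
  S : Bool → E
  π_eps : π eps = -1
  π_J : π J = rotJ
  π_T : ∀ i, π (T i) = unipB i 1
  π_S : ∀ i, π (S i) = unipB i ⟨0, 1⟩
  eps_central : ∀ x, eps * x = x * eps
  eps_sq : eps * eps = 1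
  J_sq : J * J = eps
  T_J : ∀ i, T i * J * (T i * J) * (T i * J) = 1 ∨ T i * J * (T i * J) * (T i * J) = eps
  T_S : ∀ i, T i * S i = S i * T i
  S_J : ∀ i, S i * J * (S i)⁻¹ = S (!i) * J * (S (!i))⁻¹
  T_T : ∀ i, T (!i) * T i * (T (!i) * T i) = eps

namespace LiftData

variable {E : Type} [Group E] (D : LiftData E)

/-- The elements `T^a S^b`. -/
def U (i : Bool) (a b : ℤ) : E := D.T i ^ a * D.S i ^ b

theorem commute_T_S (i : Bool) (a b : ℤ) : Commute (D.T i ^ a) (D.S i ^ b) :=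
  (show Commute (D.T i) (D.S i) from D.T_S i).zpow_zpow a b

theorem commute_eps (k : ℤ) (x : E) : Commute (D.eps ^ k) x :=
  (show Commute D.eps x from D.eps_central x).zpow_left k

theorem U_mul (i : Bool) (a b a' b' : ℤ) :
    D.U i a b * D.U i a' b' = D.U i (a + a') (b + b') := by
  unfold U
  rw [(D.commute_T_S i a' b).symm.mul_mul_mul_comm, _root_.zpow_add, _root_.zpow_add]

theorem U_zero (i : Bool) : D.U i 0 0 = 1 := by simp [U]

theorem T_eq (i : Bool) : D.T i = D.U i 1 0 := by simp [U]

theorem S_eq (i : Bool) : D.S i = D.U i 0 1 := by simp [U]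

theorem U_inv (i : Bool) (a b : ℤ) : (D.U i a b)⁻¹ = D.U i (-a) (-b) := by
  rw [inv_eq_iff_mul_eq_one, U_mul, add_neg_cancel, add_neg_cancel, U_zero]

theorem unipB_zpow (i : Bool) (z : ℤ√(-6)) (a : ℤ) : unipB i z ^ a = unipB i (a * z) := by
  have h0 : unipB i 0 = 1 := by
    have := unipB_mul i 0 0
    rwa [add_zero, mul_eq_left] at this
  induction a with
  | zero => simp [h0]
  | succ n ih => rw [_root_.zpow_add_one, ih, unipB_mul]; congr 1; push_cast; ring
  | pred n ih =>
    rw [_root_.zpow_sub_one, ih, mul_inv_eq_iff_eq_mul, unipB_mul]; congr 1; push_cast; ring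

theorem π_U (i : Bool) (a b : ℤ) : D.π (D.U i a b) = unipB i ⟨a, b⟩ := by
  rw [U, map_mul, map_zpow, map_zpow, π_T, π_S, unipB_zpow, unipB_zpow, unipB_mul]
  congr 1
  ext <;> simp

/-- The stabilizer subgroup of a cusp-type vertex. -/
def stab (i : Bool) : Subgroup E where
  carrier := {x | ∃ k a b : ℤ, x = D.eps ^ k * D.U i a b}
  mul_mem' := by
    rintro _ _ ⟨k, a, b, rfl⟩ ⟨k', a', b', rfl⟩
    exact ⟨k + k', a + a', b + b', by
      rw [(D.commute_eps k' (D.U i a b)).symm.mul_mul_mul_comm, _root_.zpow_add, U_mul]⟩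
  one_mem' := ⟨0, 0, 0, by simp [U_zero]⟩
  inv_mem' := by
    rintro _ ⟨k, a, b, rfl⟩
    exact ⟨-k, -a, -b, by rw [_root_.mul_inv_rev, ← _root_.zpow_neg, U_inv, (D.commute_eps _ _).eq]⟩

theorem U_mem (i : Bool) (a b : ℤ) : D.U i a b ∈ D.stab i := ⟨0, a, b, by simp⟩

theorem T_mem (i : Bool) : D.T i ∈ D.stab i := D.T_eq i ▸ D.U_mem i 1 0

theorem S_mem (i : Bool) : D.S i ∈ D.stab i := D.S_eq i ▸ D.U_mem i 0 1

theorem eps_mem (i : Bool) : D.eps ∈ D.stab i := ⟨1, 0, 0, by simp [U_zero]⟩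

theorem J_inv : D.J⁻¹ = D.eps * D.J := by
  rw [inv_eq_iff_mul_eq_one, ← mul_assoc, ← D.eps_central, mul_assoc, D.J_sq, D.eps_sq]

/-- The edges between vertices. -/
inductive Rel : Bool × E → Bool × E → Prop
  | same {i : Bool} {e e' σ : E} (hσ : σ ∈ D.stab i) (h : e' = e * σ) : Rel (i, e) (i, e')
  | flip {i : Bool} {e e' σ τ : E} (hσ : σ ∈ D.stab i) (hτ : τ ∈ D.stab i)
      (h : e' = e * σ * D.J * τ) : Rel (i, e) (i, e')
  | cross {i j : Bool} {e e' σ τ : E} (hij : j = !i) (hσ : σ ∈ D.stab i) (hτ : τ ∈ D.stab j)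
      (h : e' = e * σ * τ) : Rel (i, e) (j, e')

variable {D}

theorem Rel.symm {v w : Bool × E} (h : D.Rel v w) : D.Rel w v := by
  cases h with
  | same hσ h => exact .same (inv_mem hσ) (by rw [h, mul_inv_cancel_right])
  | @flip i _ _ σ τ hσ hτ h =>
    refine .flip (σ := τ⁻¹ * D.eps) (τ := σ⁻¹) (mul_mem (inv_mem hτ) (D.eps_mem i)) (inv_mem hσ) ?_
    have h1 (x : E) : D.eps * (D.J * x) = D.J⁻¹ * x := by rw [D.J_inv, mul_assoc]
    simp [h, h1, mul_assoc]
  | cross hij hσ hτ h =>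
    exact .cross (by simp [hij]) (inv_mem hτ) (inv_mem hσ) (by rw [h]; group)

theorem Rel.mul_right {v : Bool × E} {i : Bool} {e ρ : E} (h : D.Rel v (i, e))
    (hρ : ρ ∈ D.stab i) : D.Rel v (i, e * ρ) := by
  cases h with
  | same hσ h => exact .same (mul_mem hσ hρ) (by rw [h, mul_assoc])
  | flip hσ hτ h => exact .flip hσ (mul_mem hτ hρ) (by rw [h, mul_assoc])
  | cross hij hσ hτ h => exact .cross hij hσ (mul_mem hτ hρ) (by rw [h, mul_assoc])

theorem Rel.mul_left {v : Bool × E} {i : Bool} {e ρ : E} (h : D.Rel (i, e) v)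
    (hρ : ρ ∈ D.stab i) : D.Rel (i, e * ρ) v :=
  (h.symm.mul_right hρ).symm

theorem Rel.of_mul_left {v : Bool × E} {i : Bool} {e ρ : E} (h : D.Rel (i, e * ρ) v)
    (hρ : ρ ∈ D.stab i) : D.Rel (i, e) v := by
  simpa using h.mul_left (inv_mem hρ)

variable (D)

/-- The height of a vertex. -/
def ht (v : Bool × E) : ℤ := gramN v.1 (D.π v.2)

theorem ht_nonneg (v : Bool × E) : 0 ≤ D.ht v := gramN_nonneg _ _

theorem π_eps_zpow (k : ℤ) : D.π (D.eps ^ k) = 1 ∨ D.π (D.eps ^ k) = -1 := by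
  rw [map_zpow, D.π_eps]
  rcases Int.even_or_odd k with h | h
  · left; exact h.neg_one_zpow
  · right; exact h.neg_one_zpow

theorem ht_mul {i : Bool} {e ρ : E} (hρ : ρ ∈ D.stab i) : D.ht (i, e * ρ) = D.ht (i, e) := by
  obtain ⟨k, a, b, rfl⟩ := hρ
  unfold ht
  simp only [map_mul]
  rw [← mul_assoc, π_U, gramN_mul_unipB]
  rcases D.π_eps_zpow k with h | h <;> rw [h]
  · rw [mul_one]
  · rw [mul_neg_one, gramN_neg]

/-- Vertices at the far end of a `J`-edge. -/
def evenV (i : Bool) (e : E) (a b : ℤ) : Bool × E := (i, e * D.U i a b * D.J)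

/-- Vertices at the far end of a type-changing edge. -/
def oddV (i : Bool) (e : E) (a b : ℤ) : Bool × E := (!i, e * D.U i a b)

theorem rel_evenV (i : Bool) (e : E) (a b : ℤ) : D.Rel (i, e) (D.evenV i e a b) :=
  .flip (D.U_mem i a b) (one_mem _) (mul_one _).symm

theorem rel_oddV (i : Bool) (e : E) (a b : ℤ) : D.Rel (i, e) (D.oddV i e a b) :=
  .cross rfl (D.U_mem i a b) (one_mem _) (mul_one _).symm

/-- Every neighbour has the form `evenV` or `oddV` up to the stabilizer, or is equivalent to the
vertex itself. -/
theorem Rel.cases_pos {i : Bool} {e : E} {v : Bool × E} (h : D.Rel (i, e) v) :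
    (∃ σ ∈ D.stab i, v = (i, e * σ)) ∨
      ∃ w : Bool × E, ∃ τ ∈ D.stab w.1, v = (w.1, w.2 * τ) ∧
        ∃ a b, w = D.evenV i e a b ∨ w = D.oddV i e a b := by
  cases h with
  | same hσ h => left; exact ⟨_, hσ, by rw [h]⟩
  | flip hσ hτ h =>
    right
    obtain ⟨k, a, b, rfl⟩ := hσ
    refine ⟨D.evenV i e a b, D.eps ^ k * _, mul_mem (zpow_mem (D.eps_mem i) k) hτ, ?_, a, b, .inl rfl⟩
    rw [h, evenV]
    simp only [Prod.mk.injEq, true_and, ← mul_assoc]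
    rw [mul_assoc _ D.J (D.eps ^ k), ← (D.commute_eps k D.J).eq, mul_assoc e,
      (D.commute_eps k (D.U i a b)).eq]
    simp only [mul_assoc]
  | @cross _ j _ _ σ τ hij hσ hτ h =>
    right
    obtain ⟨k, a, b, rfl⟩ := hσ
    subst hij
    refine ⟨D.oddV i e a b, D.eps ^ k * _, mul_mem (zpow_mem (D.eps_mem (!i)) k) hτ, ?_, a, b,
      .inr rfl⟩
    rw [h, oddV]
    simp only [Prod.mk.injEq, true_and, ← mul_assoc]
    rw [mul_assoc e, (D.commute_eps k (D.U i a b)).eq]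
    simp only [mul_assoc]

theorem ht_evenV (i : Bool) (e : E) (a b : ℤ) :
    D.ht (D.evenV i e a b) = gramN' i (D.π e) + 2 * gramP i (D.π e) * a
      + 12 * gramQ i (D.π e) * b + gramN i (D.π e) * (a ^ 2 + 6 * b ^ 2) := by
  simp only [ht, evenV, map_mul, D.π_J, π_U]
  rw [gramN_mul_rotJ, gramN'_mul_unipB]

theorem ht_oddV (i : Bool) (e : E) (a b : ℤ) :
    D.ht (D.oddV i e a b) = 3 * gramN i (D.π e)
      + 2 * (gramN' i (D.π e) + 2 * gramP i (D.π e) * a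
        + 12 * gramQ i (D.π e) * b + gramN i (D.π e) * (a ^ 2 + 6 * b ^ 2))
      + 12 * (gramQ i (D.π e) + gramN i (D.π e) * b) := by
  simp only [ht, oddV, map_mul, π_U]
  rw [gramN_not, gramN_mul_unipB, gramN'_mul_unipB, gramQ_mul_unipB]

/-- Two vertices have a common neighbour that is low as soon as they are. -/
def Link (H : ℤ) (x y : Bool × E) : Prop :=
  ∃ z, D.Rel x z ∧ D.Rel y z ∧ (D.ht x ≤ H → D.ht y < H → D.ht z < H)

theorem link_T (i : Bool) (e : E) (a b H : ℤ) :
    D.Link H (D.evenV i e a b) (D.evenV i e (a + 1) b) ∧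
      D.Link H (D.evenV i e (a + 1) b) (D.evenV i e a b) := by
  have h : D.Rel (D.evenV i e a b) (D.evenV i e (a + 1) b) := by
    have hz : ∃ z ∈ D.stab i, (∀ x, z * x = x * z) ∧
        D.T i * D.J * (D.T i * D.J) * (D.T i * D.J) = z := by
      rcases D.T_J i with h | h
      · exact ⟨1, one_mem _, fun x => by simp, h⟩
      · exact ⟨_, D.eps_mem i, D.eps_central, h⟩
    obtain ⟨z, hz, hzc, hzT⟩ := hz
    have hJ : ∀ x, D.J * (D.J * x) = D.eps * x := fun x => by rw [← mul_assoc, D.J_sq]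
    have hJe : ∀ x, D.J * (D.eps * x) = D.eps * (D.J * x) := fun x => by
      rw [← mul_assoc, ← D.eps_central, mul_assoc]
    have hTe : ∀ x, D.T i * (D.eps * x) = D.eps * (D.T i * x) := fun x => by
      rw [← mul_assoc, ← D.eps_central, mul_assoc]
    have hee : ∀ x, D.eps * (D.eps * x) = x := fun x => by rw [← mul_assoc, D.eps_sq, one_mul]
    have key : D.J * (z * (D.T i)⁻¹) * D.J * (D.T i)⁻¹ = D.T i * D.J := by
      rw [← mul_assoc D.J, ← hzc, ← hzT]
      simp only [mul_assoc, hJ, hJe, hTe, mul_inv_cancel, mul_one]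
      rw [← D.eps_central D.J, hTe, hee]
    have hU : D.U i (a + 1) b = D.U i a b * D.T i := by
      rw [D.T_eq, U_mul, add_zero]
    refine .flip (mul_mem hz (inv_mem (D.T_mem i))) (inv_mem (D.T_mem i)) ?_
    rw [hU, mul_assoc, mul_assoc, ← key]
    simp only [mul_assoc]
  exact ⟨⟨_, h, .same (one_mem _) (mul_one _).symm, fun _ h => h⟩,
    ⟨_, h.symm, .same (one_mem _) (mul_one _).symm, fun _ h => h⟩⟩

theorem ht_flip (i : Bool) (f : E) :
    D.ht (!i, f * D.J) + D.ht (i, f) = D.ht (i, f * D.J) + D.ht (!i, f) := by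
  simp only [ht, map_mul, D.π_J]
  rw [gramN_mul_rotJ, gramN_mul_rotJ, gramN'_not, gramN_not]
  ring

theorem Link.of_parallelogram {H : ℤ} {x y z : Bool × E} (hx : D.Rel x z) (hy : D.Rel y z)
    (h : D.ht z + H = D.ht x + D.ht y) : D.Link H x y ∧ D.Link H y x :=
  ⟨⟨z, hx, hy, fun _ _ => by linarith⟩, ⟨z, hy, hx, fun _ _ => by linarith⟩⟩

theorem link_even_odd (i : Bool) (e : E) (a b : ℤ) :
    D.Link (D.ht (i, e)) (D.evenV i e a b) (D.oddV i e a b) ∧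
      D.Link (D.ht (i, e)) (D.oddV i e a b) (D.evenV i e a b) := by
  refine Link.of_parallelogram D (z := (!i, e * D.U i a b * D.J)) ?_ ?_ ?_
  · exact .cross rfl (one_mem _) (one_mem _) (by simp)
  · exact .flip (one_mem _) (one_mem _) (by simp)
  · rw [← D.ht_mul (e := e) (D.U_mem i a b), D.ht_flip]
    rfl

theorem link_even_odd_pred (i : Bool) (e : E) (a b : ℤ) :
    D.Link (D.ht (i, e)) (D.evenV i e a b) (D.oddV i e a (b - 1)) ∧
      D.Link (D.ht (i, e)) (D.oddV i e a (b - 1)) (D.evenV i e a b) := by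
  have hU : D.U i a (b - 1) = D.U i a b * (D.S i)⁻¹ := by
    rw [D.S_eq, U_inv, U_mul]; congr 1; ring
  refine Link.of_parallelogram D (z := (!i, e * D.U i a b * D.J * (D.S i)⁻¹)) ?_ ?_ ?_
  · exact .cross rfl (inv_mem (D.S_mem i)) (one_mem _) (by simp)
  · refine .flip (D.S_mem (!i)) (inv_mem (D.S_mem (!i))) ?_
    calc _ = e * D.U i a b * (D.S i)⁻¹ * (D.S i * D.J * (D.S i)⁻¹) := by group
      _ = _ := by rw [D.S_J, hU]; simp only [mul_assoc]
  · rw [← D.ht_mul (e := e) (D.U_mem i a b)]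
    simp only [ht, evenV, oddV, hU, D.S_eq, U_inv, map_mul, D.π_J, π_U]
    rw [gramN_not, gramN_not]
    simp only [← mul_assoc, gramN_mul_unipB, gramN'_mul_unipB, gramQ_mul_unipB, gramN_mul_rotJ,
      gramN'_mul_rotJ, gramQ_mul_rotJ, gramP_mul_rotJ, gramP_mul_unipB]
    ring

theorem link_odd_odd (i : Bool) (e : E) (a b : ℤ) :
    D.Link (D.ht (i, e)) (D.oddV i e a b) (D.oddV i e (a + 1) b) ∧
      D.Link (D.ht (i, e)) (D.oddV i e (a + 1) b) (D.oddV i e a b) := by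
  have hU : D.U i (a + 1) b = D.U i a b * D.T i := by
    rw [D.T_eq, U_mul, add_zero]
  refine Link.of_parallelogram D (z := (i, e * D.U i a b * (D.T (!i))⁻¹)) ?_ ?_ ?_
  · exact .cross (by simp) (inv_mem (D.T_mem (!i))) (one_mem _) (by simp)
  · refine .cross (by simp) (mul_mem (D.eps_mem (!i)) (D.T_mem (!i))) (D.T_mem i) ?_
    have h : D.T i * (D.eps * D.T (!i)) * D.T i = (D.T (!i))⁻¹ := by
      rw [eq_inv_iff_mul_eq_one, mul_eq_one_comm, ← mul_assoc, ← mul_assoc, ← mul_assoc,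
        ← D.eps_central, mul_assoc, mul_assoc, mul_assoc, ← mul_assoc (D.T !i), D.T_T, D.eps_sq]
    rw [hU, ← h]
    simp only [mul_assoc]
  · rw [← D.ht_mul (e := e) (D.U_mem i a b)]
    simp only [ht, oddV, hU, D.T_eq, U_inv, map_mul, π_U]
    have h2 := gramN_not (!i) (D.π e * unipB i ⟨a, b⟩ * unipB (!i) ⟨-1, -0⟩)
    rw [Bool.not_not] at h2
    rw [h2]
    simp only [← mul_assoc, gramN_mul_unipB, gramN'_mul_unipB, gramQ_mul_unipB, gramP_mul_unipB,
      gramN_not, gramN'_not, gramP_not, gramQ_not]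
    ring

end LiftData

end Splitting

section Reduction

/-- Remainders of least absolute value. -/
theorem exists_reduced (p : ℤ) {n : ℤ} (hn : 0 < n) :
    ∃ a : ℤ, -n ≤ 2 * (p + n * a) ∧ 2 * (p + n * a) ≤ n := by
  refine ⟨-((2 * p + n) / (2 * n)), ?_⟩
  have h1 := Int.emod_add_mul_ediv (2 * p + n) (2 * n)
  have h2 := Int.emod_nonneg (2 * p + n) (show 2 * n ≠ 0 by omega)
  have h3 := Int.emod_lt_of_pos (2 * p + n) (show 0 < 2 * n by omega)
  generalize (2 * p + n) / (2 * n) = k at *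
  constructor <;> nlinarith

theorem sq_le_four_mul_sq {n y : ℤ} (hn : 0 < n) (h : n ≤ 2 * y ∨ 2 * y ≤ -n) :
    n ^ 2 ≤ 4 * y ^ 2 := by
  rcases h with h | h <;> nlinarith

theorem four_mul_sq_le_sq {n y : ℤ} (h : -n ≤ 2 * y) (h' : 2 * y ≤ n) :
    4 * y ^ 2 ≤ n ^ 2 := by
  nlinarith

/-- Gram data of a reduced frame. -/
structure ReducedGram (n p q n' : ℤ) : Prop where
  pos : 0 < n
  disc : n * n' = p ^ 2 + 6 * q ^ 2
  p_ge : -n ≤ 2 * p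
  p_le : 2 * p ≤ n
  q_ge : -n ≤ 2 * q
  q_le : 2 * q ≤ n

/-- Heights at the far ends of `J`-edges. -/
def evenHt (n p q n' a b : ℤ) : ℤ := n' + 2 * p * a + 12 * q * b + n * (a ^ 2 + 6 * b ^ 2)

/-- Heights at the far ends of type-changing edges. -/
def oddHt (n p q n' a b : ℤ) : ℤ := 3 * n + 2 * evenHt n p q n' a b + 12 * (q + n * b)

namespace ReducedGram

variable {n p q n' : ℤ} (h : ReducedGram n p q n')

include h

theorem mul_evenHt (a b : ℤ) :
    n * evenHt n p q n' a b = (p + n * a) ^ 2 + 6 * (q + n * b) ^ 2 := by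
  unfold evenHt
  linear_combination h.disc

theorem mul_oddHt (a b : ℤ) :
    n * oddHt n p q n' a b = 2 * (p + n * a) ^ 2 + 3 * (2 * (q + n * b) + n) ^ 2 := by
  unfold oddHt
  linear_combination 2 * h.mul_evenHt a b

theorem shift_p {a : ℤ} (ha : ¬(a = -1 ∨ a = 0 ∨ a = 1)) : 9 * n ^ 2 ≤ 4 * (p + n * a) ^ 2 := by
  have hn := h.pos
  have := h.p_ge
  have := h.p_le
  have : 2 ≤ a ∨ a ≤ -2 := by omega
  have := sq_le_four_mul_sq (n := 3 * n) (y := p + n * a) (by omega) (by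
    rcases this with h | h
    · left; nlinarith
    · right; nlinarith)
  linarith

theorem even_bound {a b : ℤ} (hE : evenHt n p q n' a b ≤ n) :
    b = 0 ∧ (a = -1 ∨ a = 0 ∨ a = 1) := by
  have hn := h.pos
  have := h.q_ge
  have := h.q_le
  have h1 := h.mul_evenHt a b
  have h2 : n * evenHt n p q n' a b ≤ n ^ 2 := by nlinarith
  constructor
  · by_contra hb
    have hb : 1 ≤ b ∨ b ≤ -1 := by omega
    have := sq_le_four_mul_sq (n := n) (y := q + n * b) hn (by
      rcases hb with h | h
      · left; nlinarith
      · right; nlinarith)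
    nlinarith [sq_nonneg (p + n * a)]
  · by_contra ha
    nlinarith [h.shift_p ha, sq_nonneg (q + n * b)]

theorem odd_bound {a b : ℤ} (hO : oddHt n p q n' a b ≤ n) :
    (b = 0 ∨ b = -1) ∧ (a = -1 ∨ a = 0 ∨ a = 1) := by
  have hn := h.pos
  have := h.q_ge
  have := h.q_le
  have h1 := h.mul_oddHt a b
  have h2 : n * oddHt n p q n' a b ≤ n ^ 2 := by nlinarith
  constructor
  · by_contra hb
    have hb : 1 ≤ b ∨ b ≤ -2 := by omega
    have := sq_le_four_mul_sq (n := 4 * n) (y := 2 * (q + n * b) + n) (by omega) (by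
      rcases hb with h | h
      · left; nlinarith
      · right; nlinarith)
    nlinarith [sq_nonneg (p + n * a)]
  · by_contra ha
    nlinarith [h.shift_p ha, sq_nonneg (2 * (q + n * b) + n)]

theorem cross_nonneg (a : ℤ) : 0 ≤ 2 * p * a + n * a ^ 2 := by
  have hn := h.pos
  have := h.p_ge
  have := h.p_le
  rcases lt_trichotomy a 0 with ha | rfl | ha
  · nlinarith [mul_nonneg (show 0 ≤ -a by omega) (show 0 ≤ -a - 1 by omega)]
  · simp
  · nlinarith [mul_nonneg (show 0 ≤ a by omega) (show 0 ≤ a - 1 by omega)]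

omit h in
theorem evenHt_eq_add (a b : ℤ) :
    evenHt n p q n' a b = evenHt n p q n' 0 b + (2 * p * a + n * a ^ 2) := by
  unfold evenHt; ring

omit h in
theorem oddHt_eq_add (a b : ℤ) :
    oddHt n p q n' a b = oddHt n p q n' 0 b + 2 * (2 * p * a + n * a ^ 2) := by
  unfold oddHt evenHt; ring

theorem odd_exclusive {a a' : ℤ} (hO : oddHt n p q n' a 0 ≤ n) (hO' : oddHt n p q n' a' (-1) ≤ n) :
    False := by
  have hn := h.pos
  have h1 := h.mul_oddHt a 0
  have h2 := h.mul_oddHt a' (-1)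
  have h3 : n * oddHt n p q n' a 0 ≤ n ^ 2 := by nlinarith
  have h4 : n * oddHt n p q n' a' (-1) ≤ n ^ 2 := by nlinarith
  nlinarith [sq_nonneg (p + n * a), sq_nonneg (p + n * a'), sq_nonneg q]

theorem exists_lt : evenHt n p q n' 0 0 < n ∨ ∃ b, (b = 0 ∨ b = -1) ∧ oddHt n p q n' 0 b < n := by
  have hn := h.pos
  have hp := four_mul_sq_le_sq h.p_ge h.p_le
  by_contra! hc
  obtain ⟨hE, hO⟩ := hc
  have h0 := hO 0 (by simp)
  have h1 := hO (-1) (by simp)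
  have hE' := h.mul_evenHt 0 0
  have h0' := h.mul_oddHt 0 0
  have h1' := h.mul_oddHt 0 (-1)
  have e1 : n ^ 2 ≤ n * evenHt n p q n' 0 0 := by nlinarith
  have e2 : n ^ 2 ≤ n * oddHt n p q n' 0 0 := by nlinarith
  have e3 : n ^ 2 ≤ n * oddHt n p q n' 0 (-1) := by nlinarith
  have e4 : n ^ 2 ≤ 8 * q ^ 2 := by nlinarith
  have := h.q_ge
  have := h.q_le
  rcases le_total 0 q with hq | hq
  · have : 3 * q ≥ n := by nlinarith
    nlinarith
  · have : 3 * -q ≥ n := by nlinarith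
    nlinarith

end ReducedGram

end Reduction

namespace LiftData

variable {E : Type} [Group E] (D : LiftData E)

/-- Gram data of `π e` is reduced. -/
def IsReduced (i : Bool) (e : E) : Prop :=
  ReducedGram (gramN i (D.π e)) (gramP i (D.π e)) (gramQ i (D.π e)) (gramN' i (D.π e))

theorem exists_isReduced {i : Bool} {e : E} (h : 0 < D.ht (i, e)) :
    ∃ ρ ∈ D.stab i, D.IsReduced i (e * ρ) := by
  change 0 < gramN i (D.π e) at h
  obtain ⟨a, ha, ha'⟩ := exists_reduced (gramP i (D.π e)) h
  obtain ⟨b, hb, hb'⟩ := exists_reduced (gramQ i (D.π e)) h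
  refine ⟨D.U i a b, D.U_mem i a b, ?_⟩
  constructor
  all_goals simp only [map_mul, π_U]
  · rwa [gramN_mul_unipB]
  · exact gram_disc _ _
  all_goals simpa only [gramN_mul_unipB, gramP_mul_unipB, gramQ_mul_unipB]

variable {D}

theorem ht_evenV' (i : Bool) (e : E) (a b : ℤ) : D.ht (D.evenV i e a b) =
    evenHt (gramN i (D.π e)) (gramP i (D.π e)) (gramQ i (D.π e)) (gramN' i (D.π e)) a b :=
  D.ht_evenV i e a b

theorem ht_oddV' (i : Bool) (e : E) (a b : ℤ) : D.ht (D.oddV i e a b) =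
    oddHt (gramN i (D.π e)) (gramP i (D.π e)) (gramQ i (D.π e)) (gramN' i (D.π e)) a b :=
  D.ht_oddV i e a b

theorem ht_eq (i : Bool) (e : E) : D.ht (i, e) = gramN i (D.π e) := rfl

theorem Link.lowPath {H : ℤ} {x y : Bool × E} (h : D.Link H x y) (hx : D.ht x < H)
    (hy : D.ht y < H) : LowPath D.ht D.Rel H x y := by
  obtain ⟨z, hxz, hyz, hz⟩ := h
  have hz := hz hx.le hy
  exact (Relation.ReflTransGen.single ⟨hxz, hx, hz⟩).tail ⟨hyz.symm, hz, hy⟩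

/-- The three neighbours that minimize the height. -/
def IsCenter (i : Bool) (e : E) (w : Bool × E) : Prop :=
  w = D.evenV i e 0 0 ∨ w = D.oddV i e 0 0 ∨ w = D.oddV i e 0 (-1)

namespace IsReduced

variable {i : Bool} {e : E} (h : D.IsReduced i e)

include h

theorem exists_center : ∃ w, D.IsCenter i e w ∧ D.ht w < D.ht (i, e) := by
  rcases ReducedGram.exists_lt h with h | ⟨b, rfl | rfl, h⟩
  · exact ⟨_, .inl rfl, by rwa [ht_evenV']⟩
  · exact ⟨_, .inr (.inl rfl), by rwa [ht_oddV']⟩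
  · exact ⟨_, .inr (.inr rfl), by rwa [ht_oddV']⟩

theorem lowPath_centers {w w' : Bool × E} (hw : D.IsCenter i e w) (hw' : D.IsCenter i e w')
    (hlt : D.ht w < D.ht (i, e)) (hlt' : D.ht w' < D.ht (i, e)) :
    LowPath D.ht D.Rel (D.ht (i, e)) w w' := by
  rcases hw with rfl | rfl | rfl <;> rcases hw' with rfl | rfl | rfl
  · exact .refl
  · exact (D.link_even_odd i e 0 0).1.lowPath hlt hlt'
  · exact (D.link_even_odd_pred i e 0 0).1.lowPath hlt hlt'
  · exact (D.link_even_odd i e 0 0).2.lowPath hlt hlt'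
  · exact .refl
  · rw [ht_oddV'] at hlt hlt'
    exact (ReducedGram.odd_exclusive h hlt.le hlt'.le).elim
  · exact (D.link_even_odd_pred i e 0 0).2.lowPath hlt hlt'
  · rw [ht_oddV'] at hlt hlt'
    exact (ReducedGram.odd_exclusive h hlt'.le hlt.le).elim
  · exact .refl

omit h in
theorem link_even_zero {a : ℤ} (ha : a = -1 ∨ a = 1) (H : ℤ) :
    D.Link H (D.evenV i e a 0) (D.evenV i e 0 0) := by
  rcases ha with rfl | rfl
  · exact (D.link_T i e (-1) 0 H).1
  · exact (D.link_T i e 0 0 H).2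

omit h in
theorem link_odd_zero {a : ℤ} (ha : a = -1 ∨ a = 1) (b : ℤ) :
    D.Link (D.ht (i, e)) (D.oddV i e a b) (D.oddV i e 0 b) := by
  rcases ha with rfl | rfl
  · exact (D.link_odd_odd i e (-1) b).1
  · exact (D.link_odd_odd i e 0 b).2

theorem lowPath_center {w : Bool × E} {a b : ℤ} (hw : w = D.evenV i e a b ∨ w = D.oddV i e a b)
    (hlt : D.ht w < D.ht (i, e)) : ∃ w', D.IsCenter i e w' ∧ D.ht w' < D.ht (i, e) ∧
      LowPath D.ht D.Rel (D.ht (i, e)) w w' := by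
  have hc := ReducedGram.cross_nonneg h a
  rcases hw with rfl | rfl
  · have hb := hlt
    rw [ht_evenV'] at hb
    obtain ⟨rfl, ha⟩ := ReducedGram.even_bound h hb.le
    have hlt' : D.ht (D.evenV i e 0 0) < D.ht (i, e) := by
      rw [ht_evenV']
      rw [ReducedGram.evenHt_eq_add] at hb
      linarith
    refine ⟨_, .inl rfl, hlt', ?_⟩
    rcases eq_or_ne a 0 with rfl | ha0
    · exact .refl
    · exact (link_even_zero (by tauto) _).lowPath hlt hlt'
  · have hb := hlt
    rw [ht_oddV'] at hb
    obtain ⟨hb', ha⟩ := ReducedGram.odd_bound h hb.le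
    have hlt' : D.ht (D.oddV i e 0 b) < D.ht (i, e) := by
      rw [ht_oddV']
      rw [ReducedGram.oddHt_eq_add] at hb
      linarith
    refine ⟨D.oddV i e 0 b, .inr (by rcases hb' with rfl | rfl <;> simp), hlt', ?_⟩
    rcases eq_or_ne a 0 with rfl | ha0
    · exact .refl
    · exact (link_odd_zero (by tauto) _).lowPath hlt hlt'

theorem exists_link_of_level {w : Bool × E} {a b : ℤ}
    (hw : w = D.evenV i e a b ∨ w = D.oddV i e a b) (hlv : D.ht w = D.ht (i, e)) :
    ∃ y, D.Rel (i, e) y ∧ D.ht y < D.ht (i, e) ∧ D.Link (D.ht (i, e)) w y := by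
  have hc := ReducedGram.cross_nonneg h a
  rcases hw with rfl | rfl
  · have hb := hlv
    rw [ht_evenV'] at hb
    obtain ⟨rfl, ha⟩ := ReducedGram.even_bound h hb.le
    rw [ReducedGram.evenHt_eq_add] at hb
    rcases ReducedGram.exists_lt h with hlt | ⟨b, hb', hlt⟩
    · have ha0 : a ≠ 0 := by
        rintro rfl
        change _ = gramN i (D.π e) at hb
        simp at hb
        omega
      exact ⟨_, D.rel_evenV i e 0 0, by rwa [ht_evenV'], link_even_zero (by tauto) _⟩
    · by_cases hlt0 : evenHt (gramN i (D.π e)) (gramP i (D.π e)) (gramQ i (D.π e))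
        (gramN' i (D.π e)) 0 0 < gramN i (D.π e)
      · have ha0 : a ≠ 0 := by
          rintro rfl
          change _ = gramN i (D.π e) at hb
          simp at hb
          omega
        exact ⟨_, D.rel_evenV i e 0 0, by rwa [ht_evenV'], link_even_zero (by tauto) _⟩
      · have hlt' : D.ht (D.oddV i e a b) < D.ht (i, e) := by
          rw [ht_oddV', ReducedGram.oddHt_eq_add]
          rw [ht_eq] at hb ⊢
          linarith
        refine ⟨_, D.rel_oddV i e a b, hlt', ?_⟩
        rcases hb' with rfl | rfl
        · exact (D.link_even_odd i e a 0).1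
        · exact (D.link_even_odd_pred i e a 0).1
  · have hb := hlv
    rw [ht_oddV'] at hb
    obtain ⟨hb', ha⟩ := ReducedGram.odd_bound h hb.le
    have hb0 := hb
    rw [ReducedGram.oddHt_eq_add] at hb
    by_cases hlt0 : oddHt (gramN i (D.π e)) (gramP i (D.π e)) (gramQ i (D.π e))
        (gramN' i (D.π e)) 0 b < gramN i (D.π e)
    · have ha0 : a ≠ 0 := by
        rintro rfl
        change _ = gramN i (D.π e) at hb
        simp at hb
        omega
      exact ⟨_, D.rel_oddV i e 0 b, by rwa [ht_oddV'], link_odd_zero (by tauto) _⟩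
    · have hlt : evenHt (gramN i (D.π e)) (gramP i (D.π e)) (gramQ i (D.π e))
          (gramN' i (D.π e)) 0 0 < gramN i (D.π e) := by
        rcases ReducedGram.exists_lt h with hlt | ⟨b', hb'', hlt⟩
        · exact hlt
        · exfalso
          rcases hb' with rfl | rfl <;> rcases hb'' with rfl | rfl
          · exact hlt0 hlt
          · exact ReducedGram.odd_exclusive h hb0.le hlt.le
          · exact ReducedGram.odd_exclusive h hlt.le hb0.le
          · exact hlt0 hlt
      have hlt' : D.ht (D.evenV i e a 0) < D.ht (i, e) := by
        rw [ht_evenV', ReducedGram.evenHt_eq_add]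
        rw [ht_eq] at hb ⊢
        linarith
      refine ⟨_, D.rel_evenV i e a 0, hlt', ?_⟩
      rcases hb' with rfl | rfl
      · exact (D.link_even_odd i e a 0).2
      · exact (D.link_even_odd_pred i e a 0).2

end IsReduced

theorem exists_rel_lt {v : Bool × E} (hv : 0 < D.ht v) : ∃ c, D.Rel v c ∧ D.ht c < D.ht v := by
  obtain ⟨i, e⟩ := v
  obtain ⟨ρ, hρ, hr⟩ := D.exists_isReduced hv
  obtain ⟨w, hw, hlt⟩ := hr.exists_center
  rw [D.ht_mul hρ] at hlt
  refine ⟨w, Rel.of_mul_left ?_ hρ, hlt⟩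
  rcases hw with rfl | rfl | rfl
  · exact D.rel_evenV _ _ _ _
  · exact D.rel_oddV _ _ _ _
  · exact D.rel_oddV _ _ _ _

theorem lowPath_of_rel {v c c' : Bool × E} (hc : D.Rel v c) (hlt : D.ht c < D.ht v)
    (hc' : D.Rel v c') (hlt' : D.ht c' < D.ht v) : LowPath D.ht D.Rel (D.ht v) c c' := by
  obtain ⟨i, e⟩ := v
  obtain ⟨ρ, hρ, hr⟩ := D.exists_isReduced ((D.ht_nonneg c).trans_lt hlt)
  have key : ∀ c, D.Rel (i, e) c → D.ht c < D.ht (i, e) → ∃ w, D.IsCenter i (e * ρ) w ∧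
      D.ht w < D.ht (i, e) ∧ LowPath D.ht D.Rel (D.ht (i, e)) c w := by
    intro c hc hlt
    rcases (hc.mul_left hρ).cases_pos with ⟨σ, hσ, rfl⟩ | ⟨w, τ, hτ, rfl, a, b, hw⟩
    · rw [D.ht_mul hσ, D.ht_mul hρ] at hlt
      exact (lt_irrefl _ hlt).elim
    · have hwlt : D.ht w < D.ht (i, e) := by rwa [D.ht_mul hτ] at hlt
      obtain ⟨w', hw', hlt', hp⟩ := hr.lowPath_center hw (by rwa [D.ht_mul hρ])
      rw [D.ht_mul hρ] at hlt' hp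
      exact ⟨w', hw', hlt', hp.head ⟨.same (inv_mem hτ) (by simp), hlt, hwlt⟩⟩
  obtain ⟨w, hw, hwlt, hp⟩ := key c hc hlt
  obtain ⟨w', hw', hwlt', hp'⟩ := key c' hc' hlt'
  have := hr.lowPath_centers hw hw'
  rw [D.ht_mul hρ] at this
  exact (hp.trans (this hwlt hwlt')).trans (hp'.symm fun _ _ h => h.symm)

theorem exists_lowPath_of_level {v u : Bool × E} (hvu : D.Rel v u) (hlv : D.ht v = D.ht u)
    (hpos : 0 < D.ht v) : ∃ c c', D.Rel v c ∧ D.ht c < D.ht v ∧ D.Rel u c' ∧ D.ht c' < D.ht v ∧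
      LowPath D.ht D.Rel (D.ht v) c c' := by
  obtain ⟨i, e⟩ := v
  obtain ⟨ρ, hρ, hr⟩ := D.exists_isReduced hpos
  rcases (hvu.mul_left hρ).cases_pos with ⟨σ, hσ, rfl⟩ | ⟨w, τ, hτ, rfl, a, b, hw⟩
  · obtain ⟨c, hc, hlt⟩ := exists_rel_lt hpos
    exact ⟨c, c, hc, hlt, (hc.mul_left hρ).mul_left hσ, hlt, .refl⟩
  · rw [D.ht_mul hτ] at hlv
    obtain ⟨y, hy, hlt, z, hwz, hyz, hz⟩ := hr.exists_link_of_level hw (by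
      rw [D.ht_mul hρ]; exact hlv.symm)
    rw [D.ht_mul hρ] at hlt hz
    have hz := hz hlv.symm.le hlt
    exact ⟨y, z, hy.of_mul_left hρ, hlt, hwz.mul_left hτ, hz, .single ⟨hyz, hlt, hz⟩⟩

end LiftData

namespace LiftData

variable {E : Type} [Group E] (D : LiftData E)

theorem π_eq_one_of_mem_stab {σ : E} (hσ : σ ∈ D.stab false) (h : D.π σ = 1) : σ = 1 := by
  obtain ⟨k, a, b, rfl⟩ := hσ
  have hne : (-1 : Bianchi) ≠ 1 := fun h => by
    have := congrArg (fun g : Bianchi => (g 0 0).re) h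
    simp at this
  rw [map_mul, π_U, map_zpow, D.π_eps] at h
  have hab : a = 0 ∧ b = 0 := by
    have h01 := congrArg (fun g : Bianchi => g 0 1) h
    rcases Int.even_or_odd k with hk | hk
    · rw [hk.neg_one_zpow] at h01
      simpa [Zsqrtd.ext_iff] using h01
    · rw [hk.neg_one_zpow] at h01
      simpa [Zsqrtd.ext_iff] using h01
  obtain ⟨rfl, rfl⟩ := hab
  rcases Int.even_or_odd k with ⟨m, rfl⟩ | hk
  · rw [U_zero, mul_one, ← two_mul, _root_.zpow_mul, zpow_two, D.eps_sq, _root_.one_zpow]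
  · rw [hk.neg_one_zpow] at h
    have hu : unipB false ⟨0, 0⟩ = 1 := by apply bianchi_ext <;> simp [Zsqrtd.ext_iff]
    rw [hu, mul_one] at h
    exact (hne h).elim

theorem exists_of_ht_eq_zero {v : Bool × E} (h : D.ht v = 0) :
    v.1 = false ∧ ∃ σ ∈ D.stab false, ∃ q, v.2 = σ * D.ι q := by
  obtain ⟨i, e⟩ := v
  obtain ⟨rfl, h⟩ := eq_false_and_lower_left_of_gramN_eq_zero h
  refine ⟨rfl, ?_⟩
  obtain ⟨ε, hε, h00, h11⟩ := exists_sign_of_lower_left_eq_zero h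
  have key : ∀ σ ∈ D.stab false, D.π σ = D.π e → ∃ σ ∈ D.stab false, ∃ q, e = σ * D.ι q := by
    intro σ hσ h
    obtain ⟨q, hq⟩ := D.exists_ι (σ⁻¹ * e) (by rw [map_mul, map_inv, h, inv_mul_cancel])
    exact ⟨σ, hσ, q, by rw [hq, mul_inv_cancel_left]⟩
  change D.π e 1 0 = 0 at h
  change D.π e 0 0 = _ at h00
  change D.π e 1 1 = _ at h11
  rcases (show ε = 1 ∨ ε = -1 by simpa using hε) with rfl | rfl
  · refine key _ (D.U_mem false (D.π e 0 1).re (D.π e 0 1).im) ?_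
    rw [π_U]
    apply bianchi_ext <;> simp [h, h00, h11]
  · refine key _ (mul_mem (D.eps_mem false) (D.U_mem false (-(D.π e 0 1).re) (-(D.π e 0 1).im))) ?_
    rw [map_mul, D.π_eps, π_U]
    apply bianchi_ext <;> simp [h, h00, h11]
    ext <;> simp

/-- The value carried by a vertex of height zero. -/
noncomputable def base (v : Bool × E) : ℚ := by
  classical exact
    if h : ∃ q, ∃ σ ∈ D.stab false, v.2 = σ * D.ι q then Multiplicative.toAdd h.choose else 0

theorem base_eq {i : Bool} {σ : E} (hσ : σ ∈ D.stab false) (q : Multiplicative ℚ) :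
    D.base (i, σ * D.ι q) = Multiplicative.toAdd q := by
  have h : ∃ r, ∃ τ ∈ D.stab false, ((i, σ * D.ι q) : Bool × E).2 = τ * D.ι r := ⟨q, σ, hσ, rfl⟩
  rw [base, dif_pos h]
  obtain ⟨τ, hτ, hr⟩ := h.choose_spec
  generalize h.choose = r at hr
  congr 1
  apply D.ι_injective
  have h1 : τ⁻¹ * σ = D.ι (r * q⁻¹) := by
    rw [map_mul, map_inv, inv_mul_eq_iff_eq_mul, ← mul_assoc, ← hr, mul_inv_cancel_right]
  have h2 := D.π_eq_one_of_mem_stab (mul_mem (inv_mem hτ) hσ) (by rw [h1, D.π_ι])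
  rw [inv_mul_eq_one] at h2
  rw [h2] at hr
  exact (mul_left_cancel hr).symm

theorem base_eq_of_rel {v w : Bool × E} (hvw : D.Rel v w) (hv : D.ht v = 0) (hw : D.ht w = 0) :
    D.base v = D.base w := by
  obtain ⟨hi, σ, hσ, q, hq⟩ := D.exists_of_ht_eq_zero hv
  have hw1 := (D.exists_of_ht_eq_zero hw).1
  cases hvw with
  | @same i e e' τ hτ h =>
    subst hi
    change e = _ at hq
    rw [h, hq, D.base_eq hσ, mul_assoc, D.ι_central, ← mul_assoc, D.base_eq (mul_mem hσ hτ)]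
  | @flip i e e' τ ρ hτ hρ h =>
    exfalso
    subst hi
    rw [← D.ht_mul hτ] at hv
    rw [h, D.ht_mul hρ] at hw
    have h1 := (eq_false_and_lower_left_of_gramN_eq_zero hv).2
    have h2 := (eq_false_and_lower_left_of_gramN_eq_zero hw).2
    obtain ⟨ε, hε, -, h11⟩ := exists_sign_of_lower_left_eq_zero h1
    change D.π (e * τ * D.J) 1 0 = 0 at h2
    change D.π (e * τ) 1 1 = _ at h11
    rw [map_mul D.π (e * τ), D.π_J, mul_apply_two, h11] at h2
    simp at h2
    simp [h2] at hε
  | cross hij =>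
    dsimp only at hi hw1
    rw [hi, hw1] at hij
    simp at hij

/-- The central extension splits. -/
theorem exists_retraction : ∃ χ : E → ℚ, (∀ x y, χ (x * y) = χ x + χ y) ∧
    ∀ q : ℚ, χ (D.ι (Multiplicative.ofAdd q)) = q := by
  obtain ⟨Ψ, hΨ0, hΨ⟩ := exists_extension_of_descent D.ht_nonneg (fun _ _ h => Rel.symm h)
    (fun _ => exists_rel_lt) (fun _ _ _ => lowPath_of_rel) (fun _ _ => exists_lowPath_of_level)
    D.base (fun _ _ => D.base_eq_of_rel)
  let K : Subgroup E :=
    { carrier := {x | ∀ e, Ψ (false, e * x) = Ψ (false, e)}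
      mul_mem' := fun {x y} hx hy e => by rw [← mul_assoc, hy, hx]
      one_mem' := fun e => by rw [mul_one]
      inv_mem' := fun {x} hx e => by rw [← hx, inv_mul_cancel_right] }
  have hflip : ∀ i e, Ψ (i, e) = Ψ (false, e) := by
    intro i e
    cases i
    · rfl
    · exact hΨ _ _ (.cross rfl (one_mem _) (one_mem _) (by simp))
  have hstab : ∀ i, ∀ σ ∈ D.stab i, σ ∈ K := fun i σ hσ e => by
    rw [← hflip i, ← hflip i]
    exact (hΨ _ _ (.same hσ rfl)).symm
  have hJ : D.J ∈ K := fun e =>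
    (hΨ _ _ (.flip (one_mem _) (one_mem _) (by simp))).symm
  have hrel : ∀ v w, D.Rel v w → ∃ k ∈ K, w.2 = v.2 * k := by
    intro v w h
    cases h with
    | same hσ h => exact ⟨_, hstab _ _ hσ, h⟩
    | flip hσ hτ h =>
      exact ⟨_, mul_mem (mul_mem (hstab _ _ hσ) hJ) (hstab _ _ hτ), by rw [h]; simp only [mul_assoc]⟩
    | cross hij hσ hτ h =>
      exact ⟨_, mul_mem (hstab _ _ hσ) (hstab _ _ hτ), by rw [h, mul_assoc]⟩
  have hgen : ∀ N : ℕ, ∀ v, D.ht v ≤ N → ∃ k ∈ K, ∃ q, v.2 = k * D.ι q := by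
    intro N
    induction N with
    | zero =>
      intro v hv
      obtain ⟨-, σ, hσ, q, hq⟩ :=
        D.exists_of_ht_eq_zero (le_antisymm (by simpa using hv) (D.ht_nonneg v))
      exact ⟨σ, hstab _ _ hσ, q, hq⟩
    | succ N ih =>
      intro v hv
      rcases (D.ht_nonneg v).eq_or_lt with h0 | hpos
      · exact ih v (by rw [← h0]; positivity)
      · obtain ⟨c, hvc, hlt⟩ := exists_rel_lt hpos
        push_cast at hv
        obtain ⟨k, hk, q, hq⟩ := ih c (by linarith)
        obtain ⟨k', hk', hc⟩ := hrel _ _ hvc.symm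
        exact ⟨k * k', mul_mem hk hk', q, by rw [hc, hq, mul_assoc, D.ι_central, mul_assoc]⟩
  have hgen : ∀ e, ∃ k ∈ K, ∃ q, e = k * D.ι q := fun e =>
    hgen (D.ht (false, e)).toNat (false, e) (by rw [Int.toNat_of_nonneg (D.ht_nonneg _)])
  have hval : ∀ k ∈ K, ∀ q, Ψ (false, k * D.ι q) = Multiplicative.toAdd q := by
    intro k hk q
    rw [← D.ι_central, hk, hΨ0, ← one_mul (D.ι q), D.base_eq (one_mem _)]
    change gramN _ _ = 0
    rw [D.π_ι]
    simp [gramN, reMulStar]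
  refine ⟨fun e => Ψ (false, e), fun x y => ?_, fun q => ?_⟩
  · obtain ⟨k, hk, q, rfl⟩ := hgen x
    obtain ⟨k', hk', q', rfl⟩ := hgen y
    have : k * D.ι q * (k' * D.ι q') = k * k' * D.ι (q * q') := by
      rw [map_mul, mul_assoc, ← mul_assoc (D.ι q), D.ι_central]
      simp only [mul_assoc]
    simp only
    rw [this, hval _ (mul_mem hk hk'), hval _ hk, hval _ hk', toAdd_mul]
  · have := hval 1 (one_mem _) (Multiplicative.ofAdd q)
    simpa using this

end LiftData

section Relations

theorem rotJ_sq : rotJ ^ 2 = -1 := by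
  rw [pow_two]
  apply bianchi_ext <;> simp [mul_apply_two]

theorem unipB_false_mul_rotJ_pow : (unipB false 1 * rotJ) ^ 3 = -1 := by
  simp only [pow_succ, pow_zero, one_mul]
  apply bianchi_ext <;> simp [mul_apply_two]

theorem unipB_true_mul_rotJ_pow : (unipB true 1 * rotJ) ^ 3 = 1 := by
  simp only [pow_succ, pow_zero, one_mul]
  apply bianchi_ext <;> simp [mul_apply_two, Zsqrtd.ext_iff]

theorem unipB_mul_unipB_pow : (unipB false 1 * unipB true 1) ^ 2 = -1 := by
  rw [pow_two]
  apply bianchi_ext <;> simp [mul_apply_two, Zsqrtd.ext_iff]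

theorem unipB_mul_rotJ_mul_unipB :
    unipB false ⟨0, 1⟩ * rotJ * unipB false ⟨0, -1⟩ =
      unipB true ⟨0, 1⟩ * rotJ * unipB true ⟨0, -1⟩ := by
  apply bianchi_ext <;> simp [mul_apply_two, Zsqrtd.ext_iff]

theorem unipB_inv (i : Bool) (z : ℤ√(-6)) : (unipB i z)⁻¹ = unipB i (-z) := by
  rw [inv_eq_iff_mul_eq_one, unipB_mul, add_neg_cancel]
  cases i <;> apply bianchi_ext <;> simp

end Relations

/-- In a group with `r² = R`, `k³ = K`, `(rk)³ = L` central, `L⁴ = K⁴ R⁶`. -/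
theorem tetrahedral_relation {G : Type} [Group G] {r k R K L : G} (hR : ∀ x, Commute R x)
    (hK : ∀ x, Commute K x) (hL : ∀ x, Commute L x) (hr : r ^ 2 = R) (hk : k ^ 3 = K)
    (hl : (r * k) ^ 3 = L) : L ^ 4 = K ^ 4 * R ^ 6 := by
  set b := k * r * k⁻¹ with hb
  set c := k ^ 2 * r * (k ^ 2)⁻¹ with hc
  set z := L * K⁻¹ with hz
  have hzc : ∀ x, Commute z x := fun x => (hL x).mul_left (hK x).inv_left
  have hb2 : b ^ 2 = R := by
    rw [hb, conj_pow, hr, ← (hR k).eq, mul_inv_cancel_right]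
  have hc2 : c ^ 2 = R := by
    rw [hc, conj_pow, hr, ← (hR _).eq, mul_inv_cancel_right]
  have habc : r * b * c = z := by
    rw [hz, ← hl, ← hk, hb, hc]
    simp only [pow_succ, pow_zero, one_mul]
    group
  have hab : (r * b) ^ 2 = z ^ 2 * R⁻¹ := by
    rw [← hc2, eq_mul_inv_of_mul_eq habc, (hzc c⁻¹).mul_pow, inv_pow]
  have hw : r * b * r⁻¹ = z ^ 2 * R⁻¹ ^ 3 * b := by
    have h1 : r⁻¹ = r * R⁻¹ := by rw [← hr]; group
    have h2 : b⁻¹ = b * R⁻¹ := by rw [← hb2]; group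
    rw [← mul_inv_eq_iff_eq_mul, h1, h2]
    have h3 : r * b * (r * R⁻¹) * (b * R⁻¹) = (r * b) ^ 2 * R⁻¹ * R⁻¹ := by
      clear_value b
      rw [mul_assoc, ← mul_assoc (r * R⁻¹), mul_assoc r R⁻¹, (hR b).inv_left.eq, pow_two]
      simp only [mul_assoc]
    rw [h3, hab]
    group
  have hw2 : R = (z ^ 2 * R⁻¹ ^ 3) ^ 2 * R := by
    have hcomm : Commute (z ^ 2 * R⁻¹ ^ 3) b :=
      ((hzc b).pow_left 2).mul_left ((hR b).inv_left.pow_left 3)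
    clear_value b
    calc R = r * b ^ 2 * r⁻¹ := by rw [hb2, ← (hR r).eq, mul_inv_cancel_right]
      _ = (z ^ 2 * R⁻¹ ^ 3 * b) ^ 2 := by rw [← hw, conj_pow]
      _ = _ := by rw [hcomm.mul_pow, hb2]
  have hw3 : (z ^ 2 * R⁻¹ ^ 3) ^ 2 = 1 := by
    rwa [eq_comm, mul_eq_right] at hw2
  rw [((hzc _).pow_left 2).mul_pow, ← pow_mul, ← pow_mul, inv_pow, mul_inv_eq_one] at hw3
  rw [eq_mul_of_mul_inv_eq hz.symm, (hzc K).mul_pow, hw3, ((hR _).pow_left 6).eq]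

/-- A central extension by the rational numbers. -/
structure CentralExt (E Q : Type) [Group E] [Group Q] where
  π : E →* Q
  ι : Multiplicative ℚ →* E
  ι_injective : Function.Injective ι
  ι_central : ∀ q x, ι q * x = x * ι q
  π_ι : ∀ q, π (ι q) = 1
  exists_ι : ∀ x, π x = 1 → ∃ q, ι q = x
  π_surjective : Function.Surjective π

namespace CentralExt

variable {E Q : Type} [Group E] [Group Q] (X : CentralExt E Q)

/-- The central element attached to a rational number. -/
def c (q : ℚ) : E := X.ι (Multiplicative.ofAdd q)

theorem c_commute (q : ℚ) (x : E) : Commute (X.c q) x := X.ι_central _ x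

theorem c_mul (p q : ℚ) : X.c p * X.c q = X.c (p + q) := by
  rw [c, c, ← map_mul]; rfl

theorem c_pow (q : ℚ) (n : ℕ) : X.c q ^ n = X.c (n * q) := by
  rw [c, ← map_pow, ← ofAdd_nsmul, nsmul_eq_mul]; rfl

theorem c_inv (q : ℚ) : (X.c q)⁻¹ = X.c (-q) := by
  rw [c, ← map_inv]; rfl

theorem c_zero : X.c 0 = 1 := by
  rw [c, ofAdd_zero, map_one]

theorem c_eq_one {q : ℚ} (h : X.c q = 1) : q = 0 := by
  rw [← X.c_zero] at h
  exact X.ι_injective h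

theorem π_c (q : ℚ) : X.π (X.c q) = 1 := X.π_ι _

theorem exists_c {x y : E} (h : X.π x = X.π y) : ∃ q, x = y * X.c q := by
  obtain ⟨q, hq⟩ := X.exists_ι (y⁻¹ * x) (by rw [map_mul, map_inv, h, inv_mul_cancel])
  exact ⟨Multiplicative.toAdd q, by rw [c, ofAdd_toAdd, hq, mul_inv_cancel_left]⟩

theorem exists_lift_pow {g : Q} {z : E} {n : ℕ} (hn : n ≠ 0) (hz : X.π z = g ^ n) :
    ∃ x, X.π x = g ∧ x ^ n = z := by
  obtain ⟨x, rfl⟩ := X.π_surjective g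
  rw [← map_pow] at hz
  obtain ⟨q, hq⟩ := X.exists_c hz
  refine ⟨x * X.c (q / n), by rw [map_mul, π_c, mul_one], ?_⟩
  rw [(X.c_commute _ x).symm.mul_pow, X.c_pow, hq]
  congr 2
  field_simp

theorem eq_of_pow_eq {x y : E} {n : ℕ} (hn : n ≠ 0) (h : X.π x = X.π y) (hxy : x ^ n = y ^ n) :
    x = y := by
  obtain ⟨q, rfl⟩ := X.exists_c h
  rw [(X.c_commute _ y).symm.mul_pow, mul_eq_left, X.c_pow] at hxy
  have := X.c_eq_one hxy
  have hq : q = 0 := by simpa [hn] using this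
  rw [hq, c_zero, mul_one]

end CentralExt

namespace CentralExt

variable {E : Type} [Group E] (X : CentralExt E Bianchi)

theorem exists_eps : ∃ eps : E, X.π eps = -1 ∧ eps ^ 2 = 1 ∧ ∀ x, Commute eps x := by
  obtain ⟨eps, h, h2⟩ := X.exists_lift_pow (g := -1) (z := 1) two_ne_zero (by simp)
  refine ⟨eps, h, h2, fun x => ?_⟩
  refine (mul_inv_eq_iff_eq_mul.mp (X.eq_of_pow_eq two_ne_zero ?_ ?_)).symm
  · simp [h]
  · rw [conj_pow, h2]; simp

/-- Lifts of the generators, normalized by all relations involving `J`. -/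
theorem exists_lifts : ∃ (eps J : E) (T S : Bool → E), X.π eps = -1 ∧ eps ^ 2 = 1 ∧
    (∀ x, Commute eps x) ∧ X.π J = rotJ ∧ J ^ 2 = eps ∧ (∀ i, X.π (T i) = unipB i 1) ∧
    (∀ i, X.π (S i) = unipB i ⟨0, 1⟩) ∧ (T false * J) ^ 3 = eps ∧ (T true * J) ^ 3 = 1 := by
  obtain ⟨eps, heps, heps2, hepsc⟩ := X.exists_eps
  obtain ⟨J, hJ, hJ2⟩ := X.exists_lift_pow (g := rotJ) (z := eps) two_ne_zero (by rw [heps, rotJ_sq])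
  obtain ⟨y, hy, hy3⟩ := X.exists_lift_pow (g := unipB false 1 * rotJ) (z := eps) three_ne_zero
    (by rw [heps, unipB_false_mul_rotJ_pow])
  obtain ⟨y', hy', hy3'⟩ := X.exists_lift_pow (g := unipB true 1 * rotJ) (z := 1) three_ne_zero
    (by rw [map_one, unipB_true_mul_rotJ_pow])
  choose S hS using fun i => X.π_surjective (unipB i ⟨0, 1⟩)
  refine ⟨eps, J, fun i => bif i then y' * J⁻¹ else y * J⁻¹, S, heps, heps2, hepsc, hJ, hJ2, ?_, hS,
    ?_, ?_⟩
  · rintro (_ | _) <;> simp [hy, hy', hJ]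
  · simpa using hy3
  · simpa using hy3'

theorem S_J_eq {eps J : E} {S : Bool → E} (hepsc : ∀ x, Commute eps x) (hJ : X.π J = rotJ)
    (hJ2 : J ^ 2 = eps) (hS : ∀ i, X.π (S i) = unipB i ⟨0, 1⟩) (i : Bool) :
    S i * J * (S i)⁻¹ = S (!i) * J * (S (!i))⁻¹ := by
  have key : S false * J * (S false)⁻¹ = S true * J * (S true)⁻¹ := by
    refine X.eq_of_pow_eq two_ne_zero ?_ ?_
    · simp only [map_mul, map_inv, hS, hJ, unipB_inv]
      exact unipB_mul_rotJ_mul_unipB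
    · rw [conj_pow, conj_pow, hJ2, ← (hepsc _).eq, ← (hepsc _).eq, mul_inv_cancel_right,
        mul_inv_cancel_right]
  cases i
  · exact key
  · exact key.symm

/-- The cube of `T⁻¹ J` for `T` with `(T J)³ = 1`. -/
theorem inv_mul_pow_three {eps J T : E} (heps2 : eps ^ 2 = 1) (hepsc : ∀ x, Commute eps x)
    (hJ2 : J ^ 2 = eps) (hT : (T * J) ^ 3 = 1) : (T⁻¹ * J) ^ 3 = eps := by
  have h1 : J = eps * J⁻¹ := by rw [← hJ2]; group
  have h2 : (T⁻¹ * J⁻¹) ^ 3 = 1 := by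
    have : T⁻¹ * J⁻¹ = J * (T * J)⁻¹ * J⁻¹ := by group
    rw [this, conj_pow, inv_pow, hT]
    group
  have h3 : T⁻¹ * J = eps * (T⁻¹ * J⁻¹) := by
    nth_rw 1 [h1]
    rw [← mul_assoc, ← (hepsc T⁻¹).eq, mul_assoc]
  rw [h3, (hepsc _).mul_pow, h2, mul_one, pow_succ, heps2, one_mul]

theorem T_T_eq {eps J : E} {T : Bool → E} (heps : X.π eps = -1) (heps2 : eps ^ 2 = 1)
    (hepsc : ∀ x, Commute eps x) (hJ2 : J ^ 2 = eps) (hT : ∀ i, X.π (T i) = unipB i 1)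
    (hT0 : (T false * J) ^ 3 = eps) (hT1 : (T true * J) ^ 3 = 1) :
    (T false * T true) ^ 2 = eps := by
  obtain ⟨q, hq⟩ := X.exists_c (x := (T false * T true) ^ 2) (y := eps) (by
    rw [map_pow, map_mul, hT, hT, unipB_mul_unipB_pow, heps])
  have hl : (T false * T true * (T false * J)) ^ 3 = X.c (3 * q) := by
    have h1 : T false * T true * (T false * J) = X.c q * (eps * ((T true)⁻¹ * J)) := by
      rw [← mul_assoc (X.c q), (X.c_commute _ _).eq, ← hq, pow_two]
      group
    rw [h1, (X.c_commute _ _).mul_pow, (hepsc _).mul_pow, inv_mul_pow_three heps2 hepsc hJ2 hT1,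
      ← pow_succ, pow_mul eps 2 2, heps2, one_pow, mul_one, X.c_pow]
    norm_num
  have h := tetrahedral_relation (fun x => (hepsc x).mul_left (X.c_commute q x)) hepsc
    (X.c_commute _) hq hT0 hl
  rw [(hepsc _).mul_pow, pow_mul eps 2 2, pow_mul eps 2 3, heps2, one_pow, one_pow, one_mul, one_mul,
    X.c_pow, X.c_pow, ← mul_inv_eq_one, X.c_inv, X.c_mul] at h
  have hq0 : q = 0 := by
    have := X.c_eq_one h
    push_cast at this
    linarith
  rw [hq, hq0, X.c_zero, mul_one]

theorem T_S_true_eq {eps J : E} {T S : Bool → E} (heps : X.π eps = -1) (heps2 : eps ^ 2 = 1)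
    (hepsc : ∀ x, Commute eps x) (hJ : X.π J = rotJ) (hJ2 : J ^ 2 = eps)
    (hT : ∀ i, X.π (T i) = unipB i 1) (hS : ∀ i, X.π (S i) = unipB i ⟨0, 1⟩)
    (hT0 : (T false * J) ^ 3 = eps) (hT1 : (T true * J) ^ 3 = 1)
    (h0 : Commute (T false) (S false)) : Commute (T true) (S true) := by
  obtain ⟨q, hq⟩ := X.exists_c (x := (S true)⁻¹ * T true * S true) (y := T true) (by
    simp only [map_mul, map_inv, hT, hS, unipB_inv, unipB_mul]
    congr 1)
  have hSJ := X.S_J_eq hepsc hJ hJ2 hS false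
  have hTT := X.T_T_eq heps heps2 hepsc hJ2 hT hT0 hT1
  set T' := (S false)⁻¹ * T true * S false with hT'
  have hr : (T false * T') ^ 2 = eps := by
    have : T false * T' = (S false)⁻¹ * (T false * T true) * (S false)⁻¹⁻¹ := by
      rw [hT', ← mul_assoc, ← mul_assoc, h0.inv_right.eq]
      group
    rw [this, conj_pow, hTT, ← (hepsc _).eq, mul_inv_cancel_right]
  have hcube : (T'⁻¹ * J) ^ 3 = eps * X.c (3 * -q) := by
    have h1 : T'⁻¹ * J = (S false)⁻¹ * ((T true)⁻¹ * (S false * J * (S false)⁻¹)) * (S false)⁻¹⁻¹ := by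
      rw [hT']; group
    have h2 : (T true)⁻¹ * (S true * J * (S true)⁻¹) =
        S true * (((S true)⁻¹ * T true * S true)⁻¹ * J) * (S true)⁻¹ := by group
    have h3 : (T true * X.c q)⁻¹ * J = X.c (-q) * ((T true)⁻¹ * J) := by
      rw [← (X.c_commute _ _).eq, _root_.mul_inv_rev, X.c_inv, (X.c_commute _ _).eq, mul_assoc,
        (X.c_commute _ _).eq, mul_assoc]
    have h4 (x : E) : x * (eps * X.c (3 * -q)) * x⁻¹ = eps * X.c (3 * -q) := by
      rw [← ((hepsc x).mul_left (X.c_commute _ x)).eq, mul_inv_cancel_right]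
    rw [h1, hSJ, Bool.not_false, h2, hq, h3, conj_pow, conj_pow, (X.c_commute _ _).mul_pow,
      inv_mul_pow_three heps2 hepsc hJ2 hT1, X.c_pow, (X.c_commute _ _).eq]
    push_cast
    rw [h4, h4]
  have hl : (T false * T' * (T false * J)) ^ 3 = X.c (3 * -q) := by
    have h1 : T false * T' * (T false * J) = eps * (T'⁻¹ * J) := by
      rw [← hr, pow_two]
      group
    rw [h1, (hepsc _).mul_pow, hcube, ← mul_assoc, ← pow_succ, pow_mul eps 2 2, heps2, one_pow,
      one_mul]
  have h := tetrahedral_relation hepsc hepsc (X.c_commute _) hr hT0 hl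
  rw [pow_mul eps 2 2, pow_mul eps 2 3, heps2, one_pow, one_pow, one_mul, X.c_pow] at h
  have hq0 : q = 0 := by simpa using X.c_eq_one h
  rw [hq0, X.c_zero, mul_one, mul_assoc, inv_mul_eq_iff_eq_mul] at hq
  exact hq

/-- A central extension in which commuting lifts exist splits. -/
theorem exists_retraction (h0 : ∀ x y, X.π x = trT → X.π y = trS → Commute x y) :
    ∃ χ : E → ℚ, (∀ x y, χ (x * y) = χ x + χ y) ∧ ∀ q, χ (X.c q) = q := by
  obtain ⟨eps, J, T, S, heps, heps2, hepsc, hJ, hJ2, hT, hS, hT0, hT1⟩ := X.exists_lifts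
  have hTS : ∀ i, Commute (T i) (S i) := by
    have h := h0 _ _ (hT false) (hS false)
    rintro (_ | _)
    · exact h
    · exact X.T_S_true_eq heps heps2 hepsc hJ hJ2 hT hS hT0 hT1 h
  have hTT := X.T_T_eq heps heps2 hepsc hJ2 hT hT0 hT1
  let D : LiftData E :=
    { π := X.π
      ι := X.ι
      ι_injective := X.ι_injective
      ι_central := X.ι_central
      π_ι := X.π_ι
      exists_ι := X.exists_ι
      eps := eps
      J := J
      T := T
      S := S
      π_eps := heps
      π_J := hJ
      π_T := hT
      π_S := hS
      eps_central := hepsc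
      eps_sq := by rw [← pow_two, heps2]
      J_sq := by rw [← pow_two, hJ2]
      T_J := by
        rintro (_ | _)
        · right; rw [← hT0]; simp only [pow_succ, pow_zero, one_mul]
        · left; rw [← hT1]; simp only [pow_succ, pow_zero, one_mul]
      T_S := fun i => (hTS i).eq
      S_J := X.S_J_eq hepsc hJ hJ2 hS
      T_T := by
        rintro (_ | _)
        · have : T true * T false = T true * (T false * T true) * (T true)⁻¹ := by group
          rw [← pow_two, Bool.not_false, this, conj_pow, hTT, ← (hepsc _).eq, mul_inv_cancel_right]
        · rw [← pow_two, Bool.not_true, hTT] }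
  exact D.exists_retraction

end CentralExt

section CocycleExtension

variable {G : Type} [Group G] {f : G → G → ℚ}

/-- The central extension of `G` by the rational numbers attached to a cocycle. -/
@[ext] structure CocycleExtension (hf : IsCocycle f) where
  base : G
  fiber : ℚ

namespace CocycleExtension

theorem cocycle_one_left (hf : IsCocycle f) (g : G) : f 1 g = f 1 1 := by
  have := hf 1 1 g
  simp only [one_mul] at this
  linarith

theorem cocycle_one_right (hf : IsCocycle f) (g : G) : f g 1 = f 1 1 := by
  have := hf g 1 1
  simp only [mul_one] at this
  linarith

variable (hf : IsCocycle f)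

instance : Mul (CocycleExtension hf) := ⟨fun x y => ⟨x.1 * y.1, x.2 + y.2 + f x.1 y.1⟩⟩

instance : One (CocycleExtension hf) := ⟨⟨1, -f 1 1⟩⟩

instance : Inv (CocycleExtension hf) := ⟨fun x => ⟨x.1⁻¹, -x.2 - f 1 1 - f x.1⁻¹ x.1⟩⟩

@[simp] theorem base_mul (x y : CocycleExtension hf) : (x * y).base = x.base * y.base := rfl
@[simp] theorem fiber_mul (x y : CocycleExtension hf) :
    (x * y).fiber = x.fiber + y.fiber + f x.base y.base := rfl
@[simp] theorem base_one : (1 : CocycleExtension hf).base = 1 := rfl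
@[simp] theorem fiber_one : (1 : CocycleExtension hf).fiber = -f 1 1 := rfl
@[simp] theorem base_inv (x : CocycleExtension hf) : x⁻¹.base = x.base⁻¹ := rfl
@[simp] theorem fiber_inv (x : CocycleExtension hf) :
    x⁻¹.fiber = -x.fiber - f 1 1 - f x.base⁻¹ x.base := rfl

instance : Group (CocycleExtension hf) :=
  Group.ofLeftAxioms
    (fun x y z => by
      ext
      · simp [mul_assoc]
      · simp only [fiber_mul, base_mul]
        linear_combination -hf x.base y.base z.base)
    (fun x => by
      ext
      · simp
      · simp [cocycle_one_left hf])
    (fun x => by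
      ext
      · simp
      · simp only [fiber_mul, fiber_inv, base_inv, fiber_one]
        ring)

/-- The extension as an abstract central extension. -/
def centralExt : CentralExt (CocycleExtension hf) G where
  π := { toFun := base, map_one' := rfl, map_mul' := fun _ _ => rfl }
  ι :=
    { toFun := fun q => ⟨1, Multiplicative.toAdd q - f 1 1⟩
      map_one' := by ext <;> simp
      map_mul' := fun p q => by
        ext
        · simp
        · simp only [fiber_mul, toAdd_mul]
          ring }
  ι_injective := fun p q h => by simpa using congrArg fiber h
  ι_central := fun q x => by
    ext
    · simp
    · simp [cocycle_one_left hf, cocycle_one_right hf, add_comm]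
  π_ι := fun _ => rfl
  exists_ι := fun x hx => ⟨Multiplicative.ofAdd (x.fiber + f 1 1), by
    ext
    · exact hx.symm
    · simp⟩
  π_surjective := fun g => ⟨⟨g, 0⟩, rfl⟩

/-- A retraction onto the centre exhibits the cocycle as a coboundary. -/
theorem isCoboundary_of_retraction {χ : CocycleExtension hf → ℚ}
    (hmul : ∀ x y, χ (x * y) = χ x + χ y) (hχ : ∀ q, χ ((centralExt hf).c q) = q) :
    IsCoboundary f := by
  refine ⟨fun g => χ ⟨g, 0⟩, fun g h => ?_⟩
  have key : (⟨g, 0⟩ * ⟨h, 0⟩ : CocycleExtension hf) = ⟨g * h, 0⟩ * (centralExt hf).c (f g h) := by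
    ext
    · exact (mul_one _).symm
    · change 0 + 0 + f g h = 0 + (f g h - f 1 1) + f (g * h) 1
      rw [cocycle_one_right hf (g * h)]
      ring
  have := congrArg χ key
  rw [hmul, hmul, hχ] at this
  linarith

end CocycleExtension

end CocycleExtension

theorem hasDetectingTorus_bianchi : HasDetectingTorus Bianchi := by
  refine ⟨trT, trS, by rw [unip_mul, unip_mul, add_comm], fun f hf hts => ?_, exists_cocycle_ne⟩
  obtain ⟨χ, hmul, hχ⟩ := (CocycleExtension.centralExt hf).exists_retraction (by
    rintro ⟨x, p⟩ ⟨y, q⟩ (rfl : x = trT) (rfl : y = trS)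
    refine CocycleExtension.ext ?_ ?_
    · change trT * trS = trS * trT
      rw [unip_mul, unip_mul, add_comm]
    · simp [hts, add_comm p])
  exact CocycleExtension.isCoboundary_of_retraction hf hmul hχ

end BianchiNegSix

/-- Let `𝓞` be the ring of integers of the imaginary quadratic field
`ℚ(√-6)` and `Γ = SL₂(𝓞)` the Bianchi group. Then the second group homology of `Γ` with
trivial rational coefficients satisfies `H₂(Γ; ℚ) ≅ ℚ`. -/
theorem second_rational_homology_of_bianchi_sqrt_neg_six
    (K : Type) [Field K] [NumberField K]
    (α : K) (hα : α ^ 2 = -(6 : K)) (hgen : Algebra.adjoin ℚ {α} = ⊤) :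
    Nonempty (groupHomology2 (Matrix.SpecialLinearGroup (Fin 2) (𝓞 K)) ≃ₗ[ℚ] ℚ) := by
  obtain ⟨e⟩ := BianchiNegSix.nonempty_ringEquiv_ringOfIntegers hα hgen
  exact (BianchiNegSix.hasDetectingTorus_bianchi.congr
    (BianchiNegSix.specialLinearGroupCongr e)).nonempty_equiv
end
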